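/- Let n ≥ 1 and 1 ≤ k ≤ n. Let Ψ be a nonzero vector in (ℂ²)^⊗(2n) satisfying H^{tw}_{2n}Ψ = E₀Ψ, where H^{tw}_{2n} is the twisted-periodic XXZ Hamiltonian at Δ = −1/2 with twist 2π/3 and E₀ is the smallest eigenvalue of H^{tw}_{2n}, and satisfying SᶻΨ = 0. Then the emptiness formation probabilities E(k) are nonzero and E(k−1)/E(k) = [(2k−2)!·(2k−1)!·(2n+k−1)!·(n−k)!] / [(k−1)!·(3k−2)!·(2n−k)!·(n+k−1)!]. -/

import Mathlib

noncomputable section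

/-- Spin configurations of a chain of length `N`; `true` = spin up `↑`. -/
abbrev Cfg (N : ℕ) := Fin N → Bool

/-- Pauli matrix `σ^x` in the basis `(↑,↓)`. -/
def sigmaX : Matrix Bool Bool ℂ := Matrix.of fun b c => if b = c then 0 else 1

/-- Pauli matrix `σ^y` in the basis `(↑,↓)`. -/
def sigmaY : Matrix Bool Bool ℂ :=
  Matrix.of fun b c => if b = c then 0 else if b then -Complex.I else Complex.I

/-- Pauli matrix `σ^z` in the basis `(↑,↓)`. -/
def sigmaZ : Matrix Bool Bool ℂ :=
  Matrix.of fun b c => if b = c then (if b then 1 else -1) else 0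

/-- `σ⁺ = σ^x + i σ^y`. -/
def sigmaP : Matrix Bool Bool ℂ := sigmaX + Complex.I • sigmaY

/-- `σ⁻ = σ^x − i σ^y`. -/
def sigmaM : Matrix Bool Bool ℂ := sigmaX - Complex.I • sigmaY

/-- A one-site operator `A` acting on the `i`-th tensor factor of `(ℂ²)^{⊗N}`. -/
def localOp (N : ℕ) (i : Fin N) (A : Matrix Bool Bool ℂ) : Matrix (Cfg N) (Cfg N) ℂ :=
  Matrix.of fun f g =>
    A (f i) (g i) * ∏ j ∈ Finset.univ.erase i, (if f j = g j then (1 : ℂ) else 0)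

/-- The cyclic successor `i+1` of a site index (mod `N`). -/
def cyc (N : ℕ) (i : Fin N) : Fin N :=
  ⟨(i.val + 1) % N, Nat.mod_lt _ (by have := i.isLt; omega)⟩

/-- Periodic XXZ Hamiltonian at `Δ = −1/2`:
`H_N = −(1/2)·Σ_{i=1}^{N} (σ^x_i σ^x_{i+1} + σ^y_i σ^y_{i+1} − (1/2) σ^z_i σ^z_{i+1})`,
site indices mod `N`. -/
def Hper (N : ℕ) : Matrix (Cfg N) (Cfg N) ℂ :=
  (-(1/2) : ℂ) • ∑ i : Fin N,
    (localOp N i sigmaX * localOp N (cyc N i) sigmaX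
      + localOp N i sigmaY * localOp N (cyc N i) sigmaY
      - (1/2 : ℂ) • (localOp N i sigmaZ * localOp N (cyc N i) sigmaZ))

/-- Total spin `Sᶻ = (1/2)·Σ_i σ^z_i`. -/
def Sz (N : ℕ) : Matrix (Cfg N) (Cfg N) ℂ := (1/2 : ℂ) • ∑ i : Fin N, localOp N i sigmaZ

/-- Projector onto spin up at site `i`: `p_i⁺ = (1 + σ^z_i)/2`. -/
def pUp (N : ℕ) (i : Fin N) : Matrix (Cfg N) (Cfg N) ℂ := (1/2 : ℂ) • (1 + localOp N i sigmaZ)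

/-- The product `Π_{i=1}^{k} p_i⁺` of projectors onto spin up at the first `k` sites. -/
def projProd (N k : ℕ) : Matrix (Cfg N) (Cfg N) ℂ :=
  (((List.finRange N).filter fun i : Fin N => decide (i.val < k)).map (pUp N)).prod

/-- Standard Hermitian inner product on `(ℂ²)^{⊗N}`. -/
def hermInner {N : ℕ} (v w : Cfg N → ℂ) : ℂ := ∑ f, (starRingEnd ℂ) (v f) * w f

/-- Emptiness formation probability `E(k) = ⟨Ψ, Π_{i=1}^k p_i⁺ Ψ⟩ / ⟨Ψ, Ψ⟩`. -/
def EFP {N : ℕ} (Ψ : Cfg N → ℂ) (k : ℕ) : ℂ :=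
  hermInner Ψ ((projProd N k).mulVec Ψ) / hermInner Ψ Ψ

/-- `ω = e^{2πi/3}`. -/
def omega3 : ℂ := Complex.exp (2 * Real.pi * Complex.I / 3)

/-- Twisted-periodic XXZ Hamiltonian at `Δ = −1/2` with twist `2π/3`:
`H^{tw}_N = −(1/2)·[ Σ_{i=1}^{N−1} (σ^x_i σ^x_{i+1} + σ^y_i σ^y_{i+1} − (1/2) σ^z_i σ^z_{i+1})
  + (1/2)(e^{2πi/3} σ⁺_N σ⁻_1 + e^{−2πi/3} σ⁻_N σ⁺_1) − (1/2) σ^z_N σ^z_1 ]`. -/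
def Htw (N : ℕ) (hN : 0 < N) : Matrix (Cfg N) (Cfg N) ℂ :=
  (-(1/2) : ℂ) • (
    (∑ i : Fin (N-1),
      (localOp N ⟨i.val, by have := i.isLt; omega⟩ sigmaX *
          localOp N ⟨i.val+1, by have := i.isLt; omega⟩ sigmaX
        + localOp N ⟨i.val, by have := i.isLt; omega⟩ sigmaY *
            localOp N ⟨i.val+1, by have := i.isLt; omega⟩ sigmaY
        - (1/2 : ℂ) • (localOp N ⟨i.val, by have := i.isLt; omega⟩ sigmaZ *
            localOp N ⟨i.val+1, by have := i.isLt; omega⟩ sigmaZ)))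
    + (1/2 : ℂ) • (omega3 • (localOp N ⟨N-1, by omega⟩ sigmaP * localOp N ⟨0, hN⟩ sigmaM)
        + (Complex.exp (-(2 * Real.pi * Complex.I / 3))) •
            (localOp N ⟨N-1, by omega⟩ sigmaM * localOp N ⟨0, hN⟩ sigmaP))
    - (1/2 : ℂ) • (localOp N ⟨N-1, by omega⟩ sigmaZ * localOp N ⟨0, hN⟩ sigmaZ))

/-- The symmetric bilinear form `(v,w) = Σ_a v_a w_a` (no complex conjugation). -/
def bilin {N : ℕ} (v w : Cfg N → ℂ) : ℂ := ∑ f, v f * w f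

/-- Pseudo emptiness formation probability `Ẽ(k) = (Ψ, Π_{i=1}^k p_i⁺ Ψ) / (Ψ, Ψ)`. -/
def pseudoEFP {N : ℕ} (Ψ : Cfg N → ℂ) (k : ℕ) : ℂ :=
  bilin Ψ ((projProd N k).mulVec Ψ) / bilin Ψ Ψ

namespace XXZ
open Polynomial Finset

/-- Recurrence coefficient of the Hahn-type polynomials `hahn`. -/
def hahnCoeff (n r : ℕ) : ℂ :=
  ((n : ℂ) ^ 2 - ((n : ℂ) - r) ^ 2) * (9 * ((n : ℂ) - r) ^ 2 - 1) /
    (4 * (4 * ((n : ℂ) - r) ^ 2 - 1))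

/-- Monic orthogonal polynomials for the weight `hahnWeight`. -/
def hahn (n : ℕ) : ℕ → ℂ[X]
  | 0 => 1
  | 1 => X - C (3 * n / 2 : ℂ)
  | r + 2 => (X - C (3 * n / 2 : ℂ)) * hahn n (r + 1) - C (hahnCoeff n (r + 1)) * hahn n r

lemma four_sq_sub_one_ne_zero (m : ℤ) : 4 * (m : ℂ) ^ 2 - 1 ≠ 0 := by
  have h : (4 * m ^ 2 - 1 : ℤ) ≠ 0 := by
    intro h
    have : (4 * m ^ 2) % 4 = 1 := by rw [show 4 * m ^ 2 = 1 by linarith]; norm_num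
    omega
  exact_mod_cast h

lemma hahn_natDegree_monic (n r : ℕ) :
    ((hahn n r).Monic ∧ (hahn n r).natDegree = r) ∧
      ((hahn n (r + 1)).Monic ∧ (hahn n (r + 1)).natDegree = r + 1) := by
  induction r with
  | zero =>
    refine ⟨⟨monic_one, natDegree_one⟩, ?_, ?_⟩
    · exact monic_X_sub_C _
    · exact natDegree_X_sub_C _
  | succ r ih =>
    obtain ⟨⟨h0, d0⟩, h1, d1⟩ := ih
    refine ⟨⟨h1, d1⟩, ?_⟩
    have hm : ((X - C (3 * n / 2 : ℂ)) * hahn n (r + 1)).Monic := (monic_X_sub_C _).mul h1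
    have hd : ((X - C (3 * n / 2 : ℂ)) * hahn n (r + 1)).natDegree = r + 2 := by
      rw [(monic_X_sub_C _).natDegree_mul h1, natDegree_X_sub_C, d1]; ring
    have hlt : (C (hahnCoeff n (r + 1)) * hahn n r).degree <
        ((X - C (3 * n / 2 : ℂ)) * hahn n (r + 1)).degree := by
      refine lt_of_le_of_lt (b := (hahn n r).degree) ?_ ?_
      · rw [← smul_eq_C_mul]; exact degree_smul_le _ _
      rw [degree_eq_natDegree h0.ne_zero, degree_eq_natDegree hm.ne_zero, hd, d0]
      exact_mod_cast (by omega : r < r + 2)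
    refine ⟨hm.sub_of_left hlt, ?_⟩
    change (_ - _ : ℂ[X]).natDegree = _
    rw [natDegree_eq_of_degree_eq (degree_sub_eq_left_of_degree_lt hlt), hd]

lemma hahn_monic (n r : ℕ) : (hahn n r).Monic := (hahn_natDegree_monic n r).1.1

lemma hahn_natDegree (n r : ℕ) : (hahn n r).natDegree = r := (hahn_natDegree_monic n r).1.2

lemma eval_hahn_succ_succ (n r : ℕ) (x : ℂ) :
    (hahn n (r + 2)).eval x =
      (x - 3 * n / 2) * (hahn n (r + 1)).eval x - hahnCoeff n (r + 1) * (hahn n r).eval x := by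
  simp [hahn]

lemma hahnCoeff_mul (n r : ℕ) : hahnCoeff n r * (4 * (4 * ((n : ℂ) - r) ^ 2 - 1)) =
    ((n : ℂ) ^ 2 - ((n : ℂ) - r) ^ 2) * (9 * ((n : ℂ) - r) ^ 2 - 1) := by
  have h : (4 * (4 * ((n : ℂ) - r) ^ 2 - 1)) ≠ 0 := by
    have := four_sq_sub_one_ne_zero ((n : ℤ) - r)
    push_cast at this
    exact mul_ne_zero (by norm_num) this
  rw [hahnCoeff, div_mul_cancel₀ _ h]

lemma hahn_shift (n r : ℕ) (x e : ℂ) (he : e ^ 2 = 1) :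
    (x - 3 * n / 2 + e * (1 - 3 * n / 2)) * (x - 3 * n / 2 + e * (2 - 3 * n / 2)) *
        (hahn n r).eval (x + 3 * e) =
      ((x - 3 * n / 2) ^ 2 + (3 * n / 2 - 1) * (3 * n / 2 - 2) + 9 * r * (r + 1 - 2 * n) / 2
          + 3 * e * (n - r) * (x - 3 * n / 2)) * (hahn n r).eval x
        + 3 * e * (2 * r + 1 - 2 * n) * (hahn n (r + 1)).eval x := by
  induction r using Nat.strong_induction_on with
  | _ r ih =>
    match r with
    | 0 =>
      simp only [hahn, eval_one, eval_sub, eval_X, eval_C, CharP.cast_eq_zero]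
      linear_combination ((1 - 3 * (n : ℂ) / 2) * (2 - 3 * n / 2)) * he
    | 1 =>
      have g1 := hahnCoeff_mul n 1
      rw [eval_hahn_succ_succ]
      simp only [hahn, eval_one, eval_sub, eval_X, eval_C]
      have k1 : (4 : ℂ) * (2 * ((n : ℂ) - 1) + 1) ≠ 0 := by
        have := four_sq_sub_one_ne_zero ((n : ℤ) - 1)
        push_cast at this
        intro h
        exact this (by linear_combination (2 * ((n : ℂ) - 1) - 1) / 4 * h)
      refine mul_left_cancel₀ k1 ?_
      push_cast at g1 ⊢
      rcases (show e = 1 ∨ e = -1 from by simpa using he) with rfl | rfl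
      · linear_combination -3 * g1
      · linear_combination 3 * g1
    | r + 2 =>
      have h0 := ih r (by omega)
      have h1 := ih (r + 1) (by omega)
      rw [eval_hahn_succ_succ, eval_hahn_succ_succ n (r+1), eval_hahn_succ_succ]
      rw [eval_hahn_succ_succ] at h1
      have g1 := hahnCoeff_mul n (r + 1)
      have g2 := hahnCoeff_mul n (r + 2)
      have k1 : (4 : ℂ) * (2 * ((n : ℂ) - (r + 1)) - 1) ≠ 0 := by
        have := four_sq_sub_one_ne_zero ((n : ℤ) - (r + 1))
        push_cast at this
        intro h
        exact this (by linear_combination (2 * ((n : ℂ) - (r + 1)) + 1) / 4 * h)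
      refine mul_left_cancel₀ k1 ?_
      generalize (hahn n r).eval x = p0 at *
      generalize (hahn n (r + 1)).eval x = p1 at *
      generalize (hahn n r).eval (x + 3 * e) = q0 at *
      generalize (hahn n (r + 1)).eval (x + 3 * e) = q1 at *
      rw [show r + 1 + 1 = r + 2 from rfl]
      generalize hahnCoeff n (r + 1) = c1 at *
      generalize hahnCoeff n (r + 2) = c2 at *
      push_cast at *
      rcases (show e = 1 ∨ e = -1 from by simpa using he) with rfl | rfl
      · linear_combination (4 : ℂ) * (2 * ((n : ℂ) - (r + 1)) - 1) *
          ((x - 3 * n / 2 + 3) * h1 - c1 * h0) + 3 * p1 * g1 - 3 * p1 * g2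
      · linear_combination (4 : ℂ) * (2 * ((n : ℂ) - (r + 1)) - 1) *
          ((x - 3 * n / 2 - 3) * h1 - c1 * h0) - 3 * p1 * g1 + 3 * p1 * g2

/-- Weight of the discrete functional `hahnFun`. -/
def hahnWeight (ζ : ℂ) (n x : ℕ) : ℂ :=
  (-ζ) ^ x / (x.factorial * (3 * n - 1 - x).factorial) * ∏ l ∈ range n, ((x : ℂ) - 3 * l)

/-- The linear functional `f ↦ ∑ w(x) f(x)` on polynomials. -/
def hahnFun (ζ : ℂ) (n : ℕ) : ℂ[X] →ₗ[ℂ] ℂ where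
  toFun f := ∑ x ∈ range (3 * n), hahnWeight ζ n x * f.eval (x : ℂ)
  map_add' f g := by simp [mul_add, sum_add_distrib]
  map_smul' c f := by simp [mul_sum]; refine sum_congr rfl fun _ _ => by ring

lemma hahnFun_apply (ζ : ℂ) (n : ℕ) (f : ℂ[X]) :
    hahnFun ζ n f = ∑ x ∈ range (3 * n), hahnWeight ζ n x * f.eval (x : ℂ) := rfl

lemma cube_eq_one {ζ : ℂ} (hζ : ζ ^ 2 + ζ + 1 = 0) : ζ ^ 3 = 1 := by
  linear_combination (ζ - 1) * hζ

lemma hahnWeight_shift {ζ : ℂ} (hζ : ζ ^ 2 + ζ + 1 = 0) (n x : ℕ) (hx : x < 3 * n) :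
    hahnWeight ζ (n + 1) (x + 3) * ((x + 2) * (x + 1)) =
      hahnWeight ζ (n + 1) x * ((x - 3 * n - 2) * (x - 3 * n - 1)) := by
  obtain ⟨m, hm⟩ : ∃ m, 3 * n = x + m + 1 := ⟨3 * n - x - 1, by omega⟩
  have hmc : (3 * n : ℂ) = x + m + 1 := by exact_mod_cast hm
  have e1 : 3 * (n + 1) - 1 - (x + 3) = m := by omega
  have e2 : 3 * (n + 1) - 1 - x = m + 3 := by omega
  have e3 : ∏ l ∈ range (n + 1), (((x + 3 : ℕ) : ℂ) - 3 * l) =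
      (x + 3) * ∏ l ∈ range n, ((x : ℂ) - 3 * l) := by
    rw [prod_range_succ']
    push_cast
    rw [mul_comm]
    congr 1
    · ring
    · refine prod_congr rfl fun _ _ => by ring
  rw [hahnWeight, hahnWeight, e1, e2, e3, prod_range_succ]
  have f1 : ((x.factorial : ℕ) : ℂ) ≠ 0 := by exact_mod_cast x.factorial_ne_zero
  have f2 : ((m.factorial : ℕ) : ℂ) ≠ 0 := by exact_mod_cast m.factorial_ne_zero
  simp only [Nat.factorial_succ, Nat.cast_mul]
  have f3 : ((x + 1 + 1 + 1 : ℕ) : ℂ) ≠ 0 := by norm_cast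
  have f4 : ((x + 1 + 1 : ℕ) : ℂ) ≠ 0 := by norm_cast
  have f5 : ((x + 1 : ℕ) : ℂ) ≠ 0 := by norm_cast
  have f6 : ((m + 1 + 1 + 1 : ℕ) : ℂ) ≠ 0 := by norm_cast
  have f7 : ((m + 1 + 1 : ℕ) : ℂ) ≠ 0 := by norm_cast
  have f8 : ((m + 1 : ℕ) : ℂ) ≠ 0 := by norm_cast
  rw [pow_add, show (-ζ) ^ 3 = -1 by rw [neg_pow, cube_eq_one hζ]; norm_num, hmc]
  field_simp
  push_cast
  ring

lemma hahnFun_shift {ζ : ℂ} (hζ : ζ ^ 2 + ζ + 1 = 0) (n : ℕ) (g : ℂ → ℂ) :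
    ∑ x ∈ range (3 * n), hahnWeight ζ n x * ((x - 3 * n + 1) * (x - 3 * n + 2) * g (x + 3)) =
      ∑ x ∈ range (3 * n), hahnWeight ζ n x * ((x - 1) * (x - 2) * g x) := by
  rcases n with _ | n
  · simp
  have w0 : hahnWeight ζ (n + 1) 0 = 0 := by
    rw [hahnWeight, prod_range_succ']; simp
  have w1 : hahnWeight ζ (n + 1) (3 * n) = 0 := by
    rw [hahnWeight, prod_range_succ]; simp
  rw [show 3 * (n + 1) = 3 * n + 3 by ring, sum_range_succ, sum_range_succ, sum_range_succ,
    sum_range_succ', sum_range_succ', sum_range_succ', w0, w1]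
  have h : ∀ x ∈ range (3 * n), hahnWeight ζ (n + 1) x *
      (((x : ℂ) - 3 * (n + 1 : ℕ) + 1) * (x - 3 * (n + 1 : ℕ) + 2) * g (x + 3)) =
      hahnWeight ζ (n + 1) (x + 1 + 1 + 1) * (((x + 1 + 1 + 1 : ℕ) - 1) * ((x + 1 + 1 + 1 : ℕ) - 2)
        * g ((x + 1 + 1 + 1 : ℕ))) := by
    intro x hx
    have := hahnWeight_shift hζ n x (by simpa using hx)
    push_cast
    rw [show ((x : ℂ) + 1 + 1 + 1) = x + 3 by ring, show x + 1 + 1 + 1 = x + 3 from rfl]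
    linear_combination -g (x + 3) * this
  rw [sum_congr rfl h]
  push_cast
  ring_nf

lemma hahn_eigen (n r : ℕ) (x : ℂ) :
    (x - 3 * n + 1) * (x - 3 * n + 2) * ((hahn n r).eval (x + 3) - (hahn n r).eval x) +
      (x - 1) * (x - 2) * ((hahn n r).eval (x - 3) - (hahn n r).eval x) =
      9 * r * (r + 1 - 2 * n) * (hahn n r).eval x := by
  have h1 := hahn_shift n r x 1 (by norm_num)
  have h2 := hahn_shift n r x (-1) (by norm_num)
  rw [show x + 3 * (1 : ℂ) = x + 3 by ring] at h1
  rw [show x + 3 * (-1 : ℂ) = x - 3 by ring] at h2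
  linear_combination h1 + h2

lemma hahnFun_hahn {ζ : ℂ} (hζ : ζ ^ 2 + ζ + 1 = 0) (n r : ℕ) (h1 : 1 ≤ r) (h2 : r + 2 ≤ 2 * n) :
    hahnFun ζ n (hahn n r) = 0 := by
  have hr : (9 * r * (r + 1 - 2 * n) : ℂ) ≠ 0 := by
    have : (r : ℂ) ≠ 0 := by exact_mod_cast (by omega)
    refine mul_ne_zero (mul_ne_zero (by norm_num) this) ?_
    intro h
    have : ((r + 1 : ℕ) : ℂ) = ((2 * n : ℕ) : ℂ) := by push_cast; linear_combination h
    have := Nat.cast_injective this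
    omega
  have a := hahnFun_shift hζ n fun x => (hahn n r).eval x
  have b := hahnFun_shift hζ n fun x => (hahn n r).eval (x - 3)
  simp only [add_sub_cancel_right] at b
  refine mul_left_cancel₀ hr ?_
  have e : 9 * r * (r + 1 - 2 * n) * hahnFun ζ n (hahn n r) =
      ∑ x ∈ range (3 * n), (hahnWeight ζ n x * ((x - 3 * n + 1) * (x - 3 * n + 2) *
          (hahn n r).eval ((x : ℂ) + 3)) -
        hahnWeight ζ n x * ((x - 1) * (x - 2) * (hahn n r).eval (x : ℂ)) -
        (hahnWeight ζ n x * ((x - 3 * n + 1) * (x - 3 * n + 2) * (hahn n r).eval (x : ℂ)) -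
        hahnWeight ζ n x * ((x - 1) * (x - 2) * (hahn n r).eval ((x : ℂ) - 3)))) := by
    rw [hahnFun_apply, mul_sum]
    refine sum_congr rfl fun x _ => ?_
    linear_combination -hahnWeight ζ n x * hahn_eigen n r x
  rw [e, sum_sub_distrib, sum_sub_distrib, sum_sub_distrib, a, b]
  simp

lemma X_mul_hahn (n r : ℕ) : X * hahn n (r + 1) =
    hahn n (r + 2) + C (3 * n / 2 : ℂ) * hahn n (r + 1)
    + C (hahnCoeff n (r + 1)) * hahn n r := by
  rw [hahn]; ring

lemma hahnFun_pow_mul_hahn {ζ : ℂ} (hζ : ζ ^ 2 + ζ + 1 = 0) (n j : ℕ) :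
    ∀ r, j < r → r + j + 2 ≤ 2 * n → hahnFun ζ n (X ^ j * hahn n r) = 0 := by
  induction j with
  | zero => intro r h1 h2; simpa using hahnFun_hahn hζ n r h1 h2
  | succ j ih =>
    intro r h1 h2
    obtain ⟨r, rfl⟩ : ∃ s, r = s + 1 := ⟨r - 1, by omega⟩
    have : X ^ (j + 1) * hahn n (r + 1) = X ^ j * hahn n (r + 2) +
        (3 * n / 2 : ℂ) • (X ^ j * hahn n (r + 1)) + hahnCoeff n (r + 1) • (X ^ j * hahn n r) := by
      rw [pow_succ, mul_assoc, X_mul_hahn, smul_eq_C_mul, smul_eq_C_mul]; ring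
    rw [this, map_add, map_add, map_smul, map_smul, ih _ (by omega) (by omega),
      ih _ (by omega) (by omega), ih _ (by omega) (by omega)]
    simp

lemma hahnFun_norm {ζ : ℂ} (hζ : ζ ^ 2 + ζ + 1 = 0) (n r : ℕ) (hr : r < n) :
    hahnFun ζ n (X ^ r * hahn n r) = hahnFun ζ n 1 * ∏ i ∈ range r, hahnCoeff n (i + 1) := by
  induction r with
  | zero => simp [hahn]
  | succ r ih =>
    have : X ^ (r + 1) * hahn n (r + 1) = X ^ r * hahn n (r + 2) +
        (3 * n / 2 : ℂ) • (X ^ r * hahn n (r + 1)) + hahnCoeff n (r + 1) • (X ^ r * hahn n r) := by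
      rw [pow_succ, mul_assoc, X_mul_hahn, smul_eq_C_mul, smul_eq_C_mul]; ring
    rw [this, map_add, map_add, map_smul, map_smul,
      hahnFun_pow_mul_hahn hζ n r _ (by omega) (by omega),
      hahnFun_pow_mul_hahn hζ n r _ (by omega) (by omega), ih (by omega), prod_range_succ]
    simp only [smul_eq_mul]; ring
end XXZ

namespace XXZ
open Polynomial Finset
open scoped Matrix

/-- The monic polynomial with the given roots. -/
def rootPoly {A : Type*} [CommRing A] {M : ℕ} (y : Fin M → A) : A[X] := ∏ i, (X - C (y i))

/-- The polynomials labelling the columns of `colMat`. -/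
def colPoly {A : Type*} [CommRing A] (ζ : A) {n r : ℕ} (k : ℕ) (Y : A[X]) : Fin n ⊕ Fin r → A[X]
  | .inl j => X ^ (3 * (j : ℕ))
  | .inr b => X ^ (b : ℕ) * ((X - 1) ^ (2 * k) * Y).comp (C ζ * X)

/-- Evaluations of the polynomials `colPoly` at the points `y`. -/
def colMat {A : Type*} [CommRing A] (ζ : A) {n r M : ℕ} (k : ℕ) (e : Fin M ≃ Fin n ⊕ Fin r)
    (y : Fin M → A) : Matrix (Fin M) (Fin M) A :=
  Matrix.of fun i j => (colPoly ζ k (rootPoly y) (e j)).eval (y i)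

/-- Coefficients of the remainders of `colPoly` modulo `rootPoly`. -/
def remMat {A : Type*} [CommRing A] (ζ : A) {n r M : ℕ} (k : ℕ) (e : Fin M ≃ Fin n ⊕ Fin r)
    (y : Fin M → A) : Matrix (Fin M) (Fin M) A :=
  Matrix.of fun m j => (colPoly ζ k (rootPoly y) (e j) %ₘ rootPoly y).coeff m

lemma rootPoly_monic {A : Type*} [CommRing A] {M : ℕ} (y : Fin M → A) : (rootPoly y).Monic :=
  monic_prod_of_monic _ _ fun _ _ => monic_X_sub_C _

lemma rootPoly_natDegree {A : Type*} [CommRing A] [Nontrivial A] {M : ℕ} (y : Fin M → A) :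
    (rootPoly y).natDegree = M := by
  rw [rootPoly, natDegree_prod_of_monic _ _ fun _ _ => monic_X_sub_C _]
  simp

lemma rootPoly_eval {A : Type*} [CommRing A] {M : ℕ} (y : Fin M → A) (i : Fin M) :
    (rootPoly y).eval (y i) = 0 := by
  rw [rootPoly, eval_prod]
  exact prod_eq_zero (mem_univ i) (by simp)

lemma rootPoly_map {A B : Type*} [CommRing A] [CommRing B] (φ : A →+* B) {M : ℕ} (y : Fin M → A) :
    (rootPoly y).map φ = rootPoly fun i => φ (y i) := by
  simp [rootPoly, Polynomial.map_prod]

lemma colPoly_map {A B : Type*} [CommRing A] [CommRing B] (φ : A →+* B) (ζ : A) {n r : ℕ} (k : ℕ)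
    (Y : A[X]) (j : Fin n ⊕ Fin r) :
    (colPoly ζ k Y j).map φ = colPoly (φ ζ) k (Y.map φ) j := by
  rcases j with j | j <;> simp [colPoly, Polynomial.map_comp]

lemma remMat_map {A B : Type*} [CommRing A] [CommRing B] (φ : A →+* B) (ζ : A) {n r M : ℕ} (k : ℕ)
    (e : Fin M ≃ Fin n ⊕ Fin r) (y : Fin M → A) :
    (remMat ζ k e y).map φ = remMat (φ ζ) k e fun i => φ (y i) := by
  ext m j
  simp only [remMat, Matrix.map_apply, Matrix.of_apply]
  rw [← coeff_map, map_modByMonic _ (rootPoly_monic y), colPoly_map, rootPoly_map]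

lemma eval_eq_sum_rem {A : Type*} [CommRing A] [Nontrivial A] {M : ℕ} (y : Fin M → A) (f : A[X])
    (i : Fin M) : f.eval (y i) = ∑ m : Fin M, y i ^ (m : ℕ) * (f %ₘ rootPoly y).coeff m := by
  have h : (f %ₘ rootPoly y).degree < M := by
    have := degree_modByMonic_lt f (rootPoly_monic y)
    rwa [degree_eq_natDegree (rootPoly_monic y).ne_zero, rootPoly_natDegree] at this
  have h2 : f.eval (y i) = (f %ₘ rootPoly y).eval (y i) := by
    conv_lhs => rw [← modByMonic_add_div f (rootPoly y)]
    simp [rootPoly_eval]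
  rw [h2]
  rcases Nat.eq_zero_or_pos M with rfl | hM
  · exact i.elim0
  have h3 : (f %ₘ rootPoly y).natDegree < M := by
    rcases eq_or_ne (f %ₘ rootPoly y) 0 with h0 | h0
    · rw [h0]; simpa using hM
    · exact (natDegree_lt_iff_degree_lt h0).mpr h
  rw [eval_eq_sum_range' h3, Finset.sum_range]
  exact sum_congr rfl fun _ _ => mul_comm _ _

lemma colMat_eq {A : Type*} [CommRing A] [Nontrivial A] (ζ : A) {n r M : ℕ} (k : ℕ)
    (e : Fin M ≃ Fin n ⊕ Fin r) (y : Fin M → A) :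
    colMat ζ k e y = Matrix.vandermonde y * remMat ζ k e y := by
  ext i j
  simp only [colMat, Matrix.of_apply, Matrix.mul_apply, Matrix.vandermonde_apply, remMat]
  exact eval_eq_sum_rem y _ i

/-- Points with nonzero coordinates whose cubes are distinct. -/
def Generic {M : ℕ} (y : Fin M → ℂ) : Prop :=
  (∀ i, y i ≠ 0) ∧ Function.Injective fun i => y i ^ 3

lemma Generic.injective {M : ℕ} {y : Fin M → ℂ} (h : Generic y) : Function.Injective y :=
  fun i j hij => h.2 (by simp [hij])

lemma generic_ofReal (M : ℕ) {δ : ℝ} (hδ : δ ≠ 0) :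
    Generic fun i : Fin M => (1 : ℂ) + (δ : ℂ) ^ 2 * ((i : ℂ) + 1) := by
  have e : ∀ i : Fin M, (1 : ℂ) + (δ : ℂ) ^ 2 * ((i : ℂ) + 1) =
      ((1 + δ ^ 2 * ((i : ℝ) + 1) : ℝ) : ℂ) := fun i => by push_cast; ring
  have hp : ∀ i : Fin M, 0 < 1 + δ ^ 2 * ((i : ℝ) + 1) := fun i => by positivity
  constructor
  · intro i
    simp only [e]
    exact_mod_cast (hp i).ne'
  · intro i j hij
    simp only [e] at hij
    simp only [← Complex.ofReal_pow (1 + δ ^ 2 * _)] at hij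
    have h := (pow_left_inj₀ (hp i).le (hp j).le three_ne_zero).1 (Complex.ofReal_injective hij)
    have h2 : (i : ℝ) = j := by
      have := mul_left_cancel₀ (pow_ne_zero 2 hδ) (add_left_cancel h)
      linarith
    exact Fin.ext (by exact_mod_cast h2)

lemma eval_one_of_det {n r M k : ℕ} (ζ C₀ : ℂ) (e : Fin M ≃ Fin n ⊕ Fin r) (F : (Fin M → ℂ) → ℂ)
    (hF : Continuous F)
    (h : ∀ y, Generic y → F y * (Matrix.vandermonde y).det = C₀ * (colMat ζ k e y).det) :
    F (fun _ => 1) = C₀ * (remMat ζ k e fun _ => (1 : ℂ)).det := by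
  set y : Fin M → ℂ[X] := fun i => 1 + X ^ 2 * C ((i : ℂ) + 1)
  set d : ℂ[X] := (remMat (C ζ) k e y).det
  have hd : ∀ ε : ℂ, d.eval ε = (remMat ζ k e fun i => (1 : ℂ) + ε ^ 2 * ((i : ℂ) + 1)).det := by
    intro ε
    rw [← coe_evalRingHom, RingHom.map_det, RingHom.mapMatrix_apply, remMat_map]
    simp [y]
  have key : (fun δ : ℝ => F fun i => 1 + (δ : ℂ) ^ 2 * ((i : ℂ) + 1)) =
      fun δ : ℝ => C₀ * d.eval (δ : ℂ) := by
    refine Continuous.ext_on (s := {0}ᶜ) (dense_compl_singleton 0) ?_ ?_ ?_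
    · exact hF.comp (by fun_prop)
    · exact continuous_const.mul (d.continuous.comp Complex.continuous_ofReal)
    · intro δ hδ
      have hg := generic_ofReal M (δ := δ) hδ
      have hv := Matrix.det_vandermonde_ne_zero_iff.2 hg.injective
      have := h _ hg
      rw [colMat_eq, Matrix.det_mul, ← hd] at this
      refine mul_right_cancel₀ hv ?_
      simp only
      rw [this]; ring
  have := congrFun key 0
  simp only [hd] at this
  simpa using this

/-- The linear functional `X ^ e ↦ π(e)`. -/
def expFun (π : ℂ[X]) : ℂ[X] →ₗ[ℂ] ℂ := Polynomial.lsum fun e => π.eval (e : ℂ) • LinearMap.id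

lemma expFun_apply (π f : ℂ[X]) : expFun π f = f.sum fun e a => π.eval (e : ℂ) * a := by
  simp [expFun, Polynomial.lsum_apply]

lemma expFun_X_pow (π : ℂ[X]) (e : ℕ) : expFun π (X ^ e) = π.eval (e : ℂ) := by
  rw [expFun_apply, ← monomial_one_right_eq_X_pow, sum_monomial_index] <;> simp

lemma expFun_eq_sum (π f : ℂ[X]) (N : ℕ) (h : f.natDegree < N) :
    expFun π f = ∑ e ∈ range N, π.eval (e : ℂ) * f.coeff e := by
  rw [expFun_apply, sum_over_range' _ (by simp) N h]

lemma expFun_X_mul (π f : ℂ[X]) : expFun π (X * f) = expFun (π.comp (X + 1)) f := by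
  induction f using Polynomial.induction_on' with
  | add p q hp hq => rw [mul_add, map_add, map_add, hp, hq]
  | monomial n a =>
    rw [← C_mul_X_pow_eq_monomial, ← smul_eq_C_mul, mul_smul_comm, ← pow_succ', map_smul, map_smul,
      expFun_X_pow, expFun_X_pow]
    simp

lemma expFun_sub_left (π ρ f : ℂ[X]) : expFun (π - ρ) f = expFun π f - expFun ρ f := by
  induction f using Polynomial.induction_on' with
  | add p q hp hq => rw [map_add, map_add, map_add, hp, hq]; ring
  | monomial n a =>
    rw [← C_mul_X_pow_eq_monomial, ← smul_eq_C_mul, map_smul, map_smul, map_smul,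
      expFun_X_pow, expFun_X_pow, expFun_X_pow]
    simp; ring

lemma expFun_X_sub_one_pow_mul (m : ℕ) : ∀ π : ℂ[X], π.degree < m → ∀ f,
    expFun π ((X - 1) ^ m * f) = 0 := by
  induction m with
  | zero =>
    intro π h f
    rw [show π = 0 by simpa using h, expFun_apply]
    simp [Polynomial.sum]
  | succ m ih =>
    intro π h f
    have : (X - 1) ^ (m + 1) * f = X * ((X - 1) ^ m * f) - (X - 1) ^ m * f := by ring
    rw [this, map_sub, expFun_X_mul, ← expFun_sub_left]
    refine ih _ ?_ f
    rcases eq_or_ne π 0 with rfl | hπ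
    · simp
    rcases Nat.eq_zero_or_pos π.natDegree with h0 | h0
    · rw [eq_C_of_natDegree_eq_zero h0]; simp
    have hnd : (π.comp (X + 1)).natDegree = π.natDegree := by
      rw [natDegree_comp, show (X + 1 : ℂ[X]) = X + C 1 by simp, natDegree_X_add_C, mul_one]
    have hc0 : π.comp (X + 1) ≠ 0 := by
      intro hc; rw [hc] at hnd; simp at hnd; omega
    have hlt := degree_sub_lt_left (p := π.comp (X + 1)) (q := π)
      (by rw [degree_eq_natDegree hc0, degree_eq_natDegree hπ, hnd]) hc0
      (by
        rw [show (X + 1 : ℂ[X]) = X + C 1 by simp,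
            leadingCoeff_comp (by rw [natDegree_X_add_C]; exact one_ne_zero),
          leadingCoeff_X_add_C, one_pow, mul_one])
    rw [degree_eq_natDegree hc0, hnd, ← degree_eq_natDegree hπ] at hlt
    refine lt_of_lt_of_le hlt ?_
    rw [degree_eq_natDegree hπ] at h ⊢
    norm_cast at h ⊢
    omega

/-- The polynomials defining the dual functionals. -/
def testPoly (n : ℕ) {r : ℕ} : Fin n ⊕ Fin r → ℂ[X]
  | .inl i => ∏ l ∈ range i, (X - C (3 * l : ℂ))
  | .inr p => hahn n p * ∏ l ∈ range n, (X - C (3 * l : ℂ))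

lemma monic_prod_sub (n : ℕ) : (∏ l ∈ range n, (X - C (3 * l : ℂ))).Monic :=
  monic_prod_of_monic _ _ fun _ _ => monic_X_sub_C _

lemma natDegree_prod_sub (n : ℕ) : (∏ l ∈ range n, (X - C (3 * l : ℂ))).natDegree = n := by
  rw [natDegree_prod_of_monic _ _ fun _ _ => monic_X_sub_C _]
  simp only [natDegree_X_sub_C, sum_const, card_range, smul_eq_mul, mul_one]

lemma testPoly_monic (n : ℕ) {r : ℕ} (i : Fin n ⊕ Fin r) : (testPoly n i).Monic := by
  rcases i with i | i
  · exact monic_prod_sub _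
  · exact (hahn_monic _ _).mul (monic_prod_sub _)

lemma testPoly_natDegree (n : ℕ) {r : ℕ} (i : Fin (n + r)) :
    (testPoly n (finSumFinEquiv.symm i)).natDegree = i := by
  obtain ⟨j, rfl⟩ := finSumFinEquiv.surjective i
  rw [Equiv.symm_apply_apply]
  rcases j with j | j
  · rw [testPoly, natDegree_prod_sub]; simp
  · rw [testPoly, (hahn_monic _ _).natDegree_mul (monic_prod_sub _), natDegree_prod_sub,
      hahn_natDegree]
    simp [add_comm]

/-- The polynomial interpolating the column coefficients. -/
def ratioPoly (n r b : ℕ) : ℂ[X] :=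
  descPochhammer ℂ b * (descPochhammer ℂ (r - 1 - b)).comp (C (3 * n - 1 : ℂ) - X)

lemma ratioPoly_eval (n r b e : ℕ) (he : e < 3 * n) : (ratioPoly n r b).eval (e : ℂ) =
    (e.descFactorial b : ℂ) * ((3 * n - 1 - e).descFactorial (r - 1 - b) : ℂ) := by
  have : (3 * n - 1 - e : ℂ) = ((3 * n - 1 - e : ℕ) : ℂ) := by
    rw [Nat.cast_sub (by omega), Nat.cast_sub (by omega)]; push_cast; ring
  rw [ratioPoly, eval_mul, eval_comp, descPochhammer_eval_eq_descFactorial]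
  simp only [eval_sub, eval_C, eval_X]
  rw [this, descPochhammer_eval_eq_descFactorial]

lemma ratioPoly_natDegree (n r b : ℕ) (hb : b < r) : (ratioPoly n r b).natDegree < r := by
  refine lt_of_le_of_lt (natDegree_mul_le) ?_
  have h1 : (descPochhammer ℂ b).natDegree = b := descPochhammer_natDegree ℂ b
  have h2 : (descPochhammer ℂ (r - 1 - b)).natDegree = r - 1 - b := descPochhammer_natDegree ℂ _
  have h3 := natDegree_comp_le (p := descPochhammer ℂ (r - 1 - b)) (q := C (3 * n - 1 : ℂ) - X)
  have h4 : (C (3 * n - 1 : ℂ) - X).natDegree ≤ 1 := by compute_degree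
  rw [h2] at h3
  have h5 := Nat.mul_le_mul_left (r - 1 - b) h4
  omega

lemma coeff_X_pow_mul_X_sub_one_pow {ζ : ℂ} (hζ : ζ ^ 2 + ζ + 1 = 0) {n k r : ℕ} (hn : n = k + r)
    (b e : ℕ) (hb : b < r) (he : e < 3 * n) :
    (X ^ b * ((X - 1 : ℂ[X]) ^ (2 * n + k)).comp (C ζ * X)).coeff e =
      ((-1) ^ (2 * n + k) * (-ζ ^ 2) ^ b * (2 * n + k).factorial) *
        ((-ζ) ^ e / (e.factorial * (3 * n - 1 - e).factorial)) *
            (ratioPoly n r b).eval (e : ℂ) := by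
  rw [ratioPoly_eval _ _ _ _ he, coeff_X_pow_mul']
  split_ifs with hbe
  · obtain ⟨a, rfl⟩ := Nat.exists_eq_add_of_le hbe
    rw [Nat.add_sub_cancel_left, comp_C_mul_X_coeff,
      show (X - 1 : ℂ[X]) = X + C (-1) by simp [sub_eq_add_neg],
      coeff_X_add_C_pow]
    rcases lt_or_ge (2 * n + k) a with ha | ha
    · rw [Nat.choose_eq_zero_of_lt ha,
          Nat.descFactorial_of_lt (n := 3 * n - 1 - (b + a)) (by omega)]
      simp
    · obtain ⟨d, hd⟩ := Nat.exists_eq_add_of_le ha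
      have e1 : 3 * n - 1 - (b + a) = r - 1 - b + d := by omega
      have f1 : (b + a).descFactorial b * a.factorial = (b + a).factorial := by
        have := Nat.factorial_mul_descFactorial (show b ≤ b + a by omega)
        rw [Nat.add_sub_cancel_left] at this; rw [← this, mul_comm]
      have f2 : (r - 1 - b + d).descFactorial (r - 1 - b) * d.factorial =
          (r - 1 - b + d).factorial := by
        have := Nat.factorial_mul_descFactorial (show r - 1 - b ≤ r - 1 - b + d by omega)
        rw [Nat.add_sub_cancel_left] at this; rw [← this, mul_comm]
      have f3 : (a + d).choose a * a.factorial * d.factorial = (a + d).factorial :=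
        by rw [Nat.choose_symm_add]; exact Nat.add_choose_mul_factorial_mul_factorial a d
      rw [e1, hd, ← f1, ← f2, ← f3, Nat.add_sub_cancel_left]
      have g1 : (a.factorial : ℂ) ≠ 0 := by exact_mod_cast a.factorial_ne_zero
      have g2 : (d.factorial : ℂ) ≠ 0 := by exact_mod_cast d.factorial_ne_zero
      have g3 : ((b + a).descFactorial b : ℂ) ≠ 0 := by
        intro h
        have h : (b + a).descFactorial b = 0 := by exact_mod_cast h
        rw [h] at f1; exact (b + a).factorial_ne_zero (by omega)
      have g4 : ((r - 1 - b + d).descFactorial (r - 1 - b) : ℂ) ≠ 0 := by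
        intro h
        have h : (r - 1 - b + d).descFactorial (r - 1 - b) = 0 := by exact_mod_cast h
        rw [h] at f2; exact (r - 1 - b + d).factorial_ne_zero (by omega)
      push_cast
      field_simp
      have hz : (-ζ ^ 2) ^ b * (-ζ) ^ (b + a) = (-ζ) ^ a := by
        rw [pow_add, ← mul_assoc, ← mul_pow, show -ζ ^ 2 * -ζ = 1 by
          linear_combination cube_eq_one hζ]
        simp
      have hs : (-1 : ℂ) ^ (a + d) * (-ζ) ^ a = (-1) ^ d * ζ ^ a := by
        rw [pow_add, mul_right_comm, ← mul_pow]; simp [mul_comm]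
      linear_combination ((a + d).choose a : ℂ) * (-(-1 : ℂ) ^ (a + d) * hz - hs)
  · rw [Nat.descFactorial_of_lt (by omega)]
    simp

lemma expFun_column {ζ : ℂ} (hζ : ζ ^ 2 + ζ + 1 = 0) {n k r : ℕ} (hn : n = k + r)
    (b p : ℕ) (hb : b < r) :
    expFun (hahn n p * ∏ l ∈ range n, (X - C (3 * l : ℂ)))
        (X ^ b * ((X - 1 : ℂ[X]) ^ (2 * n + k)).comp (C ζ * X)) =
      ((-1) ^ (2 * n + k) * (-ζ ^ 2) ^ b * (2 * n + k).factorial) *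
        ∑ q : Fin r, (ratioPoly n r b).coeff q * hahnFun ζ n (X ^ (q : ℕ) * hahn n p) := by
  have hd : (X ^ b * ((X - 1 : ℂ[X]) ^ (2 * n + k)).comp (C ζ * X)).natDegree < 3 * n := by
    refine lt_of_le_of_lt (natDegree_mul_le) ?_
    have h3 := natDegree_comp_le (p := (X - 1 : ℂ[X]) ^ (2 * n + k)) (q := C ζ * X)
    have h4 : (C ζ * X).natDegree ≤ 1 := by compute_degree
    have h2 : ((X - 1 : ℂ[X]) ^ (2 * n + k)).natDegree = 2 * n + k := by
      rw [show (X - 1 : ℂ[X]) = X - C 1 by simp, natDegree_pow, natDegree_X_sub_C, mul_one]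
    rw [h2] at h3
    have h5 := Nat.mul_le_mul_left (2 * n + k) h4
    rw [natDegree_X_pow]
    omega
  have hR : hahnFun ζ n (ratioPoly n r b * hahn n p) =
      ∑ q : Fin r, (ratioPoly n r b).coeff q * hahnFun ζ n (X ^ (q : ℕ) * hahn n p) := by
    conv_lhs => rw [(ratioPoly n r b).as_sum_range_C_mul_X_pow' (ratioPoly_natDegree n r b hb),
      sum_mul, map_sum, Finset.sum_range]
    refine sum_congr rfl fun q _ => ?_
    rw [mul_assoc, ← smul_eq_C_mul, map_smul, smul_eq_mul]
  rw [← hR, expFun_eq_sum _ _ _ hd, hahnFun_apply, mul_sum]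
  refine sum_congr rfl fun e he => ?_
  rw [coeff_X_pow_mul_X_sub_one_pow hζ hn b e hb (by simpa using he), hahnWeight, eval_mul,
    eval_mul, eval_prod]
  simp only [eval_sub, eval_X, eval_C]
  ring

lemma det_vandermonde_natCast (M : ℕ) :
    (Matrix.vandermonde fun i : Fin M => ((i : ℕ) : ℂ)).det = ∏ m ∈ range M, (m.factorial : ℂ) := by
  rcases M with _ | M
  · simp
  have := Matrix.det_vandermonde_id_eq_superFactorial (R := ℂ) M
  rw [this, ← Nat.prod_range_succ_factorial]
  push_cast
  rfl

lemma det_ratioPoly (n r : ℕ) (hr : r ≤ n) :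
    (Matrix.of fun q b : Fin r => (ratioPoly n r b).coeff q).det =
      ∏ b ∈ range r, ((3 * n - 1 - b).descFactorial (r - 1 - b) : ℂ) := by
  have h1 : Matrix.vandermonde (fun i : Fin r => ((i : ℕ) : ℂ)) *
      (Matrix.of fun q b : Fin r => (ratioPoly n r b).coeff q) =
      Matrix.of fun x b : Fin r => (ratioPoly n r b).eval ((x : ℕ) : ℂ) := by
    ext x b
    simp only [Matrix.mul_apply, Matrix.vandermonde_apply, Matrix.of_apply]
    rw [eval_eq_sum_range' (ratioPoly_natDegree n r b b.2), Finset.sum_range]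
    exact sum_congr rfl fun _ _ => mul_comm _ _
  have h2 : (Matrix.of fun x b : Fin r => (ratioPoly n r b).eval ((x : ℕ) : ℂ)).det =
      ∏ b : Fin r, (((b : ℕ).factorial : ℂ) *
        ((3 * n - 1 - b).descFactorial (r - 1 - b) : ℂ)) := by
    rw [Matrix.det_of_isLowerTriangular]
    · refine prod_congr rfl fun b _ => ?_
      rw [Matrix.of_apply, ratioPoly_eval _ _ _ _ (by omega), Nat.descFactorial_self]
    · intro x b hxb
      have hxb : x < b := hxb
      rw [Matrix.of_apply, ratioPoly_eval _ _ _ _ (by omega),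
        Nat.descFactorial_of_lt (by exact_mod_cast hxb)]
      simp
  rw [← h1, Matrix.det_mul, det_vandermonde_natCast, prod_mul_distrib, Finset.prod_range] at h2
  rw [Finset.prod_range (fun b => ((3 * n - 1 - b).descFactorial (r - 1 - b) : ℂ))]
  refine mul_left_cancel₀ ?_ h2
  exact prod_ne_zero_iff.mpr fun i _ => by exact_mod_cast Nat.factorial_ne_zero _

lemma det_moments {ζ : ℂ} (hζ : ζ ^ 2 + ζ + 1 = 0) (n r : ℕ) (hr : r ≤ n) :
    (Matrix.of fun p q : Fin r => hahnFun ζ n (X ^ (q : ℕ) * hahn n p)).det =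
      ∏ p ∈ range r, hahnFun ζ n (X ^ p * hahn n p) := by
  rw [Finset.prod_range, Matrix.det_of_isUpperTriangular]
  · rfl
  · intro p q hqp
    have hqp : q < p := hqp
    exact hahnFun_pow_mul_hahn hζ n q p hqp (by omega)

/-- The determinant of the functionals `testPoly` on the monomial columns. -/
def cubeDet (n : ℕ) : ℂ :=
  (Matrix.of fun i j : Fin n => (∏ l ∈ range i, (X - C (3 * l : ℂ))).eval ((3 * j : ℕ) : ℂ)).det

lemma det_remMat_one {ζ : ℂ} (hζ : ζ ^ 2 + ζ + 1 = 0) {n k r : ℕ} (hn : n = k + r) :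
    (∏ m ∈ range (n + r), (m.factorial : ℂ)) *
        (remMat ζ k (finSumFinEquiv (m := n) (n := r)).symm fun _ => (1 : ℂ)).det =
      cubeDet n * ((∏ p ∈ range r, hahnFun ζ n (X ^ p * hahn n p)) *
        ((∏ b : Fin r, ((-1) ^ (2 * n + k) * (-ζ ^ 2) ^ (b : ℕ) * (2 * n + k).factorial)) *
          ∏ b ∈ range r, ((3 * n - 1 - b).descFactorial (r - 1 - b) : ℂ))) := by
  have hY : rootPoly (fun _ : Fin (n + r) => (1 : ℂ)) = (X - 1) ^ (n + r) := by
    simp [rootPoly]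
  have hcol : ∀ b : Fin r, colPoly ζ k ((X - 1 : ℂ[X]) ^ (n + r)) (.inr b : Fin n ⊕ Fin r) =
      X ^ (b : ℕ) * ((X - 1 : ℂ[X]) ^ (2 * n + k)).comp (C ζ * X) := by
    intro b
    rw [colPoly, ← pow_add, show 2 * k + (n + r) = 2 * n + k by omega]
  have hV := Matrix.det_eval_matrixOfPolynomials_eq_det_vandermonde
    (fun i : Fin (n + r) => ((i : ℕ) : ℂ)) (fun i => testPoly n (finSumFinEquiv.symm i))
    (testPoly_natDegree n) (fun i => testPoly_monic n _)
  rw [det_vandermonde_natCast] at hV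
  rw [hV, ← Matrix.det_transpose (Matrix.of _), ← Matrix.det_mul]
  have hprod : (Matrix.of fun i j : Fin (n + r) =>
        (testPoly n (finSumFinEquiv.symm j : Fin n ⊕ Fin r)).eval ((i : ℕ) : ℂ))ᵀ *
      (remMat ζ k (finSumFinEquiv (m := n) (n := r)).symm fun _ => (1 : ℂ)) =
      (Matrix.of fun i j : Fin n ⊕ Fin r =>
        expFun (testPoly n i) (colPoly ζ k ((X - 1) ^ (n + r)) j)).submatrix
          finSumFinEquiv.symm finSumFinEquiv.symm := by
    ext i j
    simp only [Matrix.mul_apply, Matrix.transpose_apply, Matrix.of_apply, remMat, hY,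
      Matrix.submatrix_apply]
    set f := colPoly ζ k ((X - 1 : ℂ[X]) ^ (n + r)) (finSumFinEquiv.symm j : Fin n ⊕ Fin r)
    have hM : ((X - 1 : ℂ[X]) ^ (n + r)).Monic := by
      rw [← hY]; exact rootPoly_monic _
    have hMd : ((X - 1 : ℂ[X]) ^ (n + r)).natDegree = n + r := by
      rw [← hY]; exact rootPoly_natDegree _
    have h1 : expFun (testPoly n (finSumFinEquiv.symm i : Fin n ⊕ Fin r)) f =
        expFun (testPoly n (finSumFinEquiv.symm i : Fin n ⊕ Fin r)) (f %ₘ (X - 1) ^ (n + r)) := by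
      conv_lhs => rw [← modByMonic_add_div f ((X - 1 : ℂ[X]) ^ (n + r)), map_add]
      rw [expFun_X_sub_one_pow_mul, add_zero]
      rw [degree_eq_natDegree (testPoly_monic n _).ne_zero, testPoly_natDegree]
      exact_mod_cast i.2
    rw [h1, expFun_eq_sum _ _ (n + r), Finset.sum_range]
    have := natDegree_modByMonic_lt f hM (by
      intro h1
      have := i.2
      rw [h1, natDegree_one] at hMd
      omega)
    omega
  rw [hprod, Matrix.det_submatrix_equiv_self]
  have hblock : (Matrix.of fun i j : Fin n ⊕ Fin r =>
        expFun (testPoly n i) (colPoly ζ k ((X - 1 : ℂ[X]) ^ (n + r)) j)) =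
      Matrix.fromBlocks
        (Matrix.of fun i j : Fin n => (∏ l ∈ range i, (X - C (3 * l : ℂ))).eval ((3 * j : ℕ) : ℂ))
        (Matrix.of fun (i : Fin n) (b : Fin r) =>
          expFun (testPoly n (.inl i : Fin n ⊕ Fin r)) (colPoly ζ k ((X - 1) ^ (n + r))
            (.inr b : Fin n ⊕ Fin r)))
        0
        ((Matrix.of fun p q : Fin r => hahnFun ζ n (X ^ (q : ℕ) * hahn n p)) *
          (Matrix.of fun q b : Fin r => ((-1) ^ (2 * n + k) * (-ζ ^ 2) ^ (b : ℕ) *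
            (2 * n + k).factorial) * (ratioPoly n r b).coeff q)) := by
    ext i j
    rcases i with i | p <;> rcases j with j | b
    · simp only [Matrix.of_apply, Matrix.fromBlocks_apply₁₁, colPoly, testPoly, expFun_X_pow]
    · simp only [Matrix.of_apply, Matrix.fromBlocks_apply₁₂]
    · simp only [Matrix.of_apply, Matrix.fromBlocks_apply₂₁, colPoly, testPoly, expFun_X_pow,
        Matrix.zero_apply, eval_mul]
      rw [eval_prod, prod_eq_zero (i := (j : ℕ)) (by simp) (by simp), mul_zero]
    · simp only [Matrix.of_apply, Matrix.fromBlocks_apply₂₂, Matrix.mul_apply]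
      rw [hcol, testPoly, expFun_column hζ hn b p b.2, mul_sum]
      refine sum_congr rfl fun q _ => by ring
  have hrow := Matrix.det_mul_row
    (fun b : Fin r => (-1 : ℂ) ^ (2 * n + k) * (-ζ ^ 2) ^ (b : ℕ) * (2 * n + k).factorial)
    (Matrix.of fun q b : Fin r => (ratioPoly n r b).coeff q)
  simp only [Matrix.of_apply] at hrow
  rw [hblock, Matrix.det_fromBlocks_zero₂₁, Matrix.det_mul, det_moments hζ n r (by omega),
    hrow, det_ratioPoly n r (by omega)]
  rfl

lemma norm_eq_one_of_cube {ζ : ℂ} (hζ : ζ ^ 2 + ζ + 1 = 0) : ‖ζ‖ = 1 := by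
  have : ‖ζ‖ ^ 3 = 1 := by rw [← norm_pow, cube_eq_one hζ, norm_one]
  exact (pow_eq_one_iff_of_nonneg (norm_nonneg _) (by norm_num)).mp this

lemma norm_det_remMat_equiv (ζ : ℂ) {n r M k : ℕ} (e e' : Fin M ≃ Fin n ⊕ Fin r) (y : Fin M → ℂ) :
    ‖(remMat ζ k e y).det‖ = ‖(remMat ζ k e' y).det‖ := by
  have : remMat ζ k e y = (remMat ζ k e' y).submatrix id (e.trans e'.symm) := by
    ext i j
    simp [remMat]
  rw [this, Matrix.det_permute', norm_mul]
  rcases Int.units_eq_one_or (Equiv.Perm.sign (e.trans e'.symm)) with h | h <;> simp [h]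

/-- Norm of the homogeneous limit of the determinant. -/
def homNorm (ζ : ℂ) (n k r : ℕ) : ℝ :=
  ‖(remMat ζ k (finSumFinEquiv (m := n) (n := r)).symm fun _ => (1 : ℂ)).det‖

lemma homNorm_eq (ζ : ℂ) {n r k : ℕ} (e : Fin (n + r) ≃ Fin n ⊕ Fin r) :
    ‖(remMat ζ k e fun _ => (1 : ℂ)).det‖ = homNorm ζ n k r := norm_det_remMat_equiv ζ _ _ _

lemma homNorm_mul {ζ : ℂ} (hζ : ζ ^ 2 + ζ + 1 = 0) {n k r : ℕ} (hn : n = k + r) :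
    (∏ m ∈ range (n + r), (m.factorial : ℝ)) * homNorm ζ n k r =
      ‖cubeDet n‖ * ((∏ p ∈ range r, ‖hahnFun ζ n (X ^ p * hahn n p)‖) *
        (((2 * n + k).factorial : ℝ) ^ r *
          ∏ b ∈ range r, ((3 * n - 1 - b).descFactorial (r - 1 - b) : ℝ))) := by
  have h := congrArg norm (det_remMat_one hζ hn)
  simp only [norm_mul, norm_prod, norm_pow, norm_neg, norm_one, norm_eq_one_of_cube hζ,
    one_pow, one_mul, RCLike.norm_natCast, prod_const, card_univ, Fintype.card_fin] at h
  exact h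

lemma homNorm_succ {ζ : ℂ} (hζ : ζ ^ 2 + ζ + 1 = 0) {n k r : ℕ} (hn : n = k + 1 + r) :
    ((n + r).factorial : ℝ) * homNorm ζ n k (r + 1) =
      homNorm ζ n (k + 1) r * (2 * n + k).factorial * ‖hahnFun ζ n (X ^ r * hahn n r)‖ := by
  have h0 := homNorm_mul hζ hn
  have h1 := homNorm_mul (ζ := ζ) hζ (n := n) (k := k) (r := r + 1) (by omega)
  have hP : (∏ m ∈ range (n + r), (m.factorial : ℝ)) ≠ 0 :=
    prod_ne_zero_iff.mpr fun i _ => by exact_mod_cast Nat.factorial_ne_zero _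
  have hd : ∏ b ∈ range (r + 1), ((3 * n - 1 - b).descFactorial (r + 1 - 1 - b) : ℝ) =
      ((2 * n + k + 1 : ℕ) : ℝ) ^ r *
        ∏ b ∈ range r, ((3 * n - 1 - b).descFactorial (r - 1 - b) : ℝ) := by
    rw [prod_range_succ, show r + 1 - 1 - r = 0 by omega, Nat.descFactorial_zero, Nat.cast_one,
      mul_one]
    have : ((2 * n + k + 1 : ℕ) : ℝ) ^ r = ∏ b ∈ range r, ((2 * n + k + 1 : ℕ) : ℝ) := by simp
    rw [this, ← prod_mul_distrib]
    refine prod_congr rfl fun b hb => ?_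
    have hb : b < r := by simpa using hb
    rw [show r + 1 - 1 - b = (r - 1 - b) + 1 by omega, Nat.descFactorial_succ,
      show 3 * n - 1 - b - (r - 1 - b) = 2 * n + k + 1 by omega, Nat.cast_mul]
  rw [show n + (r + 1) = n + r + 1 by ring, prod_range_succ, prod_range_succ _ r, hd] at h1
  rw [show 2 * n + (k + 1) = 2 * n + k + 1 by ring, Nat.factorial_succ] at h0
  refine mul_left_cancel₀ hP ?_
  push_cast at h0 h1 ⊢
  rw [mul_pow] at h0
  linear_combination h1 - ((2 * n + k).factorial : ℝ) * ‖hahnFun ζ n (X ^ r * hahn n r)‖ * h0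

end XXZ

namespace XXZ
open MvPolynomial

/-- Exchange of the variables `X i` and `X (i + 1)`. -/
def sw (i : ℕ) : MvPolynomial ℕ ℂ →ₐ[ℂ] MvPolynomial ℕ ℂ := rename (Equiv.swap i (i + 1))

lemma sw_X_left (i : ℕ) : sw i (X i) = X (i + 1) := by simp [sw]

lemma sw_X_right (i : ℕ) : sw i (X (i + 1)) = X i := by simp [sw]

lemma sw_X_of_ne {i j : ℕ} (h1 : j ≠ i) (h2 : j ≠ i + 1) : sw i (X j) = X j := by
  simp [sw, Equiv.swap_apply_of_ne_of_ne h1 h2]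

lemma sw_C (i : ℕ) (c : ℂ) : sw i (C c) = C c := by simp [sw]

lemma sw_sw (i : ℕ) (f : MvPolynomial ℕ ℂ) : sw i (sw i f) = f := by
  rw [sw, rename_rename]
  have : (Equiv.swap i (i + 1) : ℕ → ℕ) ∘ Equiv.swap i (i + 1) = id := by
    ext j; simp
  rw [this, rename_id_apply]

lemma sw_comm {i j : ℕ} (h : i + 2 ≤ j) (f : MvPolynomial ℕ ℂ) : sw i (sw j f) = sw j (sw i f) := by
  rw [sw, sw, rename_rename, rename_rename]
  congr 2
  ext k
  simp only [Function.comp_apply, Equiv.swap_apply_def]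
  split_ifs <;> omega

lemma sw_braid (i : ℕ) (f : MvPolynomial ℕ ℂ) :
    sw i (sw (i + 1) (sw i f)) = sw (i + 1) (sw i (sw (i + 1) f)) := by
  simp only [sw, rename_rename]
  congr 2
  ext k
  simp only [Function.comp_apply, Equiv.swap_apply_def]
  split_ifs <;> omega

lemma X_sub_X_ne_zero {i j : ℕ} (h : i ≠ j) : (X i - X j : MvPolynomial ℕ ℂ) ≠ 0 := by
  rw [sub_ne_zero]
  exact fun e => h (X_injective e)

lemma X_sub_X_dvd (i : ℕ) (f : MvPolynomial ℕ ℂ) : (X i - X (i + 1)) ∣ f - sw i f := by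
  induction f using MvPolynomial.induction_on with
  | C a => simp
  | add p q hp hq =>
    have : p + q - sw i (p + q) = (p - sw i p) + (q - sw i q) := by rw [map_add]; ring
    rw [this]; exact dvd_add hp hq
  | mul_X p k hp =>
    have : p * X k - sw i (p * X k) = (p - sw i p) * X k + sw i p * (X k - sw i (X k)) := by
      rw [map_mul]; ring
    rw [this]
    refine dvd_add (hp.mul_right _) (Dvd.dvd.mul_left ?_ _)
    by_cases h1 : k = i
    · rw [h1, sw_X_left]
    by_cases h2 : k = i + 1
    · rw [h2, sw_X_right]; exact ⟨-1, by ring⟩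
    rw [sw_X_of_ne h1 h2]; simp

lemma exists_heckeOp (ζ : ℂ) (i : ℕ) (f : MvPolynomial ℕ ℂ) :
    ∃ g, (X i - X (i + 1)) * g =
      C ζ * ((C ζ * X (i + 1) - X i) * sw i f - (C ζ - 1) * X i * f) := by
  obtain ⟨g, hg⟩ := X_sub_X_dvd i f
  refine ⟨C ζ * (-(C ζ * f) - (C ζ * X (i + 1) - X i) * g), ?_⟩
  linear_combination C ζ * (C ζ * X (i + 1) - X i) * hg

/-- Divided-difference operator relating the components `↑↓` and `↓↑` at sites `i`, `i + 1`. -/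
def heckeOp (ζ : ℂ) (i : ℕ) (f : MvPolynomial ℕ ℂ) : MvPolynomial ℕ ℂ :=
  Classical.choose (exists_heckeOp ζ i f)

lemma heckeOp_spec (ζ : ℂ) (i : ℕ) (f : MvPolynomial ℕ ℂ) :
    (X i - X (i + 1)) * heckeOp ζ i f =
      C ζ * ((C ζ * X (i + 1) - X i) * sw i f - (C ζ - 1) * X i * f) :=
  Classical.choose_spec (exists_heckeOp ζ i f)

lemma heckeOp_unique {ζ : ℂ} {i : ℕ} {f g : MvPolynomial ℕ ℂ}
    (h : (X i - X (i + 1)) * g =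
      C ζ * ((C ζ * X (i + 1) - X i) * sw i f - (C ζ - 1) * X i * f)) : heckeOp ζ i f = g :=
  mul_left_cancel₀ (X_sub_X_ne_zero (by omega)) ((heckeOp_spec ζ i f).trans h.symm)

lemma heckeOp_mul {ζ : ℂ} {i : ℕ} {s : MvPolynomial ℕ ℂ} (hs : sw i s = s) (f : MvPolynomial ℕ ℂ) :
    heckeOp ζ i (s * f) = s * heckeOp ζ i f := by
  apply heckeOp_unique
  rw [map_mul, hs]
  linear_combination s * heckeOp_spec ζ i f

lemma heckeOp_C_mul (ζ : ℂ) (i : ℕ) (c : ℂ) (f : MvPolynomial ℕ ℂ) :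
    heckeOp ζ i (C c * f) = C c * heckeOp ζ i f := heckeOp_mul (sw_C i c) f

lemma sw_heckeOp (ζ : ℂ) (i : ℕ) (f : MvPolynomial ℕ ℂ) :
    (X i - X (i + 1)) * sw i (heckeOp ζ i f) =
      -(C ζ * ((C ζ * X i - X (i + 1)) * f - (C ζ - 1) * X (i + 1) * sw i f)) := by
  have := congrArg (sw i) (heckeOp_spec ζ i f)
  simp only [map_mul, map_sub, sw_X_left, sw_X_right, sw_C, sw_sw, map_one] at this
  linear_combination -this

lemma heckeOp_comm {ζ : ℂ} {i j : ℕ} (h : i + 2 ≤ j) (f : MvPolynomial ℕ ℂ) :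
    heckeOp ζ i (heckeOp ζ j f) = heckeOp ζ j (heckeOp ζ i f) := by
  apply heckeOp_unique
  refine mul_left_cancel₀ (X_sub_X_ne_zero (show j ≠ j + 1 by omega)) ?_
  have h1 := heckeOp_spec ζ j (heckeOp ζ i f)
  have h2 := heckeOp_spec ζ i f
  have h3 := heckeOp_spec ζ j f
  have h4 := congrArg (sw i) h3
  have h5 := congrArg (sw j) h2
  simp only [map_mul, map_sub, sw_C, map_one, sw_comm h,
    sw_X_of_ne (show j ≠ i by omega) (show j ≠ i + 1 by omega),
    sw_X_of_ne (show j + 1 ≠ i by omega) (show j + 1 ≠ i + 1 by omega),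
    sw_X_of_ne (show i ≠ j by omega) (show i ≠ j + 1 by omega),
    sw_X_of_ne (show i + 1 ≠ j by omega) (show i + 1 ≠ j + 1 by omega)] at h4 h5
  linear_combination (X i - X (i + 1)) * h1 + C ζ * (C ζ * X (j + 1) - X j) * h5
    - C ζ * (C ζ - 1) * X j * h2 - C ζ * (C ζ * X (i + 1) - X i) * h4
    + C ζ * (C ζ - 1) * X i * h3

lemma heckeOp_braid (ζ : ℂ) (i : ℕ) (f : MvPolynomial ℕ ℂ) :
    heckeOp ζ i (heckeOp ζ (i + 1) (heckeOp ζ i f)) =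
      heckeOp ζ (i + 1) (heckeOp ζ i (heckeOp ζ (i + 1) f)) := by
  set g1 := heckeOp ζ i f with hg1
  set g2 := heckeOp ζ (i + 1) g1 with hg2
  set k1 := heckeOp ζ (i + 1) f with hk1
  set k2 := heckeOp ζ i k1 with hk2
  have c1 : sw i (X (i + 1 + 1)) = X (i + 1 + 1) := sw_X_of_ne (by omega) (by omega)
  have c2 : sw (i + 1) (X i) = X i := sw_X_of_ne (by omega) (by omega)
  have a1 := heckeOp_spec ζ i f
  have a2 := heckeOp_spec ζ (i + 1) g1
  have a3 := heckeOp_spec ζ i g2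
  have b1 := heckeOp_spec ζ (i + 1) f
  have b2 := heckeOp_spec ζ i k1
  have b3 := heckeOp_spec ζ (i + 1) k2
  rw [← hg1] at a1
  rw [← hg2] at a2
  rw [← hk1] at b1
  rw [← hk2] at b2
  have a1a := congrArg (sw i) a1
  have a1b := congrArg (sw (i + 1)) a1
  have a1ab := congrArg (sw i) a1b
  have a2a := congrArg (sw i) a2
  have b1b := congrArg (sw (i + 1)) b1
  have b1a := congrArg (sw i) b1
  have b1ba := congrArg (sw (i + 1)) b1a
  have b2b := congrArg (sw (i + 1)) b2
  simp only [map_mul, map_sub, sw_X_left, sw_X_right, sw_C, map_one, sw_sw, c1, c2]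
    at a1a a1b a1ab a2a b1b b1a b1ba b2b
  rw [← sw_braid] at b1ba
  have hne : (X i - X (i + 1) : MvPolynomial ℕ ℂ) ^ 2 * (X (i + 1) - X (i + 1 + 1)) ^ 2 *
      (X i - X (i + 1 + 1)) ≠ 0 :=
    mul_ne_zero (mul_ne_zero (pow_ne_zero _ (X_sub_X_ne_zero (by omega)))
      (pow_ne_zero _ (X_sub_X_ne_zero (by omega)))) (X_sub_X_ne_zero (by omega))
  refine mul_left_cancel₀ hne ?_
  generalize heckeOp ζ i g2 = g3 at *
  generalize heckeOp ζ (i + 1) k2 = k3 at *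
  clear_value g1 g2 k1 k2
  clear hg1 hg2 hk1 hk2 hne c1 c2
  generalize (X i : MvPolynomial ℕ ℂ) = x at *
  generalize (X (i + 1) : MvPolynomial ℕ ℂ) = y at *
  generalize (X (i + 1 + 1) : MvPolynomial ℕ ℂ) = z at *
  generalize (C ζ : MvPolynomial ℕ ℂ) = c at *
  linear_combination a3 * ((x - y) * (y - z) ^ 2 * (x - z))
    + a2a * ((x - y) * (y - z) ^ 2 * (c * (c * y - x)))
    + a1ab * ((x - y) * (y - z) * (c * (c * y - x)) * (c * (c * z - x)))
    - a1a * ((y - z) ^ 2 * (c * (c * y - x)) * (-(c * (c - 1) * x)))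
    + a2 * ((x - y) * (x - z) * (y - z) * (-(c * (c - 1) * x)))
    + a1b * ((x - y) * (y - z) * (-(c * (c - 1) * x)) * (c * (c * z - y)))
    + a1 * ((y - z) * (x - z) * (-(c * (c - 1) * x)) * (-(c * (c - 1) * y)))
    - b3 * ((x - y) ^ 2 * (y - z) * (x - z))
    - b2b * ((x - y) ^ 2 * (y - z) * (c * (c * z - y)))
    - b1ba * ((x - y) * (y - z) * (c * (c * z - y)) * (c * (c * z - x)))
    + b1b * ((x - y) ^ 2 * (c * (c * z - y)) * (-(c * (c - 1) * x)))
    - b2 * ((x - y) * (y - z) * (x - z) * (-(c * (c - 1) * y)))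
    - b1a * ((x - y) * (y - z) * (-(c * (c - 1) * y)) * (c * (c * y - x)))
    - b1 * ((x - y) * (x - z) * (-(c * (c - 1) * y)) * (-(c * (c - 1) * x)))

end XXZ

namespace XXZ
open MvPolynomial

/-- `T_s T_{s+1} ⋯ T_{s+p-1}`. -/
def ins (ζ : ℂ) : ℕ → ℕ → MvPolynomial ℕ ℂ → MvPolynomial ℕ ℂ
  | 0, _, g => g
  | p + 1, s, g => heckeOp ζ s (ins ζ p (s + 1) g)

/-- The component of the spin word `l` (occupying sites `s, s + 1, …`) of the family generated by
the exchange relations from its component `g` on the sorted word `↑⋯↑↓⋯↓`. -/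
def compOp (ζ : ℂ) : List Bool → ℕ → MvPolynomial ℕ ℂ → MvPolynomial ℕ ℂ
  | [], _, g => g
  | x :: l, s, g => compOp ζ l (s + 1) (if x then g else ins ζ (l.count true) s g)

lemma ins_C_mul (ζ c : ℂ) (p s : ℕ) (g : MvPolynomial ℕ ℂ) :
    ins ζ p s (C c * g) = C c * ins ζ p s g := by
  induction p generalizing s with
  | zero => rfl
  | succ p ih => simp only [ins, ih, heckeOp_C_mul]

lemma compOp_C_mul (ζ c : ℂ) (l : List Bool) (s : ℕ) (g : MvPolynomial ℕ ℂ) :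
    compOp ζ l s (C c * g) = C c * compOp ζ l s g := by
  induction l generalizing s g with
  | nil => rfl
  | cons x l ih => cases x <;> simp [compOp, ih, ins_C_mul]

lemma heckeOp_ins {ζ : ℂ} {i s : ℕ} (h : i + 2 ≤ s) (p : ℕ) (g : MvPolynomial ℕ ℂ) :
    heckeOp ζ i (ins ζ p s g) = ins ζ p s (heckeOp ζ i g) := by
  induction p generalizing s with
  | zero => rfl
  | succ p ih => rw [ins, ins, heckeOp_comm h, ih (by omega)]

lemma heckeOp_ins_right {ζ : ℂ} {i s p : ℕ} (h : s + p + 1 ≤ i) (g : MvPolynomial ℕ ℂ) :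
    heckeOp ζ i (ins ζ p s g) = ins ζ p s (heckeOp ζ i g) := by
  induction p generalizing s with
  | zero => rfl
  | succ p ih => rw [ins, ins, ← heckeOp_comm (by omega), ih (by omega)]

lemma heckeOp_ins_mid {ζ : ℂ} {i s p : ℕ} (h1 : s ≤ i) (h2 : i + 1 < s + p)
    (g : MvPolynomial ℕ ℂ) :
    heckeOp ζ (i + 1) (ins ζ p s g) = ins ζ p s (heckeOp ζ i g) := by
  induction p generalizing s with
  | zero => omega
  | succ p ih =>
    obtain rfl | h1 := h1.eq_or_lt
    · obtain ⟨q, rfl⟩ : ∃ q, p = q + 1 := ⟨p - 1, by omega⟩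
      rw [ins, ins, ← heckeOp_braid, heckeOp_ins (by omega)]
      rfl
    · rw [ins, ins, ← heckeOp_comm (by omega), ih (by omega) (by omega)]

lemma heckeOp_ins_ins (ζ : ℂ) (p s : ℕ) (g : MvPolynomial ℕ ℂ) :
    heckeOp ζ s (ins ζ p (s + 1) (ins ζ p s g)) =
      ins ζ p (s + 1) (ins ζ p s (heckeOp ζ (s + p) g)) := by
  induction p generalizing s with
  | zero => rfl
  | succ p ih =>
    have e : s + (p + 1) = s + 1 + p := by omega
    simp only [ins]
    rw [← heckeOp_ins (i := s) (s := s + 1 + 1) le_rfl, heckeOp_braid, ih,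
      ← heckeOp_ins (i := s) (s := s + 1 + 1) le_rfl, e]

lemma heckeOp_compOp {ζ : ℂ} {i s : ℕ} (h : i + 2 ≤ s) (l : List Bool) (g : MvPolynomial ℕ ℂ) :
    heckeOp ζ i (compOp ζ l s g) = compOp ζ l s (heckeOp ζ i g) := by
  induction l generalizing s g with
  | nil => rfl
  | cons x l ih => cases x <;> simp [compOp, ih (show i + 2 ≤ s + 1 by omega), heckeOp_ins h]

lemma compOp_exchange (ζ : ℂ) (l₁ l₂ : List Bool) (s : ℕ) (g : MvPolynomial ℕ ℂ) :
    compOp ζ (l₁ ++ false :: true :: l₂) s g =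
      heckeOp ζ (s + l₁.length) (compOp ζ (l₁ ++ true :: false :: l₂) s g) := by
  induction l₁ generalizing s g with
  | nil => simp [compOp, ins, heckeOp_compOp]
  | cons x l ih =>
    have e : s + (l.length + 1) = s + 1 + l.length := by omega
    simp only [List.cons_append, compOp, List.length_cons, ih, e]
    simp [List.count_append]

/-- `g` satisfies the aligned-spin relations of the sorted word `↑^p ↓^m` on sites `s, s + 1, …`. -/
def Aligned (ζ : ℂ) (s p m : ℕ) (g : MvPolynomial ℕ ℂ) : Prop :=
  (∀ i, s ≤ i → i + 1 < s + p → heckeOp ζ i g = C ζ * g) ∧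
    ∀ i, s + p ≤ i → i + 1 < s + p + m → heckeOp ζ i g = C ζ * g

lemma Aligned.ins {ζ : ℂ} {s p m : ℕ} {g : MvPolynomial ℕ ℂ} (h : Aligned ζ s p (m + 1) g) :
    Aligned ζ (s + 1) p m (ins ζ p s g) := by
  refine ⟨fun i h1 h2 => ?_, fun i h1 h2 => ?_⟩
  · obtain ⟨j, rfl⟩ : ∃ j, i = j + 1 := ⟨i - 1, by omega⟩
    rw [heckeOp_ins_mid (by omega) (by omega), h.1 j (by omega) (by omega), ins_C_mul]
  · rw [heckeOp_ins_right (by omega), h.2 i (by omega) (by omega), ins_C_mul]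

lemma compOp_aligned (ζ : ℂ) (x : Bool) (l₁ l₂ : List Bool) (s : ℕ) (g : MvPolynomial ℕ ℂ)
    (h : Aligned ζ s ((l₁ ++ x :: x :: l₂).count true) ((l₁ ++ x :: x :: l₂).count false) g) :
    heckeOp ζ (s + l₁.length) (compOp ζ (l₁ ++ x :: x :: l₂) s g) =
      C ζ * compOp ζ (l₁ ++ x :: x :: l₂) s g := by
  induction l₁ generalizing s g with
  | nil =>
    cases x
    · simp only [List.nil_append, List.length_nil, Nat.add_zero, compOp, List.count_cons] at h ⊢
      simp only [beq_iff_eq, Bool.false_eq_true, if_false, Nat.add_zero, if_true] at h ⊢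
      rw [heckeOp_compOp (by omega), heckeOp_ins_ins, h.2 _ (by omega) (by omega)]
      simp only [ins_C_mul, compOp_C_mul]
    · simp only [List.nil_append, List.length_nil, Nat.add_zero, compOp, List.count_cons] at h ⊢
      simp only [beq_iff_eq, if_true] at h ⊢
      rw [heckeOp_compOp (by omega), h.1 _ (by omega) (by omega), compOp_C_mul]
  | cons y l ih =>
    have e : s + (l.length + 1) = s + 1 + l.length := by omega
    simp only [List.cons_append, compOp, List.length_cons, e]
    apply ih
    cases y
    · simp only [List.cons_append, List.count_cons_self,
          List.count_cons_of_ne (a := true) (b := false) (by simp)] at h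
      simpa using h.ins
    · simp only [List.cons_append, List.count_cons_self,
          List.count_cons_of_ne (a := false) (b := true) (by simp)] at h
      simp only [if_true]
      exact ⟨fun i h1 h2 => h.1 i (by omega) (by omega), fun i h1 h2 => h.2 i (by omega) (by omega)⟩

/-- The word `↑^p ↓^m`. -/
def sorted (p m : ℕ) : List Bool := List.replicate p true ++ List.replicate m false

lemma count_true_sorted (p m : ℕ) : (sorted p m).count true = p := by
  simp [sorted, List.count_replicate]

lemma count_false_sorted (p m : ℕ) : (sorted p m).count false = m := by
  simp [sorted, List.count_replicate]

lemma count_add_count (l : List Bool) : l.count true + l.count false = l.length := by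
  induction l with
  | nil => rfl
  | cons x l ih => cases x <;> simp <;> omega

lemma sort_induction {Q : List Bool → Prop}
    (hQ : ∀ l₁ l₂, Q (l₁ ++ true :: false :: l₂) → Q (l₁ ++ false :: true :: l₂)) (l : List Bool)
    (h : Q (sorted (l.count true) (l.count false))) : Q l := by
  have move : ∀ a (pre r : List Bool), Q (pre ++ (List.replicate a true ++ false :: r)) →
      Q (pre ++ false :: (List.replicate a true ++ r)) := by
    intro a
    induction a with
    | zero => intro pre r h; simpa using h
    | succ a ih =>
      intro pre r h
      have := ih (pre ++ [true]) r (by simpa [List.replicate_succ] using h)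
      have := hQ pre (List.replicate a true ++ r) (by simpa using this)
      simpa [List.replicate_succ] using this
  have key : ∀ l pre : List Bool, Q (pre ++ sorted (l.count true) (l.count false)) →
      Q (pre ++ l) := by
    intro l
    induction l with
    | nil => intro pre h; simpa [sorted] using h
    | cons x l ih =>
      intro pre h
      cases x
      · have := ih (pre ++ [false]) (by
          have := move (l.count true) pre (List.replicate (l.count false) false)
            (by simpa [sorted, List.replicate_succ] using h)
          simpa [sorted] using this)
        simpa using this
      · have := ih (pre ++ [true]) (by simpa [sorted, List.replicate_succ] using h)
        simpa using this
  simpa using key l [] (by simpa using h)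

/-- Exchange relations for a family of polynomials indexed by words of length `L`, the first site
carrying the variable `X c`. -/
def Exch (ζ : ℂ) (c L : ℕ) (Φ : List Bool → MvPolynomial ℕ ℂ) : Prop :=
  ∀ l₁ l₂, l₁.length + l₂.length + 2 = L → Φ (l₁ ++ false :: true :: l₂) =
    heckeOp ζ (c + l₁.length) (Φ (l₁ ++ true :: false :: l₂))

lemma Exch.ext {ζ : ℂ} {c L : ℕ} {Φ Φ' : List Bool → MvPolynomial ℕ ℂ} (h : Exch ζ c L Φ)
    (h' : Exch ζ c L Φ') (l : List Bool) (hl : l.length = L)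
    (hs : Φ (sorted (l.count true) (l.count false)) = Φ' (sorted (l.count true) (l.count false))) :
    Φ l = Φ' l := by
  refine sort_induction (Q := fun l => l.length = L → Φ l = Φ' l) (fun l₁ l₂ ih hL => ?_) l
    (fun _ => hs) hl
  have e : l₁.length + l₂.length + 2 = L := by simp at hL; omega
  rw [h _ _ e, h' _ _ e, ih (by simp; omega)]

lemma compOp_sorted (ζ : ℂ) (p m s : ℕ) (g : MvPolynomial ℕ ℂ) : compOp ζ (sorted p m) s g = g := by
  induction p generalizing s with
  | succ p ih =>
    have : sorted (p + 1) m = true :: sorted p m := rfl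
    simp [this, compOp, ih]
  | zero =>
    induction m generalizing s with
    | zero => rfl
    | succ m ih =>
      have e : sorted 0 (m + 1) = false :: sorted 0 m := rfl
      simp [e, compOp, ih, count_true_sorted, ins]

end XXZ

namespace XXZ
open MvPolynomial

/-- `∏_{s ≤ i < j < s + n} (ζ X_j - X_i)`. -/
def pairProd (ζ : ℂ) : ℕ → ℕ → MvPolynomial ℕ ℂ
  | 0, _ => 1
  | n + 1, s => (∏ j ∈ Finset.Ico (s + 1) (s + 1 + n), (C ζ * X j - X s)) * pairProd ζ n (s + 1)

lemma sw_X (i j : ℕ) : sw i (X j) = X (Equiv.swap i (i + 1) j) := by simp [sw]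

lemma prod_swap {M : Type*} [CommMonoid M] {i a b : ℕ} (h1 : a ≤ i) (h2 : i + 1 < b) (f : ℕ → M) :
    ∏ j ∈ Finset.Ico a b, f (Equiv.swap i (i + 1) j) = ∏ j ∈ Finset.Ico a b, f j := by
  apply Equiv.Perm.prod_comp
  intro x hx
  by_contra h
  simp only [Finset.coe_Ico, Set.mem_Ico, not_and_or, not_le, not_lt] at h
  exact hx (Equiv.swap_apply_of_ne_of_ne (by omega) (by omega))

lemma sw_pairProd_left {ζ : ℂ} {i s : ℕ} (h : i + 2 ≤ s) (n : ℕ) :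
    sw i (pairProd ζ n s) = pairProd ζ n s := by
  induction n generalizing s with
  | zero => simp [pairProd]
  | succ n ih =>
    rw [pairProd, map_mul, ih (by omega), map_prod]
    congr 1
    refine Finset.prod_congr rfl fun j hj => ?_
    rw [Finset.mem_Ico] at hj
    simp only [map_sub, map_mul, sw_C]
    rw [sw_X_of_ne (by omega) (by omega), sw_X_of_ne (by omega) (by omega)]

lemma sw_eval (i : ℕ) (P : Polynomial (MvPolynomial ℕ ℂ)) (x : MvPolynomial ℕ ℂ) :
    sw i (P.eval x) = (P.map (sw i).toRingHom).eval (sw i x) :=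
  (Polynomial.eval_map_apply (f := (sw i).toRingHom) (p := P) x).symm

/-- The product of exchange operators moving one spin past `n` aligned ones. -/
lemma ins_pairProd {ζ : ℂ} (hζ : ζ ^ 2 + ζ + 1 = 0) (n s : ℕ) (P : Polynomial (MvPolynomial ℕ ℂ))
    (hdeg : P.natDegree ≤ n) (hP : ∀ i, s ≤ i → i < s + n → P.map (sw i).toRingHom = P) :
    ins ζ n s (pairProd ζ n s * P.eval (X (s + n))) =
      C (-ζ ^ 2) ^ n * pairProd ζ n (s + 1) * P.eval (C (ζ ^ 2) * X s) := by
  have hz3 : (C ζ : MvPolynomial ℕ ℂ) ^ 3 = 1 := by rw [← map_pow, cube_eq_one hζ, map_one]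
  induction n generalizing s P with
  | zero =>
    rw [Polynomial.eq_C_of_natDegree_le_zero hdeg]
    simp [ins, pairProd]
  | succ n ih =>
    set S : MvPolynomial ℕ ℂ := ∏ j ∈ Finset.Ico (s + 1) (s + 1 + (n + 1)), (C ζ * X j - X s)
      with hS
    set a : MvPolynomial ℕ ℂ := P.eval (C (ζ ^ 2) * X s) with ha
    set b : MvPolynomial ℕ ℂ := P.eval (C (ζ ^ 2) * X (s + 1)) with hb
    set W : Polynomial (MvPolynomial ℕ ℂ) := Polynomial.C S * P - Polynomial.C a *
      ∏ j ∈ Finset.Ico (s + 1) (s + 1 + (n + 1)),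
        (Polynomial.C (C ζ * X j) - Polynomial.C (C ζ) * Polynomial.X) with hW
    have hWroot : W.IsRoot (C (ζ ^ 2) * X s) := by
      rw [Polynomial.IsRoot, hW, Polynomial.eval_sub, Polynomial.eval_mul, Polynomial.eval_mul,
        Polynomial.eval_prod, Polynomial.eval_C, Polynomial.eval_C, ← ha, mul_comm S a, hS,
        sub_eq_zero]
      congr 1
      refine Finset.prod_congr rfl fun j _ => ?_
      simp only [Polynomial.eval_sub, Polynomial.eval_mul, Polynomial.eval_C, Polynomial.eval_X,
        map_pow]
      linear_combination X s * hz3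
    obtain ⟨Q', hQ'⟩ := Polynomial.dvd_iff_isRoot.mpr hWroot
    set Q := Polynomial.C (C (ζ ^ 2)) * Q' with hQdef
    have hQ : (Polynomial.C (C ζ) * Polynomial.X - Polynomial.C (X s)) * Q = W := by
      rw [hQ', hQdef]
      have : (Polynomial.C (C ζ) : Polynomial (MvPolynomial ℕ ℂ)) ^ 3 = 1 := by
        rw [← map_pow, hz3, map_one]
      simp only [map_pow, map_mul]
      linear_combination (Polynomial.X * Q') * this
    have hlin : (Polynomial.C (C ζ) * Polynomial.X - Polynomial.C (X s) :
        Polynomial (MvPolynomial ℕ ℂ)) ≠ 0 := by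
      intro h
      have := congrArg (Polynomial.eval 0) h
      simp at this
    have hWdeg : W.natDegree ≤ n + 1 := by
      refine (Polynomial.natDegree_sub_le _ _).trans (max_le ?_ ?_)
      · exact (Polynomial.natDegree_C_mul_le _ _).trans hdeg
      · refine (Polynomial.natDegree_C_mul_le _ _).trans ?_
        refine (Polynomial.natDegree_prod_le _ _).trans ?_
        refine (Finset.sum_le_card_nsmul _ _ 1 fun j _ => ?_).trans (by simp)
        refine (Polynomial.natDegree_sub_le _ _).trans (max_le ?_ ?_)
        · rw [Polynomial.natDegree_C]; omega
        · exact (Polynomial.natDegree_C_mul_le _ _).trans Polynomial.natDegree_X_le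
    have hQdeg : Q.natDegree ≤ n := by
      have h1 : Q.natDegree ≤ Q'.natDegree := Polynomial.natDegree_C_mul_le _ _
      by_cases h0 : Q' = 0
      · rw [h0] at h1; simpa using h1.trans (by simp)
      have h2 : W.natDegree = 1 + Q'.natDegree := by
        rw [hQ', Polynomial.natDegree_mul (Polynomial.X_sub_C_ne_zero _) h0,
          Polynomial.natDegree_X_sub_C]
      omega
    have hSsymm : ∀ i, s + 1 ≤ i → i < s + 1 + n → sw i S = S := by
      intro i h1 h2
      rw [hS, map_prod, ← prod_swap (i := i) (by omega) (by omega)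
        (fun j => (C ζ * X j - X s : MvPolynomial ℕ ℂ))]
      refine Finset.prod_congr rfl fun j _ => ?_
      rw [map_sub, map_mul, sw_C, sw_X, sw_X_of_ne (by omega) (by omega)]
    have hasymm : ∀ i, s + 1 ≤ i → i < s + 1 + n → sw i a = a := by
      intro i h1 h2
      rw [ha, sw_eval, hP i (by omega) (by omega), map_mul, sw_C, sw_X_of_ne (by omega) (by omega)]
    have hQsymm : ∀ i, s + 1 ≤ i → i < s + 1 + n → Q.map (sw i).toRingHom = Q := by
      intro i h1 h2
      apply mul_left_cancel₀ hlin
      have hWs : W.map (sw i).toRingHom = W := by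
        rw [hW, Polynomial.map_sub, Polynomial.map_mul, Polynomial.map_mul, Polynomial.map_C,
          Polynomial.map_C, hP i (by omega) (by omega), Polynomial.map_prod]
        have e1 : (sw i).toRingHom S = S := hSsymm i h1 h2
        have e2 : (sw i).toRingHom a = a := hasymm i h1 h2
        rw [e1, e2, ← prod_swap (i := i) (a := s + 1) (b := s + 1 + (n + 1)) (by omega) (by omega)
          (fun j => (Polynomial.C (C ζ * X j) - Polynomial.C (C ζ) * Polynomial.X :
            Polynomial (MvPolynomial ℕ ℂ)))]
        congr 2
        refine Finset.prod_congr rfl fun j _ => ?_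
        simp [sw_X]
      have := congrArg (Polynomial.map (sw i).toRingHom) hQ
      rw [hWs, Polynomial.map_mul] at this
      rw [hQ, ← this]
      simp [sw_X_of_ne (show s ≠ i by omega) (show s ≠ i + 1 by omega)]
    clear_value Q W
    set α : MvPolynomial ℕ ℂ := ∏ j ∈ Finset.Ico (s + 2) (s + 2 + n), (C ζ * X j - X s) with hα
    set β : MvPolynomial ℕ ℂ := ∏ j ∈ Finset.Ico (s + 2) (s + 2 + n), (C ζ * X j - X (s + 1))
      with hβ
    have hQev : pairProd ζ (n + 1) s * P.eval (X (s + (n + 1))) =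
        pairProd ζ n (s + 1) * Q.eval (X (s + 1 + n)) := by
      have h := congrArg (Polynomial.eval (X (s + 1 + n))) hQ
      have hS' : S = (∏ j ∈ Finset.Ico (s + 1) (s + 1 + n), (C ζ * X j - X s)) *
          (C ζ * X (s + 1 + n) - X s) := by
        rw [hS, ← Finset.prod_Ico_succ_top (by omega)]; rfl
      simp only [hW, Polynomial.eval_sub, Polynomial.eval_mul, Polynomial.eval_C,
        Polynomial.eval_X, Polynomial.eval_prod] at h
      rw [Finset.prod_eq_zero (i := s + 1 + n) (by simp) (by simp), hS'] at h
      have hne : (C ζ * X (s + 1 + n) - X s : MvPolynomial ℕ ℂ) ≠ 0 := by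
        intro h0
        have := congrArg (eval fun j => if j = s then (1 : ℂ) else 0) h0
        simp [show s + 1 + n ≠ s by omega] at this
      rw [pairProd, show s + (n + 1) = s + 1 + n by omega, mul_comm (∏ _ ∈ _, _), mul_assoc]
      congr 1
      apply mul_left_cancel₀ hne
      linear_combination -h
    set q := Q.eval (C (ζ ^ 2) * X (s + 1)) with hq
    have hqspec : (X (s + 1) - X s) * q =
        (C ζ * X (s + 1) - X s) * α * b - (C ζ - 1) * X (s + 1) * β * a := by
      have h := congrArg (Polynomial.eval (C (ζ ^ 2) * X (s + 1))) hQ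
      have hS' : S = (C ζ * X (s + 1) - X s) * α := by
        rw [hS, Finset.prod_eq_prod_Ico_succ_bot (by omega), hα]
        congr 3; omega
      have hpr : ∏ j ∈ Finset.Ico (s + 1) (s + 1 + (n + 1)),
          (C ζ * X j - C ζ * (C (ζ ^ 2) * X (s + 1)) : MvPolynomial ℕ ℂ) =
          (C ζ - 1) * X (s + 1) * β := by
        have e : ∀ j, (C ζ * X j - C ζ * (C (ζ ^ 2) * X (s + 1)) : MvPolynomial ℕ ℂ) =
            C ζ * X j - X (s + 1) := fun j => by
          rw [map_pow]; linear_combination -X (s + 1) * hz3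
        simp only [e]
        rw [Finset.prod_eq_prod_Ico_succ_bot (by omega), hβ,
          show s + 1 + (n + 1) = s + 2 + n by omega]
        ring
      simp only [hW, Polynomial.eval_sub, Polynomial.eval_mul, Polynomial.eval_C,
        Polynomial.eval_X, Polynomial.eval_prod] at h
      rw [hpr, ← hb, ← hq, hS', map_pow] at h
      linear_combination h - X (s + 1) * q * hz3
    have hsa : sw s a = b := by
      rw [ha, sw_eval, hP s le_rfl (by omega), map_mul, sw_C, sw_X_left]
    have hsb : sw s b = a := by rw [← hsa, sw_sw]
    have hsα : sw s α = β := by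
      rw [hα, hβ, map_prod]
      refine Finset.prod_congr rfl fun j hj => ?_
      rw [Finset.mem_Ico] at hj
      rw [map_sub, map_mul, sw_C, sw_X_left, sw_X_of_ne (by omega) (by omega)]
    have hsβ : sw s β = α := by rw [← hsα, sw_sw]
    have hT : heckeOp ζ s q = -(C ζ ^ 2 * β * a) := by
      apply heckeOp_unique
      have h2 := congrArg (sw s) hqspec
      simp only [map_mul, map_sub, sw_X_left, sw_X_right, sw_C, map_one, hsa, hsb, hsα, hsβ] at h2
      refine mul_left_cancel₀ (X_sub_X_ne_zero (show s ≠ s + 1 by omega)) ?_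
      linear_combination -C ζ * (C ζ * X (s + 1) - X s) * h2
        - C ζ * (C ζ - 1) * X s * hqspec
    have hinv : sw s (C (-ζ ^ 2) ^ n * pairProd ζ n (s + 2)) =
        C (-ζ ^ 2) ^ n * pairProd ζ n (s + 2) := by
      rw [map_mul, sw_pairProd_left (by omega), map_pow, sw_C]
    rw [hQev, ins, ih (s + 1) Q hQdeg hQsymm, ← hq, heckeOp_mul hinv, hT, pairProd, ← hβ, map_neg,
      map_pow]
    ring

end XXZ

namespace XXZ
open MvPolynomial

lemma heckeOp_map {ζ : ℂ} {i j : ℕ} (φ : MvPolynomial ℕ ℂ →ₐ[ℂ] MvPolynomial ℕ ℂ)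
    (h1 : φ (X i) = X j) (h2 : φ (X (i + 1)) = X (j + 1)) {f : MvPolynomial ℕ ℂ}
    (hs : φ (sw i f) = sw j (φ f)) : heckeOp ζ j (φ f) = φ (heckeOp ζ i f) := by
  apply heckeOp_unique
  have := congrArg φ (heckeOp_spec ζ i f)
  have hC : φ (C ζ) = C ζ := φ.commutes ζ
  simp only [map_mul, map_sub, map_one, h1, h2, hs, hC] at this
  exact this

/-- Cyclic shift of the first `N` indices. -/
def rot (N i : ℕ) : ℕ := if i < N then (i + 1) % N else i

lemma rot_of_lt {N i : ℕ} (h : i + 1 < N) : rot N i = i + 1 := by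
  rw [rot, if_pos (by omega), Nat.mod_eq_of_lt h]

lemma rot_last {N : ℕ} (h : 0 < N) : rot N (N - 1) = 0 := by
  rw [rot, if_pos (by omega), Nat.sub_add_cancel h, Nat.mod_self]

lemma rot_iterate {N i : ℕ} (h : i < N) (m : ℕ) : (rot N)^[m] i = (i + m) % N := by
  induction m with
  | zero => simp [Nat.mod_eq_of_lt h]
  | succ m ih =>
    rw [Function.iterate_succ_apply', ih, rot, if_pos (Nat.mod_lt _ (by omega))]
    simp [Nat.add_assoc]

lemma rot_injective (N : ℕ) : Function.Injective (rot N) := by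
  intro i j h
  unfold rot at h
  have key : ∀ a < N, (a + 1) % N = if a + 1 = N then 0 else a + 1 := by
    intro a ha
    split_ifs with h
    · rw [h, Nat.mod_self]
    · exact Nat.mod_eq_of_lt (by omega)
  split_ifs at h with h1 h2 h2
  · rw [key i h1, key j h2] at h
    split_ifs at h <;> omega
  · have := Nat.mod_lt (i + 1) (show 0 < N by omega)
    omega
  · have := Nat.mod_lt (j + 1) (show 0 < N by omega)
    omega
  · exact h

lemma rename_rot_sw {N i : ℕ} (h : i + 2 < N) (f : MvPolynomial ℕ ℂ) :
    rename (rot N) (sw i f) = sw (i + 1) (rename (rot N) f) := by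
  rw [sw, sw, rename_rename, rename_rename]
  congr 2
  ext k
  have e1 := rot_of_lt (show i + 1 < N by omega)
  have e2 := rot_of_lt (show i + 1 + 1 < N by omega)
  by_cases h1 : k = i
  · subst h1; simp [e1, e2]
  by_cases h2 : k = i + 1
  · subst h2; simp [e1, e2]
  simp only [Function.comp_apply]
  rw [Equiv.swap_apply_of_ne_of_ne h1 h2, Equiv.swap_apply_of_ne_of_ne]
  · intro h3; exact h1 (rot_injective N (h3.trans e1.symm))
  · intro h3; exact h2 (rot_injective N (h3.trans e2.symm))

lemma heckeOp_rename_rot {ζ : ℂ} {N i : ℕ} (h : i + 2 < N) (f : MvPolynomial ℕ ℂ) :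
    heckeOp ζ (i + 1) (rename (rot N) f) = rename (rot N) (heckeOp ζ i f) := by
  apply heckeOp_map
  · rw [rename_X, rot_of_lt (by omega)]
  · rw [rename_X, rot_of_lt (by omega)]
  · exact rename_rot_sw h f

lemma rename_pairProd {ζ : ℂ} {f : ℕ → ℕ} {n s s' : ℕ} (h : ∀ j < n, f (s + j) = s' + j) :
    rename f (pairProd ζ n s) = pairProd ζ n s' := by
  induction n generalizing s s' with
  | zero => simp [pairProd]
  | succ n ih =>
    rw [pairProd, pairProd, map_mul, ih (s := s + 1) (s' := s' + 1), map_prod,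
      Finset.prod_Ico_eq_prod_range, Finset.prod_Ico_eq_prod_range]
    · congr 1
      refine Finset.prod_congr (by simp) fun j hj => ?_
      simp only [Finset.mem_range] at hj
      have h0 := h 0 (by omega)
      simp only [Nat.add_zero] at h0
      simp only [map_sub, map_mul, rename_C, rename_X, h0]
      rw [show s + 1 + j = s + (j + 1) by omega, h (j + 1) (by omega)]
      congr 3
      omega
    · intro j hj
      rw [show s + 1 + j = s + (j + 1) by omega, h _ (by omega)]
      omega

lemma pairProd_succ (ζ : ℂ) (n s : ℕ) : pairProd ζ (n + 1) s =
    (∏ j ∈ Finset.Ico (s + 1) (s + 1 + n), (C ζ * X j - X s)) * pairProd ζ n (s + 1) := rfl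

lemma pairProd_succ_last (ζ : ℂ) (n s : ℕ) : pairProd ζ (n + 1) s =
    pairProd ζ n s * ∏ i ∈ Finset.Ico s (s + n), (C ζ * X (s + n) - X i) := by
  induction n generalizing s with
  | zero => simp [pairProd]
  | succ n ih =>
    rw [pairProd, ih, pairProd, show s + 1 + (n + 1) = (s + 1 + n) + 1 by omega,
      Finset.prod_Ico_succ_top (by omega), show s + (n + 1) = s + 1 + n by omega,
      Finset.prod_eq_prod_Ico_succ_bot (show s < s + 1 + n by omega)]
    ring

/-- The fully sorted component `↑^n ↓^n`. -/
def baseComp (ζ : ℂ) (n : ℕ) : MvPolynomial ℕ ℂ := pairProd ζ n 0 * pairProd ζ n n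

lemma Exch.ins {ζ : ℂ} {c L : ℕ} {Φ : List Bool → MvPolynomial ℕ ℂ} (h : Exch ζ c L Φ)
    (p : ℕ) (pre r : List Bool) (hL : pre.length + p + 1 + r.length = L) :
    Φ (pre ++ false :: (List.replicate p true ++ r)) =
      ins ζ p (c + pre.length) (Φ (pre ++ (List.replicate p true ++ false :: r))) := by
  induction p generalizing pre with
  | zero => rfl
  | succ p ih =>
    have h1 := h pre (List.replicate p true ++ r) (by simp; omega)
    have h2 := ih (pre ++ [true]) (by simp; omega)
    simp only [List.append_assoc, List.singleton_append, List.length_append, List.length_singleton]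
      at h2
    rw [List.replicate_succ, List.cons_append, h1, h2, XXZ.ins, Nat.add_assoc]
    rfl

lemma ins_base {ζ : ℂ} (hζ : ζ ^ 2 + ζ + 1 = 0) {n : ℕ} (hn : 1 ≤ n) {ε : ℕ} (hε : ε ≤ 1) :
    ins ζ n 0 (baseComp ζ n * (∏ j ∈ Finset.Ico n (2 * n), X j) ^ ε) =
      C (-ζ ^ 2 * (ζ ^ 2) ^ ε) *
        rename (rot (2 * n)) (baseComp ζ n * (∏ j ∈ Finset.Ico n (2 * n), X j) ^ ε) := by
  obtain ⟨m, rfl⟩ : ∃ m, n = m + 1 := ⟨n - 1, by omega⟩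
  set B : MvPolynomial ℕ ℂ := pairProd ζ m (m + 2) *
    (∏ j ∈ Finset.Ico (m + 2) (2 * (m + 1)), X j) ^ ε with hB
  set P : Polynomial (MvPolynomial ℕ ℂ) := Polynomial.C B *
    (Polynomial.X ^ ε * ∏ j ∈ Finset.Ico (m + 2) (2 * (m + 1)),
      (Polynomial.C (C ζ * X j) - Polynomial.X)) with hP
  have hPe : ∀ x, P.eval x = B * (x ^ ε * ∏ j ∈ Finset.Ico (m + 2) (2 * (m + 1)),
      (C ζ * X j - x)) := by
    intro x
    simp [hP, Polynomial.eval_prod]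
  have hfix : ∀ i < m + 1, ∀ j ∈ Finset.Ico (m + 2) (2 * (m + 1)), sw i (X j) = X j := by
    intro i hi j hj
    rw [Finset.mem_Ico] at hj
    exact sw_X_of_ne (by omega) (by omega)
  have key := ins_pairProd hζ (m + 1) 0 P ?_ ?_
  · have e1 : baseComp ζ (m + 1) * (∏ j ∈ Finset.Ico (m + 1) (2 * (m + 1)), X j) ^ ε =
        pairProd ζ (m + 1) 0 * P.eval (X (0 + (m + 1))) := by
      rw [hPe, baseComp, hB, Finset.prod_eq_prod_Ico_succ_bot (by omega)]
      rw [pairProd_succ ζ m (m + 1)]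
      rw [show m + 1 + 1 + m = 2 * (m + 1) by omega, Nat.zero_add, show m + 1 + 1 = m + 2 from rfl]
      ring
    have e2 : rename (rot (2 * (m + 1))) (pairProd ζ (m + 1) (m + 1)) =
        pairProd ζ m (m + 2) * ∏ j ∈ Finset.Ico (m + 2) (2 * (m + 1)), (C ζ * X 0 - X j) := by
      rw [pairProd_succ_last, map_mul, rename_pairProd (s' := m + 2), map_prod,
        Finset.prod_Ico_eq_prod_range, Finset.prod_Ico_eq_prod_range]
      · congr 1
        refine Finset.prod_congr (congrArg _ (by omega)) fun j hj => ?_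
        simp only [Finset.mem_range] at hj
        simp only [map_sub, map_mul, rename_C, rename_X]
        rw [show m + 1 + m = 2 * (m + 1) - 1 by omega, rot_last (by omega),
          rot_of_lt (by omega)]
        congr 2
        omega
      · intro j hj
        rw [rot_of_lt (by omega)]
        omega
    have e3 : rename (rot (2 * (m + 1))) (∏ j ∈ Finset.Ico (m + 1) (2 * (m + 1)), X j) =
        (X 0 * ∏ j ∈ Finset.Ico (m + 2) (2 * (m + 1)), X j : MvPolynomial ℕ ℂ) := by
      rw [show 2 * (m + 1) = (2 * m + 1) + 1 by ring, Finset.prod_Ico_succ_top (by omega), map_mul,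
        map_prod, rename_X, show 2 * m + 1 + 1 = 2 * (m + 1) by ring,
        show 2 * m + 1 = 2 * (m + 1) - 1 by omega, rot_last (by omega), mul_comm,
        Finset.prod_Ico_eq_prod_range, Finset.prod_Ico_eq_prod_range]
      congr 1
      refine Finset.prod_congr (congrArg _ (by omega)) fun j hj => ?_
      simp only [Finset.mem_range] at hj
      rw [rename_X, rot_of_lt (by omega)]
      congr 1
      omega
    have e4 : ∏ j ∈ Finset.Ico (m + 2) (2 * (m + 1)),
        (C ζ * X j - C (ζ ^ 2) * X 0 : MvPolynomial ℕ ℂ) =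
        (-C ζ) ^ m * ∏ j ∈ Finset.Ico (m + 2) (2 * (m + 1)), (C ζ * X 0 - X j) := by
      have : m = (Finset.Ico (m + 2) (2 * (m + 1))).card := by rw [Nat.card_Ico]; omega
      conv_rhs => rw [this, ← Finset.prod_const]
      rw [← this, ← Finset.prod_mul_distrib]
      refine Finset.prod_congr rfl fun j _ => ?_
      rw [map_pow]; ring
    rw [e1, key, ← e1, hPe, e4, hB, map_mul (rename _), baseComp, map_mul (rename _),
      map_pow (rename _), e2, e3,
      rename_pairProd (s' := 1) (fun j hj => by rw [rot_of_lt (by omega)]; omega)]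
    have hz3 : (C ζ : MvPolynomial ℕ ℂ) ^ 3 = 1 := by rw [← map_pow, cube_eq_one hζ, map_one]
    have e5 : (C (-ζ ^ 2) : MvPolynomial ℕ ℂ) ^ (m + 1) * (-C ζ) ^ m = -C ζ ^ 2 := by
      rw [pow_succ, mul_right_comm, ← mul_pow, map_neg, map_pow,
        show -C ζ ^ 2 * -C ζ = (C ζ ^ 3 : MvPolynomial ℕ ℂ) by ring, hz3, one_pow, one_mul]
    simp only [map_mul, map_pow, map_neg, Nat.zero_add, mul_pow] at e5 ⊢
    linear_combination (pairProd ζ (m + 1) 1 * pairProd ζ m (m + 2) *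
      (∏ j ∈ Finset.Ico (m + 2) (2 * (m + 1)), X j) ^ ε * (C ζ ^ 2) ^ ε * X 0 ^ ε *
      ∏ j ∈ Finset.Ico (m + 2) (2 * (m + 1)), (C ζ * X 0 - X j)) * e5
  · refine (Polynomial.natDegree_C_mul_le _ _).trans ?_
    refine Polynomial.natDegree_mul_le.trans ?_
    have h1 : (Polynomial.X ^ ε : Polynomial (MvPolynomial ℕ ℂ)).natDegree ≤ ε :=
      Polynomial.natDegree_X_pow_le ε
    have h2 : (∏ j ∈ Finset.Ico (m + 2) (2 * (m + 1)),
      (Polynomial.C (C ζ * X j : MvPolynomial ℕ ℂ) - Polynomial.X)).natDegree ≤ m := by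
      refine (Polynomial.natDegree_prod_le _ _).trans ?_
      refine (Finset.sum_le_card_nsmul _ _ 1 fun j _ => ?_).trans
        (by rw [Nat.card_Ico]; simp; omega)
      refine (Polynomial.natDegree_sub_le _ _).trans (max_le ?_ Polynomial.natDegree_X_le)
      rw [Polynomial.natDegree_C]; omega
    omega
  · intro i _ hi
    have hB' : (sw i).toRingHom B = B := by
      change sw i B = B
      rw [hB, map_mul, sw_pairProd_left (by omega), map_pow, map_prod]
      congr 2
      exact Finset.prod_congr rfl fun j hj => hfix i (by omega) j hj
    rw [hP, Polynomial.map_mul, Polynomial.map_mul, Polynomial.map_C, hB', Polynomial.map_pow,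
      Polynomial.map_X, Polynomial.map_prod]
    congr 2
    refine Finset.prod_congr rfl fun j hj => ?_
    have := hfix i (by omega) j hj
    simp [this]

lemma Exch.rot_down {ζ : ℂ} (hζ : ζ ^ 2 + ζ + 1 = 0) {n : ℕ} (hn : 1 ≤ n) {ε : ℕ} (hε : ε ≤ 1)
    {Φ : List Bool → MvPolynomial ℕ ℂ} (h : Exch ζ 0 (2 * n) Φ) (c : ℂ)
    (hs : Φ (sorted n n) = C c * (baseComp ζ n * (∏ j ∈ Finset.Ico n (2 * n), X j) ^ ε))
    (l : List Bool) (hl : l.length + 1 = 2 * n) (hl' : l.count true = n) :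
    Φ (false :: l) = C (-ζ ^ 2 * (ζ ^ 2) ^ ε) * rename (rot (2 * n)) (Φ (l ++ [false])) := by
  obtain ⟨m, rfl⟩ : ∃ m, n = m + 1 := ⟨n - 1, by omega⟩
  have hc := count_add_count l
  refine Exch.ext (ζ := ζ) (c := 1) (L := 2 * (m + 1) - 1) (Φ := fun l => Φ (false :: l))
    (Φ' := fun l => C (-ζ ^ 2 * (ζ ^ 2) ^ ε) * rename (rot (2 * (m + 1))) (Φ (l ++ [false])))
    ?_ ?_ l (by omega) ?_
  · intro l₁ l₂ hL
    have := h (false :: l₁) l₂ (by simp; omega)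
    simp only [List.cons_append, List.length_cons] at this ⊢
    rw [this]
    congr 1; omega
  · intro l₁ l₂ hL
    have := h l₁ (l₂ ++ [false]) (by simp; omega)
    simp only [List.append_assoc, List.cons_append, Nat.zero_add] at this ⊢
    rw [this, heckeOp_C_mul, Nat.add_comm 1, heckeOp_rename_rot (by omega)]
  · rw [hl', show l.count false = m by omega]
    have e : sorted (m + 1) m ++ [false] = sorted (m + 1) (m + 1) := by
      have : List.replicate (m + 1) false = List.replicate m false ++ [false] :=
        List.replicate_succ'
      rw [sorted, sorted, List.append_assoc, this]
    have h1 := h.ins (m + 1) [] (List.replicate m false) (by simp; omega)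
    simp only [List.nil_append, List.length_nil, Nat.add_zero] at h1
    change Φ (false :: sorted (m + 1) m) = _
    rw [e, sorted, h1]
    change XXZ.ins ζ (m + 1) 0 (Φ (sorted (m + 1) (m + 1))) = _
    rw [hs, ins_C_mul, ins_base hζ (by omega) hε, map_mul (rename _) (C c), rename_C]
    ring

/-- The component of the spin word `l` of length `2 n`. -/
def comp (ζ : ℂ) (n : ℕ) (l : List Bool) : MvPolynomial ℕ ℂ := compOp ζ l 0 (baseComp ζ n)

lemma comp_exch (ζ : ℂ) (n L : ℕ) : Exch ζ 0 L (comp ζ n) :=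
    fun l₁ l₂ _ => compOp_exchange ζ l₁ l₂ 0 _

lemma comp_sorted (ζ : ℂ) (n : ℕ) : comp ζ n (sorted n n) = baseComp ζ n := compOp_sorted ζ n n 0 _

lemma comp_false_cons {ζ : ℂ} (hζ : ζ ^ 2 + ζ + 1 = 0) {n : ℕ} (hn : 1 ≤ n)
    (l : List Bool) (hl : l.length + 1 = 2 * n) (hl' : l.count true = n) :
    comp ζ n (false :: l) = C (-ζ ^ 2) * rename (rot (2 * n)) (comp ζ n (l ++ [false])) := by
  have := (comp_exch ζ n (2 * n)).rot_down hζ hn (ε := 0) (by omega) 1 (by simp [comp_sorted])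
    l hl hl'
  simpa using this

/-- Monomial in the variables sitting at down spins. -/
def downMon : List Bool → ℕ → MvPolynomial ℕ ℂ
  | [], _ => 1
  | x :: l, s => (if x then 1 else X s) * downMon l (s + 1)

lemma downMon_append (l₁ l₂ : List Bool) (s : ℕ) :
    downMon (l₁ ++ l₂) s = downMon l₁ s * downMon l₂ (s + l₁.length) := by
  induction l₁ generalizing s with
  | nil => simp [downMon]
  | cons x l ih =>
    simp only [List.cons_append, downMon, ih, List.length_cons]
    rw [show s + 1 + l.length = s + (l.length + 1) by omega]; ring

lemma downMon_ne_zero (l : List Bool) (s : ℕ) : downMon l s ≠ 0 := by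
  induction l generalizing s with
  | nil => simp [downMon]
  | cons x l ih => cases x <;> simp [downMon, ih]

lemma sw_downMon {l : List Bool} {s i : ℕ} (h : i + 1 < s ∨ s + l.length ≤ i) :
    sw i (downMon l s) = downMon l s := by
  induction l generalizing s with
  | nil => simp [downMon]
  | cons x l ih =>
    simp only [List.length_cons] at h
    rw [downMon, map_mul, ih (by omega)]
    cases x
    · simp [sw_X_of_ne (show s ≠ i by omega) (show s ≠ i + 1 by omega)]
    · simp

lemma rename_rot_downMon {l : List Bool} {s N : ℕ} (h : s + l.length < N) :
    rename (rot N) (downMon l s) = downMon l (s + 1) := by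
  induction l generalizing s with
  | nil => simp [downMon]
  | cons x l ih =>
    simp only [List.length_cons] at h
    rw [downMon, map_mul, ih (by omega), downMon]
    cases x
    · simp [rot_of_lt (show s + 1 < N by omega)]
    · simp

lemma downMon_replicate_true (n s : ℕ) : downMon (List.replicate n true) s = 1 := by
  induction n generalizing s with
  | zero => rfl
  | succ n ih => simp [List.replicate_succ, downMon, ih]

lemma downMon_replicate_false (n s : ℕ) :
    downMon (List.replicate n false) s = ∏ j ∈ Finset.Ico s (s + n), X j := by
  induction n generalizing s with
  | zero => simp [downMon]
  | succ n ih =>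
    rw [List.replicate_succ, downMon, ih, show s + 1 + n = s + (n + 1) by omega,
      Finset.prod_eq_prod_Ico_succ_bot (show s < s + (n + 1) by omega)]
    rfl

lemma comp_flip_exch {ζ : ℂ} (hζ : ζ ^ 2 + ζ + 1 = 0) (n L : ℕ) :
    Exch ζ 0 L (fun l => comp ζ n (l.map not) * downMon l 0) := by
  intro l₁ l₂ hL
  have h := comp_exch ζ n L (l₁.map not) (l₂.map not) (by simpa using hL)
  have hz3 : (C ζ : MvPolynomial ℕ ℂ) ^ 3 = 1 := by rw [← map_pow, cube_eq_one hζ, map_one]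
  simp only [List.length_map, Nat.zero_add] at h
  simp only [List.map_append, List.map_cons, Bool.not_true, Bool.not_false, h, downMon_append,
    downMon, Nat.zero_add, if_true, Bool.false_eq_true, if_false, one_mul]
  set k := l₁.length
  set u := comp ζ n (l₁.map not ++ true :: false :: l₂.map not)
  have hM : sw k (downMon l₁ 0 * downMon l₂ (k + 1 + 1)) =
      downMon l₁ 0 * downMon l₂ (k + 1 + 1) := by
    rw [map_mul, sw_downMon (Or.inr (by omega)), sw_downMon (Or.inl (by omega))]
  have hT : heckeOp ζ k (heckeOp ζ k u * X (k + 1)) = u * X k := by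
    apply heckeOp_unique
    refine mul_left_cancel₀ (X_sub_X_ne_zero (show k ≠ k + 1 by omega)) ?_
    rw [map_mul, sw_X_right]
    linear_combination -C ζ * (C ζ * X (k + 1) - X k) * X k * sw_heckeOp ζ k u
      + C ζ * (C ζ - 1) * X k * X (k + 1) * heckeOp_spec ζ k u
      - X k * u * (X k - X (k + 1)) ^ 2 * hz3
  have e : heckeOp ζ k u * (downMon l₁ 0 * (X (k + 1) * downMon l₂ (k + 1 + 1))) =
      (downMon l₁ 0 * downMon l₂ (k + 1 + 1)) * (heckeOp ζ k u * X (k + 1)) := by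
    ring
  rw [e, heckeOp_mul hM, hT]
  ring

lemma comp_rot_iterate {ζ : ℂ} (hζ : ζ ^ 2 + ζ + 1 = 0) {n : ℕ} (hn : 1 ≤ n) (m : ℕ) (hm : m ≤ n) :
    comp ζ n (List.replicate m false ++ (List.replicate n true ++ List.replicate (n - m) false)) =
      C (-ζ ^ 2) ^ m * rename ((rot (2 * n))^[m]) (baseComp ζ n) := by
  induction m with
  | zero => simpa [sorted] using comp_sorted ζ n
  | succ m ih =>
    have h := comp_false_cons hζ hn
      (List.replicate m false ++ (List.replicate n true ++ List.replicate (n - (m + 1)) false))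
      (by simp; omega) (by simp [List.count_replicate])
    rw [List.replicate_succ, List.cons_append, h]
    have e : (List.replicate m false ++ (List.replicate n true ++
        List.replicate (n - (m + 1)) false)) ++ [false] =
        List.replicate m false ++ (List.replicate n true ++ List.replicate (n - m) false) := by
      rw [show n - m = (n - (m + 1)) + 1 by omega, List.replicate_succ' (n := n - (m + 1))]
      simp
    rw [e, ih (by omega), map_mul, map_pow, rename_C, rename_rename, ← mul_assoc, ← pow_succ',
      Function.iterate_succ']

lemma rename_rot_iterate_base (ζ : ℂ) (n : ℕ) :
    rename ((rot (2 * n))^[n]) (baseComp ζ n) = baseComp ζ n := by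
  rw [baseComp, map_mul, rename_pairProd (s' := n), rename_pairProd (s' := 0), mul_comm]
  · intro j hj
    rw [rot_iterate (by omega), show n + j + n = 0 + j + 2 * n by omega, Nat.add_mod_right,
      Nat.mod_eq_of_lt (by omega)]
  · intro j hj
    rw [rot_iterate (by omega), Nat.mod_eq_of_lt (by omega)]
    omega

lemma comp_true_cons {ζ : ℂ} (hζ : ζ ^ 2 + ζ + 1 = 0) {n : ℕ} (hn : 1 ≤ n)
    (l : List Bool) (hl : l.length + 1 = 2 * n) (hl' : l.count false = n) :
    comp ζ n (true :: l) = C (-ζ) * rename (rot (2 * n)) (comp ζ n (l ++ [true])) := by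
  have hz3 := cube_eq_one hζ
  have hmap : (l.map not).map not = l := by
    rw [List.map_map, show not ∘ not = id from funext Bool.not_not, List.map_id]
  have hcount : (l.map not).count true = n := by
    rw [← hl', List.count, List.countP_map, List.count]
    congr 1
    ext x; cases x <;> rfl
  have h := (comp_flip_exch hζ n (2 * n)).rot_down hζ hn (ε := 1) le_rfl ((-ζ ^ 2) ^ n) ?_
    (l.map not) (by simpa using hl) hcount
  · simp only [List.map_cons, List.map_append, hmap, downMon, downMon_append, List.map_nil,
      Bool.not_false, map_mul, List.length_map] at h
    rw [rename_rot_downMon (by simp; omega), show 0 + l.length = 2 * n - 1 by omega] at h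
    simp only [Bool.false_eq_true, if_false, rename_X, rot_last (show 0 < 2 * n by omega), map_one,
      mul_one] at h
    have hne : (X 0 * downMon (l.map not) 1 : MvPolynomial ℕ ℂ) ≠ 0 :=
      mul_ne_zero (X_ne_zero 0) (downMon_ne_zero _ _)
    apply mul_right_cancel₀ hne
    have hz : (C ζ : MvPolynomial ℕ ℂ) ^ 3 = 1 := by rw [← map_pow, hz3, map_one]
    simp only [pow_one, map_neg, map_pow, Nat.zero_add] at h ⊢
    linear_combination h - C ζ * X 0 * downMon (l.map not) 1 *
      rename (rot (2 * n)) (comp ζ n (l ++ [true])) * hz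
  · have := comp_rot_iterate hζ hn n le_rfl
    rw [rename_rot_iterate_base] at this
    simp only [Nat.sub_self, List.replicate_zero, List.append_nil] at this
    simp only [sorted, List.map_append, List.map_replicate, Bool.not_true, Bool.not_false, this,
      downMon_append, downMon_replicate_true, downMon_replicate_false, one_mul,
          List.length_replicate,
      pow_one, map_pow, Nat.zero_add]
    rw [two_mul]
    ring

end XXZ

namespace XXZ
open MvPolynomial

lemma sw_pairProd_right {ζ : ℂ} {i s n : ℕ} (h : s + n ≤ i) :
    sw i (pairProd ζ n s) = pairProd ζ n s := by
  induction n generalizing s with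
  | zero => simp [pairProd]
  | succ n ih =>
    rw [pairProd, map_mul, ih (by omega), map_prod]
    congr 1
    refine Finset.prod_congr rfl fun j hj => ?_
    rw [Finset.mem_Ico] at hj
    simp only [map_sub, map_mul, sw_C]
    rw [sw_X_of_ne (by omega) (by omega), sw_X_of_ne (by omega) (by omega)]

lemma sw_pairProd_mid {ζ : ℂ} {i s n : ℕ} (h1 : s ≤ i) (h2 : i + 1 < s + n) :
    (C ζ * X (i + 1) - X i) * sw i (pairProd ζ n s) =
      (C ζ * X i - X (i + 1)) * pairProd ζ n s := by
  induction n generalizing s with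
  | zero => omega
  | succ n ih =>
    obtain rfl | h1 := h1.eq_or_lt
    · obtain ⟨m, rfl⟩ : ∃ m, n = m + 1 := ⟨n - 1, by omega⟩
      rw [pairProd, pairProd, Finset.prod_eq_prod_Ico_succ_bot (by omega),
        show s + 1 + (m + 1) = s + 1 + 1 + m by omega]
      simp only [map_mul, map_sub, map_prod, sw_C, sw_X_left, sw_X_right,
        sw_pairProd_left (show s + 2 ≤ s + 1 + 1 by omega)]
      have e : ∀ j ∈ Finset.Ico (s + 1 + 1) (s + 1 + 1 + m), sw s (X j) = X j := fun j hj => by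
        rw [Finset.mem_Ico] at hj
        exact sw_X_of_ne (by omega) (by omega)
      have p1 : ∏ j ∈ Finset.Ico (s + 1 + 1) (s + 1 + 1 + m),
          (C ζ * sw s (X j) - X (s + 1) : MvPolynomial ℕ ℂ) =
          ∏ j ∈ Finset.Ico (s + 1 + 1) (s + 1 + 1 + m), (C ζ * X j - X (s + 1)) :=
        Finset.prod_congr rfl fun j hj => by rw [e j hj]
      have p2 : ∏ j ∈ Finset.Ico (s + 1 + 1) (s + 1 + 1 + m),
          (C ζ * sw s (X j) - X s : MvPolynomial ℕ ℂ) =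
          ∏ j ∈ Finset.Ico (s + 1 + 1) (s + 1 + 1 + m), (C ζ * X j - X s) :=
        Finset.prod_congr rfl fun j hj => by rw [e j hj]
      rw [p1, p2]
      ring
    · rw [pairProd, map_mul, map_prod]
      have : ∏ j ∈ Finset.Ico (s + 1) (s + 1 + n), sw i (C ζ * X j - X s) =
          ∏ j ∈ Finset.Ico (s + 1) (s + 1 + n), (C ζ * X j - X s) := by
        rw [← prod_swap (i := i) (by omega) (by omega)
          (fun j => (C ζ * X j - X s : MvPolynomial ℕ ℂ))]
        refine Finset.prod_congr rfl fun j _ => ?_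
        rw [map_sub, map_mul, sw_C, sw_X, sw_X_of_ne (by omega) (by omega)]
      rw [this]
      linear_combination (∏ j ∈ Finset.Ico (s + 1) (s + 1 + n), (C ζ * X j - X s)) *
        ih (s := s + 1) h1 (by omega)

lemma heckeOp_eq_iff {ζ : ℂ} (i : ℕ) (f : MvPolynomial ℕ ℂ)
    (h : (C ζ * X (i + 1) - X i) * sw i f = (C ζ * X i - X (i + 1)) * f) :
    heckeOp ζ i f = C ζ * f := by
  apply heckeOp_unique
  linear_combination -C ζ * h

lemma aligned_base (ζ : ℂ) (n : ℕ) : Aligned ζ 0 n n (baseComp ζ n) := by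
  refine ⟨fun i _ h => heckeOp_eq_iff i _ ?_, fun i h1 h2 => heckeOp_eq_iff i _ ?_⟩
  · rw [baseComp, map_mul, sw_pairProd_left (s := n) (n := n) (show i + 2 ≤ n by omega)]
    linear_combination pairProd ζ n n * sw_pairProd_mid (ζ := ζ) (Nat.zero_le i) h
  · rw [baseComp, map_mul, sw_pairProd_right (s := 0) (n := n) (show 0 + n ≤ i by omega)]
    linear_combination pairProd ζ n 0 *
        sw_pairProd_mid (ζ := ζ) (n := n) (show n ≤ i by omega) (by omega)

lemma comp_exchange (ζ : ℂ) (n : ℕ) (l₁ l₂ : List Bool) :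
    comp ζ n (l₁ ++ false :: true :: l₂) =
      heckeOp ζ l₁.length (comp ζ n (l₁ ++ true :: false :: l₂)) := by
  simpa using comp_exch ζ n (l₁.length + l₂.length + 2) l₁ l₂ rfl

lemma C_cube {ζ : ℂ} (hζ : ζ ^ 2 + ζ + 1 = 0) : (C ζ : MvPolynomial ℕ ℂ) ^ 3 = 1 := by
  rw [← map_pow, cube_eq_one hζ, map_one]

lemma comp_swap_up_down {ζ : ℂ} (hζ : ζ ^ 2 + ζ + 1 = 0) (n : ℕ) (l₁ l₂ : List Bool) :
    (C ζ * X (l₁.length + 1) - X l₁.length) *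
        sw l₁.length (comp ζ n (l₁ ++ true :: false :: l₂)) =
      C ζ ^ 2 * (X l₁.length - X (l₁.length + 1)) * comp ζ n (l₁ ++ false :: true :: l₂) +
        (C ζ - 1) * X l₁.length * comp ζ n (l₁ ++ true :: false :: l₂) := by
  have h := heckeOp_spec ζ l₁.length (comp ζ n (l₁ ++ true :: false :: l₂))
  rw [← comp_exchange] at h
  linear_combination -C ζ ^ 2 * h - (((C ζ * X (l₁.length + 1) - X l₁.length) *
        sw l₁.length (comp ζ n (l₁ ++ true :: false :: l₂))) -
        (C ζ - 1) * X l₁.length * comp ζ n (l₁ ++ true :: false :: l₂)) * C_cube hζ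

lemma comp_swap_down_up {ζ : ℂ} (hζ : ζ ^ 2 + ζ + 1 = 0) (n : ℕ) (l₁ l₂ : List Bool) :
    (C ζ * X (l₁.length + 1) - X l₁.length) *
        sw l₁.length (comp ζ n (l₁ ++ false :: true :: l₂)) =
      C ζ ^ 2 * (X l₁.length - X (l₁.length + 1)) * comp ζ n (l₁ ++ true :: false :: l₂) +
        (C ζ - 1) * X (l₁.length + 1) * comp ζ n (l₁ ++ false :: true :: l₂) := by
  have h1 := comp_swap_up_down hζ n l₁ l₂
  have h := sw_heckeOp ζ l₁.length (comp ζ n (l₁ ++ true :: false :: l₂))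
  rw [← comp_exchange] at h
  refine mul_left_cancel₀ (X_sub_X_ne_zero (show l₁.length ≠ l₁.length + 1 by omega)) ?_
  linear_combination (C ζ * X (l₁.length + 1) - X l₁.length) * h
    + C ζ * (C ζ - 1) * X (l₁.length + 1) * h1 + (C ζ - 1) * X (l₁.length + 1) *
    (X l₁.length - X (l₁.length + 1)) * comp ζ n (l₁ ++ false :: true :: l₂) * C_cube hζ

lemma comp_swap_aligned {ζ : ℂ} (hζ : ζ ^ 2 + ζ + 1 = 0) (n : ℕ) (x : Bool) (l₁ l₂ : List Bool)
    (h1 : (l₁ ++ x :: x :: l₂).count true = n) (h2 : (l₁ ++ x :: x :: l₂).count false = n) :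
    (C ζ * X (l₁.length + 1) - X l₁.length) * sw l₁.length (comp ζ n (l₁ ++ x :: x :: l₂)) =
      (C ζ * X l₁.length - X (l₁.length + 1)) * comp ζ n (l₁ ++ x :: x :: l₂) := by
  have h := compOp_aligned ζ x l₁ l₂ 0 (baseComp ζ n) (by rw [h1, h2]; exact aligned_base ζ n)
  have h' := heckeOp_spec ζ l₁.length (comp ζ n (l₁ ++ x :: x :: l₂))
  rw [Nat.zero_add] at h
  change heckeOp ζ l₁.length (comp ζ n (l₁ ++ x :: x :: l₂)) =
      C ζ * comp ζ n (l₁ ++ x :: x :: l₂) at h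
  rw [h] at h'
  linear_combination -C ζ ^ 2 * h' - ((C ζ * X (l₁.length + 1) - X l₁.length) *
    sw l₁.length (comp ζ n (l₁ ++ x :: x :: l₂)) -
      (C ζ * X l₁.length - X (l₁.length + 1)) * comp ζ n (l₁ ++ x :: x :: l₂)) * C_cube hζ

/-- Phase picked up by a spin moving around the chain. -/
def kap (ζ : ℂ) (x : Bool) : ℂ := if x then -ζ else -ζ ^ 2

/-- Twisted rotation of functions of spin words. -/
def rho (ζ : ℂ) : Module.End ℂ (List Bool → ℂ) where
  toFun Φ l := match l with
    | [] => Φ []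
    | x :: l => kap ζ x * Φ (l ++ [x])
  map_add' Φ Ψ := by
    funext l
    cases l
    · rfl
    · exact mul_add _ _ _
  map_smul' c Φ := by
    funext l
    cases l
    · rfl
    · exact mul_left_comm _ _ _

@[simp] lemma rho_nil (ζ : ℂ) (Φ : List Bool → ℂ) : rho ζ Φ [] = Φ [] := rfl

@[simp] lemma rho_cons (ζ : ℂ) (Φ : List Bool → ℂ) (x : Bool) (l : List Bool) :
    rho ζ Φ (x :: l) = kap ζ x * Φ (l ++ [x]) := rfl

/-- Contraction of the first two sites. -/
def con (ζ : ℂ) : Module.End ℂ (List Bool → ℂ) where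
  toFun Φ l := Φ (false :: true :: l) - ζ * Φ (true :: false :: l)
  map_add' Φ Ψ := by
    funext l
    simp only [Pi.add_apply]
    ring
  map_smul' c Φ := by
    funext l
    simp only [Pi.smul_apply, smul_eq_mul, RingHom.id_apply]
    ring

lemma con_apply (ζ : ℂ) (Φ : List Bool → ℂ) (l : List Bool) :
    con ζ Φ l = Φ (false :: true :: l) - ζ * Φ (true :: false :: l) := rfl

/-- Amplitude of an arc on two given neighbouring spins. -/
def arc (ζ : ℂ) : Bool → Bool → ℂ
  | true, false => 1
  | false, true => -ζ ^ 2
  | _, _ => 0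

/-- Insertion of an arc in front of the first site. -/
def cup (ζ : ℂ) : Module.End ℂ (List Bool → ℂ) where
  toFun Φ l := match l with
    | x :: y :: l => arc ζ x y * Φ l
    | _ => 0
  map_add' Φ Ψ := by
    funext l
    rcases l with _ | ⟨x, _ | ⟨y, l⟩⟩
    · exact (add_zero _).symm
    · exact (add_zero _).symm
    · exact mul_add _ _ _
  map_smul' c Φ := by
    funext l
    rcases l with _ | ⟨x, _ | ⟨y, l⟩⟩
    · exact (mul_zero _).symm
    · exact (mul_zero _).symm
    · exact mul_left_comm _ _ _

@[simp] lemma cup_nil (ζ : ℂ) (Φ : List Bool → ℂ) : cup ζ Φ [] = 0 := rfl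

@[simp] lemma cup_singleton (ζ : ℂ) (Φ : List Bool → ℂ) (x : Bool) : cup ζ Φ [x] = 0 := rfl

@[simp] lemma cup_cons_cons (ζ : ℂ) (Φ : List Bool → ℂ) (x y : Bool) (l : List Bool) :
    cup ζ Φ (x :: y :: l) = arc ζ x y * Φ l := rfl

/-- Functions supported on words with `n` up and `n` down spins. -/
def Balanced (n : ℕ) (Φ : List Bool → ℂ) : Prop :=
  ∀ l : List Bool, ¬ (l.count true = n ∧ l.count false = n) → Φ l = 0

/-- The components at the homogeneous point. -/
def groundVec (ζ : ℂ) (n : ℕ) (l : List Bool) : ℂ :=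
  if l.count true = n ∧ l.count false = n then eval (fun _ => 1) (comp ζ n l) else 0

/-- Derivatives of the components at the homogeneous point. -/
def derivVec (ζ : ℂ) (n i : ℕ) (l : List Bool) : ℂ :=
  if l.count true = n ∧ l.count false = n then eval (fun _ => 1) (pderiv i (comp ζ n l)) else 0

lemma eval_one_rename (f : ℕ → ℕ) (p : MvPolynomial ℕ ℂ) :
    eval (fun _ => (1 : ℂ)) (rename f p) = eval (fun _ => 1) p := by
  rw [eval_rename]; rfl

lemma pderiv_sw (k : ℕ) (p : MvPolynomial ℕ ℂ) :
    pderiv k (sw k p) = sw k (pderiv (k + 1) p) := by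
  have := pderiv_rename (R := ℂ) (f := Equiv.swap k (k + 1)) (Equiv.injective _) (k + 1) p
  rw [Equiv.swap_apply_right] at this
  exact this

lemma comp_cons {ζ : ℂ} (hζ : ζ ^ 2 + ζ + 1 = 0) {n : ℕ} (hn : 1 ≤ n) (x : Bool) (l : List Bool)
    (h1 : (x :: l).count true = n) (h2 : (x :: l).count false = n) :
    comp ζ n (x :: l) = C (kap ζ x) * rename (rot (2 * n)) (comp ζ n (l ++ [x])) := by
  have hc := count_add_count l
  cases x
  · simp at h1 h2
    exact comp_false_cons hζ hn l (by omega) h1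
  · simp at h1 h2
    exact comp_true_cons hζ hn l (by omega) h2

lemma rho_groundVec {ζ : ℂ} (hζ : ζ ^ 2 + ζ + 1 = 0) {n : ℕ} (hn : 1 ≤ n) :
    rho ζ (groundVec ζ n) = groundVec ζ n := by
  funext l
  cases l with
  | nil => rfl
  | cons x l =>
    have e : ∀ b, (l ++ [x]).count b = (x :: l).count b := fun b => by
      simp [List.count_append, List.count_cons]
    simp only [rho_cons, groundVec, e]
    split_ifs with h
    · rw [comp_cons hζ hn x l h.1 h.2, map_mul, eval_C, eval_one_rename]
    · simp

lemma rho_derivVec {ζ : ℂ} (hζ : ζ ^ 2 + ζ + 1 = 0) {n : ℕ} (hn : 1 ≤ n) :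
    rho ζ (derivVec ζ n 0) = derivVec ζ n 1 := by
  funext l
  cases l with
  | nil =>
    have : ¬ (0 : ℕ) = n := by omega
    simp [derivVec, this]
  | cons x l =>
    have e : ∀ b, (l ++ [x]).count b = (x :: l).count b := fun b => by
      simp [List.count_append, List.count_cons]
    simp only [rho_cons, derivVec, e]
    split_ifs with h
    · have := pderiv_rename (R := ℂ) (rot_injective (2 * n)) 0 (comp ζ n (l ++ [x]))
      rw [rot_of_lt (by omega)] at this
      rw [comp_cons hζ hn x l h.1 h.2, pderiv_C_mul, this, map_mul, eval_C, eval_one_rename]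
    · simp

lemma cup_con_groundVec {ζ : ℂ} (hζ : ζ ^ 2 + ζ + 1 = 0) {n : ℕ} (hn : 1 ≤ n) (l : List Bool) :
    cup ζ (con ζ (groundVec ζ n)) l = groundVec ζ n l +
      ζ * (ζ - 1) * (derivVec ζ n 1 l - derivVec ζ n 0 l) := by
  have hz3 := cube_eq_one hζ
  have hC : ∀ (c : ℂ) (f : MvPolynomial ℕ ℂ), pderiv 0 (C c * f) = C c * pderiv 0 f := fun c f => by
    rw [pderiv_C_mul]
  have d1 : ∀ p : MvPolynomial ℕ ℂ, eval (fun _ => (1 : ℂ)) (pderiv 0 (sw 0 p)) =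
      eval (fun _ => 1) (pderiv 1 p) := fun p => by rw [pderiv_sw, sw, eval_one_rename]
  have d2 : ∀ p : MvPolynomial ℕ ℂ, eval (fun _ => (1 : ℂ)) (sw 0 p) = eval (fun _ => 1) p :=
    fun p => by rw [sw, eval_one_rename]
  rcases l with _ | ⟨x, _ | ⟨y, l⟩⟩
  · have : ¬ (0 : ℕ) = n := by omega
    simp [groundVec, derivVec, this]
  · have : ¬ ([x].count true = n ∧ [x].count false = n) := by
      cases x <;> simp <;> omega
    simp only [cup_singleton, groundVec, derivVec, if_neg this]; ring
  · have al : ∀ x, groundVec ζ n (x :: x :: l) +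
      ζ * (ζ - 1) * (derivVec ζ n 1 (x :: x :: l) - derivVec ζ n 0 (x :: x :: l)) = 0 := by
      intro x
      simp only [groundVec, derivVec]
      split_ifs with h
      · have := congrArg (fun p => eval (fun _ => (1 : ℂ)) (pderiv 0 p))
          (comp_swap_aligned hζ n x [] l h.1 h.2)
        simp only [List.nil_append, List.length_nil, Derivation.leibniz, map_sub, d1, d2,
          pderiv_X_self, smul_eq_mul, map_add, map_mul, eval_C, eval_X, pderiv_C, map_one,
          Nat.zero_add, pderiv_X_of_ne (show (1 : ℕ) ≠ 0 by omega), map_zero]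
          at this
        linear_combination ζ * this + (eval (fun _ => 1) (comp ζ n (x :: x :: l))) * hζ
      · ring
    have e1 : ∀ b, (false :: true :: l).count b = (true :: false :: l).count b := fun b => by
      simp [List.count_cons]; ring
    have ud : con ζ (groundVec ζ n) l = groundVec ζ n (true :: false :: l) +
      ζ * (ζ - 1) * (derivVec ζ n 1 (true :: false :: l) -
          derivVec ζ n 0 (true :: false :: l)) := by
      simp only [con_apply, groundVec, derivVec, e1]
      split_ifs with h
      · have := congrArg (fun p => eval (fun _ => (1 : ℂ)) (pderiv 0 p))
          (comp_swap_up_down hζ n [] l)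
        simp only [List.nil_append, List.length_nil, Derivation.leibniz, map_sub, d1, d2,
          pderiv_X_self, smul_eq_mul, map_add, map_mul, eval_C, eval_X, pderiv_C, map_one,
          Nat.zero_add, pderiv_X_of_ne (show (1 : ℕ) ≠ 0 by omega), map_zero,
          map_pow, Derivation.leibniz_pow] at this
        simp at this
        linear_combination (-ζ) * this - eval (fun _ => 1) (comp ζ n (true :: false :: l)) * hζ
          - eval (fun _ => 1) (comp ζ n (false :: true :: l)) * hz3
      · ring
    have du : -ζ ^ 2 * con ζ (groundVec ζ n) l = groundVec ζ n (false :: true :: l) +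
      ζ * (ζ - 1) * (derivVec ζ n 1 (false :: true :: l) -
          derivVec ζ n 0 (false :: true :: l)) := by
      simp only [con_apply, groundVec, derivVec, e1]
      split_ifs with h
      · have := congrArg (fun p => eval (fun _ => (1 : ℂ)) (pderiv 0 p))
          (comp_swap_down_up hζ n [] l)
        simp only [List.nil_append, List.length_nil, Derivation.leibniz, map_sub, d1, d2,
          pderiv_X_self, smul_eq_mul, map_add, map_mul, eval_C, eval_X, pderiv_C, map_one,
          Nat.zero_add, pderiv_X_of_ne (show (1 : ℕ) ≠ 0 by omega), map_zero,
          map_pow, Derivation.leibniz_pow] at this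
        simp at this
        linear_combination (-ζ) * this - eval (fun _ => 1) (comp ζ n (false :: true :: l)) * hζ
      · ring
    cases x <;> cases y
    · rw [al]; exact zero_mul _
    · rw [← du]; rfl
    · rw [← ud]; exact one_mul _
    · rw [al]; exact zero_mul _

end XXZ

namespace XXZ

/-- Phase of a word. -/
def kapProd (ζ : ℂ) (l : List Bool) : ℂ := (l.map (kap ζ)).prod

@[simp] lemma kapProd_nil (ζ : ℂ) : kapProd ζ [] = 1 := rfl

@[simp] lemma kapProd_cons (ζ : ℂ) (x : Bool) (l : List Bool) :
    kapProd ζ (x :: l) = kap ζ x * kapProd ζ l := by simp [kapProd]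

@[simp] lemma kapProd_append (ζ : ℂ) (l l' : List Bool) :
    kapProd ζ (l ++ l') = kapProd ζ l * kapProd ζ l' := by simp [kapProd]

lemma rho_pow_append (ζ : ℂ) (Φ : List Bool → ℂ) (a r : List Bool) :
    (rho ζ ^ a.length) Φ (a ++ r) = kapProd ζ a * Φ (r ++ a) := by
  induction a generalizing r with
  | nil => simp
  | cons x a ih =>
    rw [List.length_cons, pow_succ', Module.End.mul_apply, List.cons_append, rho_cons,
      List.append_assoc, ih, kapProd_cons]
    simp [mul_assoc]

lemma kapProd_balanced {ζ : ℂ} (hζ : ζ ^ 2 + ζ + 1 = 0) {n : ℕ} {l : List Bool}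
    (h1 : l.count true = n) (h2 : l.count false = n) : kapProd ζ l = 1 := by
  have : ∀ l : List Bool, kapProd ζ l = (-ζ) ^ l.count true * (-ζ ^ 2) ^ l.count false := by
    intro l
    induction l with
    | nil => simp
    | cons x l ih => cases x <;> simp [ih, kap] <;> ring
  rw [this, h1, h2, ← mul_pow]
  have : -ζ * -ζ ^ 2 = 1 := by linear_combination cube_eq_one hζ
  rw [this, one_pow]

lemma Balanced.ext {n : ℕ} {Φ Ψ : List Bool → ℂ} (h : Balanced n Φ) (h' : Balanced n Ψ)
    (H : ∀ l, l.count true = n → l.count false = n → Φ l = Ψ l) : Φ = Ψ := by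
  funext l
  by_cases hl : l.count true = n ∧ l.count false = n
  · exact H l hl.1 hl.2
  · rw [h l hl, h' l hl]

lemma Balanced.rho {ζ : ℂ} {n : ℕ} {Φ : List Bool → ℂ} (h : Balanced n Φ) :
    Balanced n (rho ζ Φ) := by
  intro l hl
  cases l with
  | nil => exact h _ hl
  | cons x l =>
    rw [rho_cons, h _ (by simpa [List.count_cons] using hl), mul_zero]

lemma Balanced.rho_pow {ζ : ℂ} {n : ℕ} {Φ : List Bool → ℂ} (h : Balanced n Φ) (s : ℕ) :
    Balanced n ((XXZ.rho ζ ^ s) Φ) := by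
  induction s with
  | zero => simpa
  | succ s ih => rw [pow_succ', Module.End.mul_apply]; exact ih.rho

lemma Balanced.con {ζ : ℂ} {n : ℕ} {Φ : List Bool → ℂ} (h : Balanced n Φ) :
    Balanced (n - 1) (con ζ Φ) := by
  intro l hl
  rw [con_apply, h, h, mul_zero, sub_zero] <;> simp <;> omega

lemma Balanced.con_zero {ζ : ℂ} {Φ : List Bool → ℂ} (h : Balanced 0 Φ) : XXZ.con ζ Φ = 0 := by
  funext l
  rw [con_apply, h, h, mul_zero, sub_zero] <;> simp

lemma Balanced.cup {ζ : ℂ} {n : ℕ} {Φ : List Bool → ℂ} (h : Balanced n Φ) :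
    Balanced (n + 1) (cup ζ Φ) := by
  intro l hl
  rcases l with _ | ⟨x, _ | ⟨y, l⟩⟩
  · simp
  · simp
  · rw [cup_cons_cons]
    cases x <;> cases y
    · exact zero_mul _
    · rw [h l (by simpa using hl), mul_zero]
    · rw [h l (by simpa using hl), mul_zero]
    · exact zero_mul _

lemma Balanced.add {n : ℕ} {Φ Ψ : List Bool → ℂ} (h : Balanced n Φ) (h' : Balanced n Ψ) :
    Balanced n (Φ + Ψ) := fun l hl => by rw [Pi.add_apply, h l hl, h' l hl, add_zero]

lemma Balanced.smul {n : ℕ} {Φ : List Bool → ℂ} (h : Balanced n Φ) (c : ℂ) :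
    Balanced n (c • Φ) := fun l hl => by rw [Pi.smul_apply, h l hl, smul_zero]

lemma Balanced.rho_period {ζ : ℂ} (hζ : ζ ^ 2 + ζ + 1 = 0) {n : ℕ} {Φ : List Bool → ℂ}
    (h : Balanced n Φ) : (XXZ.rho ζ ^ (2 * n)) Φ = Φ := by
  refine (h.rho_pow _).ext h fun l h1 h2 => ?_
  have := rho_pow_append ζ Φ l []
  rw [← count_add_count, h1, h2, ← two_mul, List.append_nil, kapProd_balanced hζ h1 h2] at this
  simpa using this

lemma Balanced.rho_mod {ζ : ℂ} (hζ : ζ ^ 2 + ζ + 1 = 0) {n : ℕ} {Φ : List Bool → ℂ}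
    (h : Balanced n Φ) (t : ℕ) : (XXZ.rho ζ ^ (t % (2 * n))) Φ = (XXZ.rho ζ ^ t) Φ := by
  have : ∀ q, (XXZ.rho ζ ^ (2 * n * q)) Φ = Φ := by
    intro q
    induction q with
    | zero => simp
    | succ q ih => rw [mul_add, pow_add, mul_one, Module.End.mul_apply, h.rho_period hζ, ih]
  conv_rhs => rw [← Nat.mod_add_div t (2 * n), pow_add, Module.End.mul_apply, this]

lemma con_cup {ζ : ℂ} (hζ : ζ ^ 2 + ζ + 1 = 0) (Φ : List Bool → ℂ) : con ζ (cup ζ Φ) = Φ := by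
  funext l
  simp only [con_apply, cup_cons_cons, arc]
  linear_combination -Φ l * hζ

lemma con_rho_cup {ζ : ℂ} (hζ : ζ ^ 2 + ζ + 1 = 0) (Φ : List Bool → ℂ) :
    con ζ (rho ζ (cup ζ Φ)) = rho ζ Φ := by
  have h3 := cube_eq_one hζ
  funext l
  rcases l with _ | ⟨x, l⟩
  · simp [con_apply, arc, kap]
    linear_combination (-Φ []) * hζ - Φ [] * ζ * h3
  · cases x
    · simp [con_apply, arc, kap]
    · simp [con_apply, arc, kap, -mul_eq_mul_left_iff, -mul_eq_mul_right_iff]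
      linear_combination ζ * Φ (l ++ [true]) * h3

lemma con_rho_pow_cup_mid {ζ : ℂ} (hζ : ζ ^ 2 + ζ + 1 = 0) {q t : ℕ} (h1 : 2 ≤ t)
    (h2 : t ≤ 2 * q) {X : List Bool → ℂ} (hX : Balanced q X) :
    con ζ ((rho ζ ^ t) (cup ζ X)) =
      (rho ζ ^ (t - 2)) (cup ζ ((rho ζ ^ (2 * q - t)) (con ζ ((rho ζ ^ t) X)))) := by
  obtain ⟨q, rfl⟩ : ∃ p, q = p + 1 := ⟨q - 1, by omega⟩
  have hb := (hX.cup (ζ := ζ)).rho_pow (ζ := ζ) t |>.con (ζ := ζ)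
  refine hb.ext (((hX.rho_pow (ζ := ζ) t).con (ζ := ζ)).rho_pow (ζ := ζ) _ |>.cup (ζ := ζ)
    |>.rho_pow (ζ := ζ) _) fun l c1 c2 => ?_
  have hl := count_add_count l
  simp only [Nat.add_sub_cancel] at c1 c2
  obtain ⟨a, r, rfl, ha⟩ : ∃ a r, l = a ++ r ∧ a.length = t - 2 :=
    ⟨l.take (t - 2), l.drop (t - 2), by simp, by simp; omega⟩
  have hr : r.length = 2 * q + 4 - t := by simp at hl c1 c2; omega
  rcases r with _ | ⟨z, _ | ⟨w, r⟩⟩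
  · simp at hr; omega
  · simp at hr; omega
  have hr' : r.length = 2 * (q + 1) - t := by simp at hr; omega
  have e1 : ∀ x y, (rho ζ ^ t) (cup ζ X) (x :: y :: (a ++ z :: w :: r)) =
      kapProd ζ (x :: y :: a) * (arc ζ z w * X (r ++ x :: y :: a)) := by
    intro x y
    have := rho_pow_append ζ (cup ζ X) (x :: y :: a) (z :: w :: r)
    rw [show (x :: y :: a).length = t by simp; omega] at this
    simpa using this
  have e2 : ∀ x y, (rho ζ ^ t) X (x :: y :: (a ++ r)) =
      kapProd ζ (x :: y :: a) * X (r ++ x :: y :: a) := by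
    intro x y
    have := rho_pow_append ζ X (x :: y :: a) r
    rw [show (x :: y :: a).length = t by simp; omega] at this
    simpa using this
  rw [con_apply, e1, e1, ← ha, rho_pow_append, List.cons_append, List.cons_append, cup_cons_cons,
    ← hr', rho_pow_append, con_apply, e2, e2]
  by_cases hc : (a ++ r).count true = q ∧ (a ++ r).count false = q
  · have := kapProd_balanced hζ hc.1 hc.2
    rw [kapProd_append] at this
    simp only [kapProd_cons]
    linear_combination (-(kapProd ζ a * arc ζ z w * kap ζ false * kap ζ true *
      (X (r ++ false :: true :: a) - ζ * X (r ++ true :: false :: a)))) * this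
  · rw [hX, hX]
    · ring
    · simp at hc ⊢; omega
    · simp at hc ⊢; omega

lemma con_rho_pow_cup_last {ζ : ℂ} (hζ : ζ ^ 2 + ζ + 1 = 0) {q : ℕ}
    {X : List Bool → ℂ} (hX : Balanced (q + 1) X) :
    con ζ ((rho ζ ^ (2 * q + 3)) (cup ζ X)) = (rho ζ ^ (2 * q + 1)) X := by
  have hb := (hX.cup (ζ := ζ)).rho_pow (ζ := ζ) (2 * q + 3) |>.con (ζ := ζ)
  refine hb.ext (hX.rho_pow (ζ := ζ) _) fun l c1 c2 => ?_
  have hl := count_add_count l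
  simp only [Nat.add_sub_cancel] at c1 c2
  obtain ⟨a, r, rfl, ha⟩ : ∃ a r, l = a ++ r ∧ a.length = 2 * q + 1 :=
    ⟨l.take (2 * q + 1), l.drop (2 * q + 1), by simp, by simp; omega⟩
  have hr : r.length = 1 := by simp at hl c1 c2; omega
  obtain ⟨z, rfl⟩ := List.length_eq_one_iff.1 hr
  have e1 : ∀ x y, (rho ζ ^ (2 * q + 3)) (cup ζ X) (x :: y :: (a ++ [z])) =
      kapProd ζ (x :: y :: a) * (arc ζ z x * X (y :: a)) := by
    intro x y
    have := rho_pow_append ζ (cup ζ X) (x :: y :: a) [z]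
    rw [show (x :: y :: a).length = 2 * q + 3 by simp; omega] at this
    simpa using this
  rw [con_apply, e1, e1, ← ha, rho_pow_append]
  have h3 := cube_eq_one hζ
  cases z
  · simp [arc, kap, -mul_eq_mul_left_iff, -mul_eq_mul_right_iff]
    linear_combination kapProd ζ a * X (false :: a) * (ζ ^ 3 + 1) * h3
  · simp [arc, kap, -mul_eq_mul_left_iff, -mul_eq_mul_right_iff]
    linear_combination kapProd ζ a * X (true :: a) * h3

lemma con_rho_pow_cup {ζ : ℂ} (hζ : ζ ^ 2 + ζ + 1 = 0) (q t : ℕ) :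
    (∃ u, ∀ X, Balanced q X → con ζ ((rho ζ ^ t) (cup ζ X)) = (rho ζ ^ u) X) ∨
    ∃ u v w, ∀ X, Balanced q X → con ζ ((rho ζ ^ t) (cup ζ X)) =
      (rho ζ ^ u) (cup ζ ((rho ζ ^ v) (con ζ ((rho ζ ^ w) X)))) := by
  set t' := t % (2 * (q + 1)) with ht'
  have hlt : t' < 2 * (q + 1) := Nat.mod_lt _ (by omega)
  have red : ∀ X, Balanced q X → (rho ζ ^ t) (cup ζ X) = (rho ζ ^ t') (cup ζ X) :=
    fun X hX => (hX.cup.rho_mod hζ t).symm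
  rcases Nat.lt_or_ge t' 2 with h | h
  · left
    refine ⟨t', fun X hX => ?_⟩
    rw [red X hX]
    interval_cases t'
    · simp [con_cup hζ]
    · simp [con_rho_cup hζ]
  · rcases Nat.lt_or_ge (2 * q) t' with h' | h'
    · left
      obtain ⟨p, rfl⟩ : ∃ p, q = p + 1 := ⟨q - 1, by omega⟩
      refine ⟨2 * p + 1, fun X hX => ?_⟩
      rw [red X hX, show t' = 2 * p + 3 by omega, con_rho_pow_cup_last hζ hX]
    · right
      exact ⟨t' - 2, 2 * q - t', t', fun X hX => by
        rw [red X hX, con_rho_pow_cup_mid hζ h h' hX]⟩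

end XXZ

namespace XXZ

/-- Compositions of rotations and exactly `m` contractions. -/
inductive Lev (ζ : ℂ) : ℕ → Module.End ℂ (List Bool → ℂ) → Prop
  | base (s : ℕ) : Lev ζ 0 (rho ζ ^ s)
  | step (s : ℕ) {m : ℕ} {g : Module.End ℂ (List Bool → ℂ)} (h : Lev ζ m g) :
      Lev ζ (m + 1) (rho ζ ^ s * con ζ * g)

lemma Lev.rho_mul {ζ : ℂ} {m : ℕ} {g : Module.End ℂ (List Bool → ℂ)} (h : Lev ζ m g) (s : ℕ) :
    Lev ζ m (rho ζ ^ s * g) := by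
  cases h with
  | base t => rw [← pow_add]; exact .base _
  | step t h => rw [← mul_assoc, ← mul_assoc, ← pow_add]; exact .step _ h

lemma Lev.mul_con {ζ : ℂ} {m : ℕ} {g : Module.End ℂ (List Bool → ℂ)} (h : Lev ζ m g) (s : ℕ) :
    Lev ζ (m + 1) (g * con ζ * rho ζ ^ s) := by
  induction h with
  | base t => exact .step t (.base s)
  | step t h ih =>
    rw [show ∀ a b c d e : Module.End ℂ (List Bool → ℂ), a * b * c * d * e = a * b * (c * d * e)
      from fun a b c d e => by simp only [mul_assoc]]
    exact .step t ih

lemma Lev.balanced {ζ : ℂ} {m n : ℕ} {g : Module.End ℂ (List Bool → ℂ)} (h : Lev ζ m g)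
    {Φ : List Bool → ℂ} (hΦ : Balanced n Φ) : Balanced (n - m) (g Φ) := by
  induction h with
  | base s => exact hΦ.rho_pow s
  | step s h ih => exact ih.con.rho_pow s

lemma Lev.eq_zero {ζ : ℂ} {m n : ℕ} {g : Module.End ℂ (List Bool → ℂ)} (h : Lev ζ m g)
    {Φ : List Bool → ℂ} (hΦ : Balanced n Φ) (hm : n < m) : g Φ = 0 := by
  cases h with
  | base s => omega
  | @step s m g h =>
    have := h.balanced hΦ
    rw [show n - m = 0 by omega] at this
    rw [Module.End.mul_apply, Module.End.mul_apply, this.con_zero, map_zero]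

lemma Lev.cup_dichotomy {ζ : ℂ} (hζ : ζ ^ 2 + ζ + 1 = 0) {m : ℕ}
    {g : Module.End ℂ (List Bool → ℂ)} (h : Lev ζ m g) (n b : ℕ) :
    (∃ m' g', m = m' + 1 ∧ Lev ζ m' g' ∧ ∀ Y, Balanced n Y →
      g ((rho ζ ^ b) (cup ζ Y)) = g' Y) ∨
    ∃ s g', Lev ζ m g' ∧ ∀ Y, Balanced n Y → g ((rho ζ ^ b) (cup ζ Y)) =
      (rho ζ ^ s) (cup ζ (g' Y)) := by
  induction h with
  | base s =>
    right
    refine ⟨s + b, 1, by simpa using Lev.base (ζ := ζ) 0, fun Y _ => ?_⟩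
    rw [pow_add]; rfl
  | @step s m g h ih =>
    rcases ih with ⟨m', g', rfl, hg', e⟩ | ⟨t, g', hg', e⟩
    · left
      refine ⟨_, _, rfl, hg'.step s, fun Y hY => ?_⟩
      simp only [Module.End.mul_apply, e Y hY]
    · rcases con_rho_pow_cup hζ (n - m) t with ⟨u, hu⟩ | ⟨u, v, w, hu⟩
      · left
        refine ⟨m, _, rfl, hg'.rho_mul (s + u), fun Y hY => ?_⟩
        simp only [Module.End.mul_apply, e Y hY, hu _ (hg'.balanced hY), pow_add]
      · right
        refine ⟨s + u, _, (hg'.rho_mul w).step v, fun Y hY => ?_⟩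
        simp only [Module.End.mul_apply, e Y hY, hu _ (hg'.balanced hY), pow_add]

lemma Balanced.finite_range {n : ℕ} {Φ : List Bool → ℂ} (h : Balanced n Φ) :
    (Set.range Φ).Finite := by
  refine (((List.finite_length_eq Bool (2 * n)).image Φ).union (Set.finite_singleton 0)).subset ?_
  rintro _ ⟨l, rfl⟩
  by_cases hl : l.count true = n ∧ l.count false = n
  · left
    refine ⟨l, ?_, rfl⟩
    have := count_add_count l
    simp only [Set.mem_ofPred_eq]; omega
  · right
    exact h l hl

lemma finite_rho_orbits {ζ : ℂ} (hζ : ζ ^ 2 + ζ + 1 = 0) {k : ℕ} {S : Set (List Bool → ℂ)}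
    (hS : S.Finite) (hb : ∀ X ∈ S, Balanced k X) :
    {X | ∃ s, ∃ Y ∈ S, (rho ζ ^ s) Y = X}.Finite := by
  rcases Nat.eq_zero_or_pos k with rfl | hk
  · refine hS.subset ?_
    rintro _ ⟨s, Y, hY, rfl⟩
    have : (rho ζ ^ s) Y = Y := ((hb Y hY).rho_pow s).ext (hb Y hY) fun l h1 h2 => by
      have h := count_add_count l
      obtain rfl : l = [] := List.length_eq_zero_iff.1 (by omega)
      induction s with
      | zero => simp
      | succ s ih => rw [pow_succ', Module.End.mul_apply, rho_nil, ih]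
    rwa [this]
  · refine ((Set.finite_Iic (2 * k)).image2 (fun s Y => (rho ζ ^ s) Y) hS).subset ?_
    rintro _ ⟨s, Y, hY, rfl⟩
    exact ⟨s % (2 * k), (Nat.mod_lt _ (by omega)).le, Y, hY, (hb Y hY).rho_mod hζ s⟩

lemma finite_lev {ζ : ℂ} (hζ : ζ ^ 2 + ζ + 1 = 0) {n : ℕ} {Φ : List Bool → ℂ}
    (hΦ : Balanced n Φ) (m : ℕ) : {X | ∃ g, Lev ζ m g ∧ g Φ = X}.Finite := by
  induction m with
  | zero =>
    refine (finite_rho_orbits hζ (Set.finite_singleton Φ) (by simpa using hΦ)).subset ?_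
    rintro _ ⟨g, ⟨s⟩, rfl⟩
    exact ⟨s, Φ, rfl, rfl⟩
  | succ m ih =>
    refine (finite_rho_orbits hζ (ih.image (con ζ)) (k := n - m - 1) ?_).subset ?_
    · rintro _ ⟨_, ⟨g, hg, rfl⟩, rfl⟩
      exact (hg.balanced hΦ).con
    · rintro _ ⟨g, h, rfl⟩
      cases h with
      | @step s m g h => exact ⟨s, con ζ (g Φ), ⟨_, ⟨g, h, rfl⟩, rfl⟩, rfl⟩

/-- The Temperley-Lieb generator at site `j` of a chain of length `N`. -/
def gen (ζ : ℂ) (N j : ℕ) : Module.End ℂ (List Bool → ℂ) :=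
  rho ζ ^ j * cup ζ * con ζ * rho ζ ^ (N - j)

lemma gen_apply (ζ : ℂ) (N j : ℕ) (Φ : List Bool → ℂ) :
    gen ζ N j Φ = (rho ζ ^ j) (cup ζ (con ζ ((rho ζ ^ (N - j)) Φ))) := rfl

lemma Balanced.gen {ζ : ℂ} {n : ℕ} (hn : 1 ≤ n) {Φ : List Bool → ℂ} (h : Balanced n Φ)
    (N j : ℕ) : Balanced n (gen ζ N j Φ) := by
  have := ((h.rho_pow (ζ := ζ) (N - j)).con (ζ := ζ)).cup (ζ := ζ) |>.rho_pow (ζ := ζ) j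
  rwa [Nat.sub_add_cancel hn] at this

lemma norm_kap {ζ : ℂ} (hζ : ζ ^ 2 + ζ + 1 = 0) (x : Bool) : ‖kap ζ x‖ = 1 := by
  have := norm_eq_one_of_cube hζ
  cases x <;> simp [kap, this]

lemma gen_append {ζ : ℂ} (hζ : ζ ^ 2 + ζ + 1 = 0) {n : ℕ} {Φ : List Bool → ℂ}
    (hΦ : Balanced n Φ) (a r : List Bool) (x y : Bool) (hl : a.length + 2 + r.length = 2 * n) :
    gen ζ (2 * n) a.length Φ (a ++ x :: y :: r) =
      arc ζ x y * (Φ (a ++ false :: true :: r) - ζ * Φ (a ++ true :: false :: r)) := by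
  have e : ∀ z w, kapProd ζ a * (rho ζ ^ (2 * n - a.length)) Φ (z :: w :: (r ++ a)) =
      Φ (a ++ z :: w :: r) := by
    intro z w
    have h := rho_pow_append ζ Φ (z :: w :: r) a
    rw [show (z :: w :: r).length = 2 * n - a.length by simp; omega] at h
    rw [← List.cons_append, ← List.cons_append, h]
    by_cases hc : (a ++ z :: w :: r).count true = n ∧ (a ++ z :: w :: r).count false = n
    · have := kapProd_balanced hζ hc.1 hc.2
      rw [kapProd_append] at this
      linear_combination Φ (a ++ z :: w :: r) * this
    · rw [hΦ _ hc, mul_zero, mul_zero]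
  rw [gen_apply, rho_pow_append, List.cons_append, List.cons_append, cup_cons_cons, con_apply,
    ← e false true, ← e true false]
  ring

lemma con_pow_congr {ζ : ℂ} (i : ℕ) {Φ Ψ : List Bool → ℂ} {c d : ℂ} {s s₁ s₂ : List Bool}
    (h : ∀ a : List Bool, a.length = 2 * i → Φ (a ++ s) = c * (Ψ (a ++ s₁) + d * Ψ (a ++ s₂))) :
    (con ζ ^ i) Φ s = c * ((con ζ ^ i) Ψ s₁ + d * (con ζ ^ i) Ψ s₂) := by
  induction i generalizing Φ Ψ with
  | zero => simpa using h [] rfl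
  | succ i ih =>
    simp only [pow_succ, Module.End.mul_apply]
    apply ih
    intro a ha
    have h1 := h (false :: true :: a) (by simp; omega)
    have h2 := h (true :: false :: a) (by simp; omega)
    simp only [List.cons_append] at h1 h2
    rw [con_apply, con_apply, con_apply, h1, h2]
    ring

/-- Product of the generators at sites `0, 2, …, 2 i - 2`. -/
def evenGen (ζ : ℂ) (N : ℕ) : ℕ → Module.End ℂ (List Bool → ℂ)
  | 0 => 1
  | i + 1 => evenGen ζ N i * gen ζ N (2 * i)

lemma evenGen_append {ζ : ℂ} (hζ : ζ ^ 2 + ζ + 1 = 0) {n : ℕ} (i : ℕ) (hi : i ≤ n)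
    (a : List Bool) (ha : a.length = 2 * i) : ∃ c : ℂ, ∀ (r : List Bool) (Φ : List Bool → ℂ),
      Balanced n Φ → r.length + 2 * i = 2 * n →
        evenGen ζ (2 * n) i Φ (a ++ r) = c * (con ζ ^ i) Φ r := by
  induction i generalizing a with
  | zero =>
    obtain rfl := List.length_eq_zero_iff.1 ha
    exact ⟨1, fun r Φ _ _ => by simp [evenGen]⟩
  | succ i ih =>
    obtain ⟨b, x, y, rfl, hb⟩ : ∃ b x y, a = b ++ [x, y] ∧ b.length = 2 * i := by
      have h := List.take_append_drop (2 * i) a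
      obtain ⟨x, y, h'⟩ := List.length_eq_two.1 (show (a.drop (2 * i)).length = 2 by simp; omega)
      exact ⟨a.take (2 * i), x, y, by rw [← h', h], by simp; omega⟩
    obtain ⟨c, hc⟩ := ih (by omega) b hb
    refine ⟨c * arc ζ x y, fun r Φ hΦ hr => ?_⟩
    rw [evenGen, Module.End.mul_apply, List.append_assoc, List.cons_append, List.cons_append,
      List.nil_append, hc _ _ (hΦ.gen (by omega) _ _) (by simp; omega),
      con_pow_congr (c := arc ζ x y) (d := -ζ) (Ψ := Φ) (s₁ := false :: true :: r)
        (s₂ := true :: false :: r), pow_succ', Module.End.mul_apply, con_apply]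
    · ring
    · intro a' ha'
      rw [← ha', gen_append hζ hΦ _ _ _ _ (by omega)]
      ring

/-- An eigenvector with eigenvalue at least the length of the chain is detected by one full
contraction. -/
theorem eq_zero_of_eigen {ζ : ℂ} (hζ : ζ ^ 2 + ζ + 1 = 0) {n : ℕ} (hn : 1 ≤ n)
    {Φ : List Bool → ℂ} (hΦ : Balanced n Φ) {lam : ℝ} (hlam : 2 * n ≤ lam)
    (heig : ∑ j ∈ Finset.range (2 * n), gen ζ (2 * n) j Φ = (lam : ℂ) • Φ)
    (h0 : lam = 2 * n → (con ζ ^ n) Φ [] = 0) : Φ = 0 := by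
  have hA : lam = 2 * n → evenGen ζ (2 * n) n Φ = 0 := by
    intro hl
    have hbal : ∀ i, ∀ Ψ, Balanced n Ψ → Balanced n (evenGen ζ (2 * n) i Ψ) := by
      intro i
      induction i with
      | zero => exact fun Ψ h => h
      | succ i ih => exact fun Ψ h => ih _ (h.gen hn _ _)
    refine (hbal n Φ hΦ).ext (fun l _ => rfl) fun l h1 h2 => ?_
    have hl' := count_add_count l
    obtain ⟨c, hc⟩ := evenGen_append hζ n le_rfl l (by omega)
    have := hc [] Φ hΦ (by simp)
    rw [h0 hl, mul_zero, List.append_nil] at this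
    exact this
  have main : ∀ d m, n + 1 ≤ m + d → ∀ g, Lev ζ m g → g Φ = 0 := by
    intro d
    induction d with
    | zero => exact fun m hm g hg => hg.eq_zero hΦ (by omega)
    | succ d ih =>
      intro m hm
      have ih' := ih (m + 1) (by omega)
      set T : Set ℝ := {t | ∃ g l, Lev ζ m g ∧ ‖g Φ l‖ = t} with hT
      have hfin : T.Finite := by
        refine (((finite_lev hζ hΦ m).biUnion (t := fun X => Set.range X) fun X hX => ?_).image
          norm).subset ?_
        · obtain ⟨g, hg, rfl⟩ := hX
          exact (hg.balanced hΦ).finite_range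
        · rintro _ ⟨g, l, hg, rfl⟩
          exact ⟨g Φ l, Set.mem_biUnion (x := g Φ) ⟨g, hg, rfl⟩ ⟨l, rfl⟩, rfl⟩
      intro g₁ hg₁
      have hne : T.Nonempty := ⟨_, g₁, [], hg₁, rfl⟩
      obtain ⟨M, ⟨g₀, l₀, hg₀, hM⟩, hmax⟩ := Set.exists_max_image T id hfin hne
      have hmax' : ∀ g l, Lev ζ m g → ‖g Φ l‖ ≤ M := fun g l hg => hmax _ ⟨g, l, hg, rfl⟩
      rcases (hM ▸ norm_nonneg _ : 0 ≤ M).eq_or_lt with hM0 | hM0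
      · funext l
        have := hmax' g₁ l hg₁
        rw [← hM0] at this
        exact norm_le_zero_iff.1 this
      exfalso
      have step : ∀ g, Lev ζ m g → ‖g Φ l₀‖ = M → lam = 2 * n ∧ ∀ j < 2 * n, ∃ g', Lev ζ m g' ∧
          ‖g' Φ l₀‖ = M ∧ ∀ Y, Balanced n Y → g' Y = g (gen ζ (2 * n) j Y) := by
        intro g hg hgM
        have dich : ∀ j, (∃ g', Lev ζ m g' ∧ ∀ Y, Balanced n Y → g' Y = g (gen ζ (2 * n) j Y)) ∨
            g (gen ζ (2 * n) j Φ) = 0 := by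
          intro j
          have hb : ∀ Y, Balanced n Y → Balanced (n - 1) (con ζ ((rho ζ ^ (2 * n - j)) Y)) :=
            fun Y hY => (hY.rho_pow _).con
          rcases hg.cup_dichotomy hζ (n - 1) j with ⟨m', g', rfl, hg', e⟩ | ⟨s, g', hg', e⟩
          · left
            refine ⟨_, hg'.mul_con (2 * n - j), fun Y hY => ?_⟩
            rw [gen_apply, e _ (hb Y hY)]
            rfl
          · right
            rw [gen_apply, e _ (hb Φ hΦ)]
            have := ih' _ (hg'.mul_con (2 * n - j))
            simp only [Module.End.mul_apply] at this
            rw [this, map_zero, map_zero]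
        have hle : ∀ j, ‖g (gen ζ (2 * n) j Φ) l₀‖ ≤ M := by
          intro j
          rcases dich j with ⟨g', hg', e⟩ | e
          · rw [← e Φ hΦ]; exact hmax' _ _ hg'
          · rw [e]; simpa using hM0.le
        have h2 : lam * M ≤ ∑ j ∈ Finset.range (2 * n), ‖g (gen ζ (2 * n) j Φ) l₀‖ := by
          have h1 := congrArg (fun X => g X l₀) heig
          simp only [map_sum, map_smul, Finset.sum_apply, Pi.smul_apply, smul_eq_mul] at h1
          have h2 := norm_sum_le (Finset.range (2 * n)) fun j => g (gen ζ (2 * n) j Φ) l₀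
          rw [h1, norm_mul, hgM, Complex.norm_real, Real.norm_eq_abs] at h2
          exact le_trans (mul_le_mul_of_nonneg_right (le_abs_self _) hM0.le) h2
        have h3 : ∑ j ∈ Finset.range (2 * n), M = 2 * n * M := by simp
        have h4 := Finset.sum_le_sum fun j (_ : j ∈ Finset.range (2 * n)) => hle j
        have heq := (Finset.sum_eq_sum_iff_of_le fun j _ => hle j).1
          (le_antisymm h4 (h3.trans_le ((mul_le_mul_of_nonneg_right hlam hM0.le).trans h2)))
        refine ⟨le_antisymm ?_ hlam, fun j hj => ?_⟩
        · exact le_of_mul_le_mul_right (h2.trans (h4.trans h3.le)) hM0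
        · have hj' := heq j (Finset.mem_range.2 hj)
          rcases dich j with ⟨g', hg', e⟩ | e
          · exact ⟨g', hg', by rw [e Φ hΦ, hj'], e⟩
          · rw [e] at hj'
            simp at hj'
            exact absurd hj' hM0.ne
      have iter : ∀ i ≤ n, ∃ g', Lev ζ m g' ∧ ‖g' Φ l₀‖ = M ∧
          ∀ Y, Balanced n Y → g' Y = g₀ (evenGen ζ (2 * n) i Y) := by
        intro i
        induction i with
        | zero => exact fun _ => ⟨g₀, hg₀, hM, fun Y _ => rfl⟩
        | succ i ihi =>
          intro hi
          obtain ⟨g, hg, hgM, e⟩ := ihi (by omega)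
          obtain ⟨g', hg', hgM', e'⟩ := (step g hg hgM).2 (2 * i) (by omega)
          refine ⟨g', hg', hgM', fun Y hY => ?_⟩
          rw [e' Y hY, e _ (hY.gen hn _ _)]
          rfl
      obtain ⟨g, -, hgM, e⟩ := iter n le_rfl
      rw [e Φ hΦ, hA (step g₀ hg₀ hM).1, map_zero] at hgM
      simp at hgM
      exact hM0.ne hgM
  simpa using main (n + 1) 0 (by omega) _ (Lev.base 0)

lemma balanced_groundVec (ζ : ℂ) (n : ℕ) : Balanced n (groundVec ζ n) := fun _ hl => if_neg hl

lemma balanced_derivVec (ζ : ℂ) (n i : ℕ) : Balanced n (derivVec ζ n i) := fun _ hl => if_neg hl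

lemma sum_gen_groundVec {ζ : ℂ} (hζ : ζ ^ 2 + ζ + 1 = 0) {n : ℕ} (hn : 1 ≤ n) :
    ∑ j ∈ Finset.range (2 * n), gen ζ (2 * n) j (groundVec ζ n) =
      ((2 * n : ℝ) : ℂ) • groundVec ζ n := by
  have hrho : ∀ j, (rho ζ ^ j) (groundVec ζ n) = groundVec ζ n := by
    intro j
    induction j with
    | zero => simp
    | succ j ih => rw [pow_succ, Module.End.mul_apply, rho_groundVec hζ hn, ih]
  have hcc : cup ζ (con ζ (groundVec ζ n)) = groundVec ζ n +
      (ζ * (ζ - 1)) • (rho ζ (derivVec ζ n 0) - derivVec ζ n 0) := by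
    funext l
    rw [cup_con_groundVec hζ hn l, rho_derivVec hζ hn]
    rfl
  have : ∀ j, gen ζ (2 * n) j (groundVec ζ n) = groundVec ζ n + (ζ * (ζ - 1)) •
      ((rho ζ ^ (j + 1)) (derivVec ζ n 0) - (rho ζ ^ j) (derivVec ζ n 0)) := by
    intro j
    rw [gen_apply, hrho, hcc, map_add, map_smul, map_sub, hrho, pow_succ, Module.End.mul_apply]
  simp only [this]
  rw [Finset.sum_add_distrib, ← Finset.smul_sum,
    Finset.sum_range_sub (fun j => (rho ζ ^ j) (derivVec ζ n 0)),
    (balanced_derivVec ζ n 0).rho_period hζ]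
  simp [← Nat.cast_smul_eq_nsmul ℂ]

lemma groundVec_sorted_ne_zero {ζ : ℂ} (hζ : ζ ^ 2 + ζ + 1 = 0) (n : ℕ) :
    groundVec ζ n (sorted n n) ≠ 0 := by
  have h1 : ζ - 1 ≠ 0 := fun h => by
    rw [sub_eq_zero.1 h] at hζ
    norm_num at hζ
  have hp : ∀ m s, MvPolynomial.eval (fun _ => (1 : ℂ)) (pairProd ζ m s) ≠ 0 := by
    intro m
    induction m with
    | zero => simp [pairProd]
    | succ m ih =>
      intro s
      rw [pairProd, map_mul, map_prod]
      refine mul_ne_zero (Finset.prod_ne_zero_iff.2 fun j _ => ?_) (ih _)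
      simpa using h1
  rw [groundVec, if_pos ⟨count_true_sorted n n, count_false_sorted n n⟩, comp, compOp_sorted,
    baseComp, map_mul]
  exact mul_ne_zero (hp _ _) (hp _ _)

/-- Uniqueness of the ground state among balanced vectors. -/
theorem eq_smul_groundVec {ζ : ℂ} (hζ : ζ ^ 2 + ζ + 1 = 0) {n : ℕ} (hn : 1 ≤ n)
    {Φ : List Bool → ℂ} (hΦ : Balanced n Φ) {lam : ℝ} (hlam : 2 * n ≤ lam)
    (heig : ∑ j ∈ Finset.range (2 * n), gen ζ (2 * n) j Φ = (lam : ℂ) • Φ) :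
    ∃ c : ℂ, Φ = c • groundVec ζ n := by
  have hv : (con ζ ^ n) (groundVec ζ n) [] ≠ 0 := fun h => by
    have := eq_zero_of_eigen hζ hn (balanced_groundVec ζ n) le_rfl (sum_gen_groundVec hζ hn)
      fun _ => h
    exact groundVec_sorted_ne_zero hζ n (congrFun this _)
  by_cases hl : lam = 2 * n
  · set c := (con ζ ^ n) Φ [] / (con ζ ^ n) (groundVec ζ n) [] with hc
    refine ⟨c, ?_⟩
    have hb : Balanced n (Φ + (-c) • groundVec ζ n) := hΦ.add ((balanced_groundVec ζ n).smul _)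
    have := eq_zero_of_eigen hζ hn hb hlam (by
      simp only [map_add, map_smul, Finset.sum_add_distrib]
      rw [heig, ← Finset.smul_sum, sum_gen_groundVec hζ hn, hl, smul_add, smul_comm]) fun _ => by
        simp only [map_add, map_smul, Pi.add_apply, Pi.smul_apply, smul_eq_mul]
        rw [hc]
        field_simp
        ring
    rwa [neg_smul, ← sub_eq_add_neg, sub_eq_zero] at this
  · exact ⟨0, by rw [eq_zero_of_eigen hζ hn hΦ hlam heig fun h => absurd h hl, zero_smul]⟩

end XXZ

namespace XXZ

lemma gen_last {ζ : ℂ} (hζ : ζ ^ 2 + ζ + 1 = 0) {n : ℕ} (hn : 1 ≤ n) {Φ : List Bool → ℂ}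
    (hΦ : Balanced n Φ) (r : List Bool) (x y : Bool) (hl : r.length = 2 * n - 2) :
    gen ζ (2 * n) (2 * n - 1) Φ (y :: (r ++ [x])) =
      if x = y then 0 else (if x then ζ else ζ ^ 2) *
        (Φ (x :: (r ++ [y])) - Φ (y :: (r ++ [x]))) := by
  have h3 := cube_eq_one hζ
  by_cases hc : (y :: (r ++ [x])).count true = n ∧ (y :: (r ++ [x])).count false = n
  · have h := rho_pow_append ζ (cup ζ (con ζ (rho ζ Φ))) (y :: r) [x]
    rw [show (y :: r).length = 2 * n - 1 by simp; omega] at h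
    rw [gen_apply, show 2 * n - (2 * n - 1) = 1 by omega, pow_one, ← List.cons_append, h,
      List.singleton_append, cup_cons_cons, con_apply, rho_cons, rho_cons]
    have hk := kapProd_balanced hζ hc.1 hc.2
    rw [← List.cons_append, kapProd_append] at hk
    simp only [kapProd_cons, kapProd_nil, mul_one] at hk ⊢
    cases x <;> cases y <;> simp [arc, kap, -mul_eq_mul_left_iff, -mul_eq_mul_right_iff] at hk ⊢
    · linear_combination (ζ ^ 2 * Φ (false :: (r ++ [true])) -
          ζ ^ 2 * Φ (true :: (r ++ [false]))) * hk
    · linear_combination (ζ * Φ (true :: (r ++ [false])) - ζ * Φ (false :: (r ++ [true]))) * hk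
  · rw [(hΦ.gen hn _ _) _ hc, hΦ _ hc, hΦ]
    · simp
    · intro h
      apply hc
      simp only [List.count_cons, List.count_append, List.count_nil] at h ⊢
      constructor
      · rw [← h.1]; ring
      · rw [← h.2]; ring

/-- Extension by zero of a vector on the chain of length `N` to all words. -/
def wordExt {N : ℕ} (Ψ : Cfg N → ℂ) (l : List Bool) : ℂ :=
  if h : l.length = N then Ψ fun i => l[i.1]'(by have := i.2; omega) else 0

lemma wordExt_ofFn {N : ℕ} (Ψ : Cfg N → ℂ) (a : Cfg N) : wordExt Ψ (List.ofFn a) = Ψ a := by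
  simp [wordExt]

lemma ofFn_eq_splice {N : ℕ} (a : Cfg N) {i : ℕ} (hi : i + 1 < N) :
    List.ofFn a = (List.ofFn a).take i ++ a ⟨i, by omega⟩ :: a ⟨i + 1, hi⟩ ::
      (List.ofFn a).drop (i + 2) := by
  conv_lhs => rw [← List.take_append_drop i (List.ofFn a)]
  rw [List.drop_eq_getElem_cons (by simpa using by omega),
    List.drop_eq_getElem_cons (by simpa using by omega)]
  simp

lemma take_ofFn_congr {N : ℕ} {a b : Cfg N} {i : ℕ} (h : ∀ j : Fin N, j.1 < i → a j = b j) :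
    (List.ofFn a).take i = (List.ofFn b).take i := by
  apply List.ext_getElem (by simp)
  intro m h1 h2
  simp only [List.length_take, List.length_ofFn] at h1
  simpa using h _ (by simp; omega)

lemma drop_ofFn_congr {N : ℕ} {a b : Cfg N} {i : ℕ} (h : ∀ j : Fin N, i ≤ j.1 → a j = b j) :
    (List.ofFn a).drop i = (List.ofFn b).drop i := by
  apply List.ext_getElem (by simp)
  intro m h1 h2
  simpa using h _ (by simp)

lemma ofFn_update_update {N : ℕ} (a : Cfg N) {i : ℕ} (hi : i + 1 < N) (x y : Bool) :
    List.ofFn (Function.update (Function.update a ⟨i, by omega⟩ x) ⟨i + 1, hi⟩ y) =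
      (List.ofFn a).take i ++ x :: y :: (List.ofFn a).drop (i + 2) := by
  rw [ofFn_eq_splice _ hi]
  congr 1
  · refine take_ofFn_congr fun j hj => ?_
    rw [Function.update_of_ne, Function.update_of_ne] <;> simp [Fin.ext_iff] <;> omega
  · congr 1
    · rw [Function.update_of_ne (by simp [Fin.ext_iff]), Function.update_self]
    · congr 1
      · rw [Function.update_self]
      · refine drop_ofFn_congr fun j hj => ?_
        rw [Function.update_of_ne, Function.update_of_ne] <;> simp [Fin.ext_iff] <;> omega

lemma ofFn_eq_ends {N : ℕ} (a : Cfg (N + 2)) :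
    List.ofFn a = a 0 :: (List.ofFn (fun i : Fin N => a i.succ.castSucc) ++ [a (Fin.last _)]) := by
  rw [List.ofFn_succ, List.ofFn_succ']
  simp [List.concat_eq_append]

lemma exists_ofFn_update_ends {N : ℕ} (a : Cfg N) (hN : 2 ≤ N) :
    ∃ r, List.ofFn a = a ⟨0, by omega⟩ :: (r ++ [a ⟨N - 1, by omega⟩]) ∧
      List.ofFn (Function.update (Function.update a ⟨N - 1, by omega⟩ (a ⟨0, by omega⟩))
        ⟨0, by omega⟩ (a ⟨N - 1, by omega⟩)) =
        a ⟨N - 1, by omega⟩ :: (r ++ [a ⟨0, by omega⟩]) := by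
  obtain ⟨N, rfl⟩ : ∃ M, N = M + 2 := ⟨N - 2, by omega⟩
  refine ⟨List.ofFn (fun i : Fin N => a i.succ.castSucc), ofFn_eq_ends a, ?_⟩
  have hl : (⟨N + 2 - 1, by omega⟩ : Fin (N + 2)) = Fin.last _ := rfl
  rw [ofFn_eq_ends, hl, show (⟨0, by omega⟩ : Fin (N + 2)) = 0 from rfl, Function.update_self,
    Function.update_of_ne (Fin.last_pos.ne'), Function.update_self]
  congr 3
  funext i
  rw [Function.update_of_ne, Function.update_of_ne]
  · rw [Ne, Fin.ext_iff]; simp; omega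
  · rw [Ne, Fin.ext_iff]; simp

lemma localOp_mulVec {N : ℕ} (i : Fin N) (A : Matrix Bool Bool ℂ) (Ψ : Cfg N → ℂ) (a : Cfg N) :
    (localOp N i A).mulVec Ψ a = ∑ b, A (a i) b * Ψ (Function.update a i b) := by
  simp only [Matrix.mulVec, dotProduct, localOp, Matrix.of_apply]
  rw [← Finset.sum_subset (Finset.subset_univ (Finset.univ.image fun b => Function.update a i b))]
  · rw [Finset.sum_image fun b _ c _ h => by simpa using congrFun h i]
    refine Finset.sum_congr rfl fun b _ => ?_
    rw [Function.update_self, Finset.prod_eq_one, mul_one]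
    intro j hj
    rw [Function.update_of_ne (Finset.ne_of_mem_erase hj), if_pos rfl]
  · intro g _ hg
    have : ∃ j ≠ i, a j ≠ g j := by
      by_contra! h
      apply hg
      simp only [Finset.mem_image, Finset.mem_univ, true_and]
      refine ⟨g i, funext fun j => ?_⟩
      by_cases hj : j = i
      · subst hj; simp
      · rw [Function.update_of_ne hj, h j hj]
    obtain ⟨j, hj, hne⟩ := this
    rw [Finset.prod_eq_zero (Finset.mem_erase.2 ⟨hj, Finset.mem_univ j⟩) (if_neg hne)]
    simp

lemma localOp_mul_mulVec {N : ℕ} {i j : Fin N} (hij : j ≠ i) (A B : Matrix Bool Bool ℂ)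
    (Ψ : Cfg N → ℂ) (a : Cfg N) :
    (localOp N i A * localOp N j B).mulVec Ψ a =
      ∑ b, ∑ c, A (a i) b * (B (a j) c * Ψ (Function.update (Function.update a i b) j c)) := by
  rw [← Matrix.mulVec_mulVec, localOp_mulVec]
  refine Finset.sum_congr rfl fun b _ => ?_
  rw [localOp_mulVec, Finset.mul_sum, Function.update_of_ne hij]

lemma omega3_spec : omega3 ^ 2 + omega3 + 1 = 0 := by
  have h := Complex.isPrimitiveRoot_exp 3 (by norm_num)
  have h2 := h.geom_sum_eq_zero (by norm_num)
  simp only [Finset.sum_range_succ, Finset.sum_range_zero] at h2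
  rw [omega3]
  push_cast at h2
  linear_combination h2

lemma exp_neg_eq_omega3_sq : Complex.exp (-(2 * Real.pi * Complex.I / 3)) = omega3 ^ 2 := by
  rw [Complex.exp_neg, inv_eq_iff_eq_inv, eq_comm, ← mul_eq_one_iff_inv_eq₀, ← omega3]
  · linear_combination cube_eq_one omega3_spec
  · rw [omega3]; exact pow_ne_zero _ (Complex.exp_ne_zero _)

lemma balanced_wordExt {n : ℕ} {Ψ : Cfg (2 * n) → ℂ} (hSz : (Sz (2 * n)).mulVec Ψ = 0) :
    Balanced n (wordExt Ψ) := by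
  have key : ∀ a : Cfg (2 * n), (((List.ofFn a).count true : ℂ) - (List.ofFn a).count false) *
      Ψ a = 0 := by
    intro a
    have h := congrFun hSz a
    rw [Sz, Matrix.smul_mulVec, Matrix.sum_mulVec, Pi.smul_apply, Finset.sum_apply] at h
    have e : ∀ i, (localOp (2 * n) i sigmaZ).mulVec Ψ a = (if a i then 1 else -1) * Ψ a := by
      intro i
      rw [localOp_mulVec, Fintype.sum_eq_single (a i)]
      · simp [sigmaZ]
      · intro b hb
        simp [sigmaZ, hb.symm]
    have e2 : ∀ l : List Bool, (l.map fun b => if b then (1 : ℂ) else -1).sum =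
        l.count true - l.count false := by
      intro l
      induction l with
      | nil => simp
      | cons b l ih => cases b <;> simp [ih] <;> ring
    rw [Finset.sum_congr rfl fun i _ => e i, ← Finset.sum_mul, ← e2, List.map_ofFn,
      List.sum_ofFn] at *
    simpa using h
  intro l hl
  rw [wordExt]
  split_ifs with h
  · have := key (fun i => l[i.1]'(by have := i.2; omega))
    rw [show List.ofFn (fun i : Fin (2 * n) => l[i.1]'(by have := i.2; omega)) = l from
      List.ext_getElem (by simp [h]) (by simp)] at this
    rcases mul_eq_zero.1 this with h0 | h0
    · exfalso
      rw [sub_eq_zero, Nat.cast_inj] at h0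
      have := count_add_count l
      omega
    · exact h0
  · rfl

lemma bond_mulVec {N : ℕ} {i j : Fin N} (hij : j ≠ i) (Ψ : Cfg N → ℂ) (a : Cfg N) :
    (localOp N i sigmaX * localOp N j sigmaX + localOp N i sigmaY * localOp N j sigmaY
      - (1 / 2 : ℂ) • (localOp N i sigmaZ * localOp N j sigmaZ)).mulVec Ψ a =
      if a i = a j then -(1 / 2) * Ψ a else
        2 * Ψ (Function.update (Function.update a i (a j)) j (a i)) + (1 / 2) * Ψ a := by
  rw [Matrix.sub_mulVec, Matrix.add_mulVec, Matrix.smul_mulVec, Pi.sub_apply, Pi.add_apply,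
    Pi.smul_apply, localOp_mul_mulVec hij, localOp_mul_mulVec hij, localOp_mul_mulVec hij]
  have hself : Function.update (Function.update a i (a i)) j (a j) = a := by simp
  cases h1 : a i <;> cases h2 : a j <;> rw [h1, h2] at hself <;>
    simp [sigmaX, sigmaY, sigmaZ, hself, ← mul_assoc] <;> ring

lemma seam_mulVec {N : ℕ} {i j : Fin N} (hij : j ≠ i) (Ψ : Cfg N → ℂ) (a : Cfg N) :
    ((1 / 2 : ℂ) • (omega3 • (localOp N i sigmaP * localOp N j sigmaM)
        + (Complex.exp (-(2 * Real.pi * Complex.I / 3))) •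
            (localOp N i sigmaM * localOp N j sigmaP))
      - (1 / 2 : ℂ) • (localOp N i sigmaZ * localOp N j sigmaZ)).mulVec Ψ a =
      if a i = a j then -(1 / 2) * Ψ a else
        2 * (if a i then omega3 else omega3 ^ 2) *
          Ψ (Function.update (Function.update a i (a j)) j (a i)) + (1 / 2) * Ψ a := by
  rw [Matrix.sub_mulVec, Matrix.smul_mulVec, Matrix.add_mulVec, Matrix.smul_mulVec,
    Matrix.smul_mulVec, Matrix.smul_mulVec, exp_neg_eq_omega3_sq]
  simp only [Pi.sub_apply, Pi.add_apply, Pi.smul_apply, localOp_mul_mulVec hij]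
  have hself : Function.update (Function.update a i (a i)) j (a j) = a := by simp
  cases h1 : a i <;> cases h2 : a j <;> rw [h1, h2] at hself <;>
    simp [sigmaP, sigmaM, sigmaX, sigmaY, sigmaZ, hself, ← mul_assoc,
      -mul_eq_mul_left_iff, -mul_eq_mul_right_iff] <;> ring

lemma Htw_mulVec {n : ℕ} (hn : 1 ≤ n) {Ψ : Cfg (2 * n) → ℂ} (hΨ : Balanced n (wordExt Ψ))
    (a : Cfg (2 * n)) :
    (Htw (2 * n) (by omega)).mulVec Ψ a =
      (n / 2 : ℂ) * Ψ a -
        (∑ j ∈ Finset.range (2 * n), gen omega3 (2 * n) j (wordExt Ψ)) (List.ofFn a) := by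
  have hω := omega3_spec
  have h3 := cube_eq_one hω
  set sp : ℕ → ℂ := fun i => if h : i < 2 * n then (if a ⟨i, h⟩ then 1 else 0) else 0 with hsp
  have hbond : ∀ i : Fin (2 * n - 1),
      (localOp (2 * n) ⟨i.val, by have := i.isLt; omega⟩ sigmaX *
          localOp (2 * n) ⟨i.val+1, by have := i.isLt; omega⟩ sigmaX
        + localOp (2 * n) ⟨i.val, by have := i.isLt; omega⟩ sigmaY *
            localOp (2 * n) ⟨i.val+1, by have := i.isLt; omega⟩ sigmaY
        - (1/2 : ℂ) • (localOp (2 * n) ⟨i.val, by have := i.isLt; omega⟩ sigmaZ *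
            localOp (2 * n) ⟨i.val+1, by have := i.isLt; omega⟩ sigmaZ)).mulVec Ψ a =
      2 * gen omega3 (2 * n) i (wordExt Ψ) (List.ofFn a) - (1 / 2) * Ψ a +
        (1 + 2 * omega3) * (sp i - sp (i + 1)) * Ψ a := by
    intro i
    have hi : i.1 + 1 < 2 * n := by have := i.2; omega
    have hlen : ((List.ofFn a).take i.1).length = i.1 := by simp; omega
    rw [bond_mulVec (by simp [Fin.ext_iff])]
    have hg := gen_append hω hΨ ((List.ofFn a).take i.1) ((List.ofFn a).drop (i.1 + 2))
      (a ⟨i, by omega⟩) (a ⟨i + 1, hi⟩) (by simp; omega)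
    have hu := fun x y => ofFn_update_update a hi x y
    rw [hlen, ← ofFn_eq_splice, ← hu, ← hu, wordExt_ofFn, wordExt_ofFn] at hg
    rw [hg]
    have hself : Function.update (Function.update a ⟨i, by omega⟩ (a ⟨i, by omega⟩)) ⟨i + 1, hi⟩
      (a ⟨i + 1, hi⟩) = a := by simp
    have s1 : sp i = if a ⟨i, by omega⟩ then 1 else 0 := dif_pos (by omega)
    have s2 : sp (i + 1) = if a ⟨i + 1, hi⟩ then 1 else 0 := dif_pos hi
    rw [s1, s2]
    cases h1 : a ⟨i, by omega⟩ <;> cases h2 : a ⟨i + 1, hi⟩ <;> rw [h1, h2] at hself <;>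
      simp only [hself, arc] <;> simp
    · linear_combination 2 * Ψ a * hω - 2 *
        Ψ (Function.update (Function.update a ⟨i, by omega⟩ true) ⟨i + 1, hi⟩ false) * h3
    · ring
  have hseam := seam_mulVec (i := (⟨2 * n - 1, by omega⟩ : Fin (2 * n))) (j := ⟨0, by omega⟩)
    (by simp [Fin.ext_iff]; omega) Ψ a
  have hlast : gen omega3 (2 * n) (2 * n - 1) (wordExt Ψ) (List.ofFn a) =
      if a ⟨2 * n - 1, by omega⟩ = a ⟨0, by omega⟩ then 0 else
        (if a ⟨2 * n - 1, by omega⟩ then omega3 else omega3 ^ 2) *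
        (Ψ (Function.update (Function.update a ⟨2 * n - 1, by omega⟩ (a ⟨0, by omega⟩))
          ⟨0, by omega⟩ (a ⟨2 * n - 1, by omega⟩)) - Ψ a) := by
    obtain ⟨r, hr, hr2⟩ := exists_ofFn_update_ends a (by omega)
    rw [← wordExt_ofFn Ψ a, ← wordExt_ofFn Ψ (Function.update _ _ _), hr2, hr,
      gen_last hω hn hΨ _ _ _ (by
        have := congrArg List.length hr
        simp at this
        omega)]
  have s1 : sp (2 * n - 1) = if a ⟨2 * n - 1, by omega⟩ then 1 else 0 := dif_pos (by omega)
  have s2 : sp 0 = if a ⟨0, by omega⟩ then 1 else 0 := dif_pos (by omega)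
  have htel := Finset.sum_range_sub' sp (2 * n - 1)
  have hsplit : ∀ f : ℕ → ℂ, ∑ j ∈ Finset.range (2 * n), f j =
      ∑ j ∈ Finset.range (2 * n - 1), f j + f (2 * n - 1) := fun f => by
    rw [← Finset.sum_range_succ, show 2 * n - 1 + 1 = 2 * n by omega]
  rw [Htw, Matrix.smul_mulVec, add_sub_assoc, Matrix.add_mulVec, Matrix.sum_mulVec, Pi.smul_apply,
    Pi.add_apply, hseam, Finset.sum_apply, Finset.sum_congr rfl fun i _ => hbond i,
    Fin.sum_univ_eq_sum_range (fun i => 2 * gen omega3 (2 * n) i (wordExt Ψ) (List.ofFn a) -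
      (1 / 2) * Ψ a + (1 + 2 * omega3) * (sp i - sp (i + 1)) * Ψ a),
    Finset.sum_add_distrib, Finset.sum_sub_distrib, ← Finset.mul_sum, ← Finset.sum_mul,
    ← Finset.sum_mul, ← Finset.mul_sum, htel, Finset.sum_apply,
    hsplit fun j => gen omega3 (2 * n) j (wordExt Ψ) (List.ofFn a), hlast, s1, s2]
  have hc : ((2 * n - 1 : ℕ) : ℂ) = 2 * n - 1 := by
    rw [Nat.cast_sub (by omega)]; push_cast; ring
  rw [Finset.sum_const, Finset.card_range, nsmul_eq_mul, hc]
  cases h1 : a ⟨2 * n - 1, by omega⟩ <;> cases h2 : a ⟨0, by omega⟩ <;> simp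
  · ring
  · linear_combination -Ψ a * hω
  · ring
  · ring

/-- The ground state of the twisted chain is the balanced vector `groundVec`. -/
theorem ground_eq_smul {n : ℕ} (hn : 1 ≤ n) {Ψ : Cfg (2 * n) → ℂ} (hΨ : Ψ ≠ 0) {E₀ : ℝ}
    (hground : (Htw (2 * n) (by omega)).mulVec Ψ = (E₀ : ℂ) • Ψ)
    (hmin : ∀ (E : ℂ) (v : Cfg (2 * n) → ℂ), v ≠ 0 →
      (Htw (2 * n) (by omega)).mulVec v = E • v → E₀ ≤ E.re)
    (hSz : (Sz (2 * n)).mulVec Ψ = 0) :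
    ∃ c : ℂ, c ≠ 0 ∧ ∀ a, Ψ a = c * groundVec omega3 n (List.ofFn a) := by
  have hω := omega3_spec
  have hbal := balanced_wordExt hSz
  have hE : E₀ ≤ -(3 * n / 2) := by
    set v : Cfg (2 * n) → ℂ := fun a => groundVec omega3 n (List.ofFn a) with hv
    have hext : wordExt v = groundVec omega3 n := by
      funext l
      rw [wordExt]
      split_ifs with h
      · rw [hv]
        exact congrArg _ (List.ext_getElem (by simp [h]) (by simp))
      · rw [balanced_groundVec omega3 n l]
        rintro ⟨h1, h2⟩
        have := count_add_count l
        omega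
    have h := hmin (-(3 * n / 2)) v (fun h0 => by
      have := groundVec_sorted_ne_zero hω n
      rw [← hext, h0] at this
      apply this
      simp [wordExt]) (by
      funext a
      rw [Htw_mulVec hn (hext ▸ balanced_groundVec omega3 n), hext, sum_gen_groundVec hω hn]
      simp only [hv, Pi.smul_apply, smul_eq_mul]
      push_cast
      ring)
    have e : ((-(3 * n / 2) : ℂ)).re = -(3 * n / 2) := by
      rw [show (-(3 * n / 2) : ℂ) = ((-(3 * n / 2) : ℝ) : ℂ) by push_cast; ring, Complex.ofReal_re]
    rwa [e] at h
  obtain ⟨c, hc⟩ := eq_smul_groundVec hω hn hbal (lam := n / 2 - E₀) (by linarith) (by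
    funext l
    by_cases hl : l.length = 2 * n
    · obtain ⟨a, rfl⟩ : ∃ a : Cfg (2 * n), l = List.ofFn a :=
        ⟨fun i => l[i.1]'(by have := i.2; omega), List.ext_getElem (by simp [hl]) (by simp)⟩
      have := Htw_mulVec hn hbal a
      rw [hground] at this
      rw [Pi.smul_apply, wordExt_ofFn]
      simp only [Pi.smul_apply, smul_eq_mul] at this ⊢
      push_cast
      linear_combination this
    · have hb : ¬ (l.count true = n ∧ l.count false = n) := by
        have := count_add_count l
        omega
      rw [Finset.sum_apply, Finset.sum_eq_zero fun j _ => hbal.gen hn _ _ _ hb, Pi.smul_apply,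
        hbal _ hb, smul_zero])
  have h2 : ∀ a, Ψ a = c * groundVec omega3 n (List.ofFn a) := fun a => by
    rw [← wordExt_ofFn Ψ, hc]; rfl
  refine ⟨c, fun h0 => hΨ (funext fun a => ?_), h2⟩
  rw [h2, h0]; simp

end XXZ

namespace XXZ
open MvPolynomial

/-- Sum of `g` over all words of length `L`. -/
def wsum {A : Type*} [AddCommMonoid A] : ℕ → (List Bool → A) → A
  | 0, g => g []
  | L + 1, g => wsum L (fun l => g (true :: l)) + wsum L (fun l => g (false :: l))

lemma wsum_congr {A : Type*} [AddCommMonoid A] {L : ℕ} {g g' : List Bool → A}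
    (h : ∀ l, l.length = L → g l = g' l) : wsum L g = wsum L g' := by
  induction L generalizing g g' with
  | zero => exact h _ rfl
  | succ L ih =>
    rw [wsum, wsum, ih fun l hl => h _ (by simp [hl]), ih fun l hl => h _ (by simp [hl])]

lemma map_wsum {A B : Type*} [AddCommMonoid A] [AddCommMonoid B] (φ : A →+ B) (L : ℕ)
    (g : List Bool → A) : φ (wsum L g) = wsum L fun l => φ (g l) := by
  induction L generalizing g with
  | zero => rfl
  | succ L ih => rw [wsum, wsum, map_add, ih, ih]

lemma wsum_add_length {A : Type*} [AddCommMonoid A] (p q : ℕ) (g : List Bool → A) :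
    wsum (p + q) g = wsum p fun a => wsum q fun b => g (a ++ b) := by
  induction p generalizing g with
  | zero => simp [wsum]
  | succ p ih =>
    rw [show p + 1 + q = p + q + 1 by omega, wsum, ih, ih]
    rfl

lemma wsum_add {A : Type*} [AddCommMonoid A] (L : ℕ) (g g' : List Bool → A) :
    (wsum L fun l => g l + g' l) = wsum L g + wsum L g' := by
  induction L generalizing g g' with
  | zero => rfl
  | succ L ih => simp only [wsum, ih]; abel

lemma mul_wsum {A : Type*} [NonUnitalNonAssocSemiring A] (c : A) (L : ℕ) (g : List Bool → A) :
    c * wsum L g = wsum L fun l => c * g l :=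
  map_wsum (AddMonoidHom.mulLeft c) L g

lemma wsum_zero {A : Type*} [AddCommMonoid A] (L : ℕ) : (wsum L fun _ => (0 : A)) = 0 := by
  induction L with
  | zero => rfl
  | succ L ih => rw [wsum, ih, add_zero]

/-- Monomial in the variables sitting at up spins. -/
def upMon : List Bool → ℕ → MvPolynomial ℕ ℂ
  | [], _ => 1
  | x :: l, s => (if x then X s else 1) * upMon l (s + 1)

lemma upMon_append (l₁ l₂ : List Bool) (s : ℕ) :
    upMon (l₁ ++ l₂) s = upMon l₁ s * upMon l₂ (s + l₁.length) := by
  induction l₁ generalizing s with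
  | nil => simp [upMon]
  | cons x l ih =>
    simp only [List.cons_append, upMon, ih, List.length_cons]
    rw [show s + 1 + l.length = s + (l.length + 1) by omega]; ring

lemma sw_upMon {l : List Bool} {s i : ℕ} (h : i + 1 < s ∨ s + l.length ≤ i) :
    sw i (upMon l s) = upMon l s := by
  induction l generalizing s with
  | nil => simp [upMon]
  | cons x l ih =>
    simp only [List.length_cons] at h
    rw [upMon, map_mul, ih (by omega)]
    cases x
    · simp
    · simp [sw_X_of_ne (show s ≠ i by omega) (show s ≠ i + 1 by omega)]

/-- Contribution of the word `l` to the weighted sum rule. -/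
def term (ζ : ℂ) (n : ℕ) (l : List Bool) : MvPolynomial ℕ ℂ :=
  if l.count true = n ∧ l.count false = n then comp ζ n l * comp (ζ ^ 2) n l * upMon l 0 else 0

/-- Weighted sum of squares over the words of length `k + M` starting with `k` up spins. -/
def sumPoly (ζ : ℂ) (n k M : ℕ) : MvPolynomial ℕ ℂ :=
  wsum M fun w => term ζ n (List.replicate k true ++ w)

lemma sq_spec {ζ : ℂ} (hζ : ζ ^ 2 + ζ + 1 = 0) : (ζ ^ 2) ^ 2 + ζ ^ 2 + 1 = 0 := by
  linear_combination (ζ ^ 2 - ζ + 1) * hζ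

lemma C_spec {ζ : ℂ} (hζ : ζ ^ 2 + ζ + 1 = 0) : (C ζ : MvPolynomial ℕ ℂ) ^ 2 + C ζ + 1 = 0 := by
  rw [← map_pow, ← map_add, ← map_one C, ← map_add, hζ, map_zero]

lemma quad_ne_zero {ζ : ℂ} (hζ : ζ ^ 2 + ζ + 1 = 0) (i j : ℕ) :
    (C ζ * X i - X j : MvPolynomial ℕ ℂ) * (C (ζ ^ 2) * X i - X j) ≠ 0 := by
  intro h
  have h1 := congrArg (eval fun _ => (1 : ℂ)) h
  simp only [map_mul, map_sub, eval_C, eval_X, map_zero] at h1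
  have : (ζ * 1 - 1) * (ζ ^ 2 * 1 - 1) = 3 := by linear_combination (ζ - 2) * hζ
  rw [this] at h1
  norm_num at h1

lemma sw_term_pair {ζ : ℂ} (hζ : ζ ^ 2 + ζ + 1 = 0) (n : ℕ) (a b : List Bool) :
    sw a.length (term ζ n (a ++ true :: false :: b) + term ζ n (a ++ false :: true :: b)) =
      term ζ n (a ++ true :: false :: b) + term ζ n (a ++ false :: true :: b) := by
  have e1 : (a ++ false :: true :: b).count true = (a ++ true :: false :: b).count true := by
    simp
  have e2 : (a ++ false :: true :: b).count false = (a ++ true :: false :: b).count false := by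
    simp
  rw [term, term, e1, e2]
  split_ifs with h
  swap
  · simp
  refine mul_left_cancel₀ (quad_ne_zero hζ (a.length + 1) a.length) ?_
  have h1 := comp_swap_up_down hζ n a b
  have h2 := comp_swap_down_up hζ n a b
  have h3 := comp_swap_up_down (sq_spec hζ) n a b
  have h4 := comp_swap_down_up (sq_spec hζ) n a b
  simp only [upMon_append, upMon, map_add, map_mul, if_true, if_false, Bool.false_eq_true,
    zero_add, one_mul, sw_X_left, sw_X_right,
    sw_upMon (l := a) (s := 0) (i := a.length) (by omega),
    sw_upMon (l := b) (s := a.length + 1 + 1) (i := a.length) (by omega)]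
  have hc := C_spec hζ
  rw [map_pow] at h3 h4 ⊢
  generalize comp ζ n (a ++ true :: false :: b) = u at *
  generalize comp ζ n (a ++ false :: true :: b) = v at *
  generalize comp (ζ ^ 2) n (a ++ true :: false :: b) = u' at *
  generalize comp (ζ ^ 2) n (a ++ false :: true :: b) = v' at *
  generalize sw a.length u = su at *
  generalize sw a.length v = sv at *
  generalize sw a.length u' = su' at *
  generalize sw a.length v' = sv' at *
  generalize (X a.length : MvPolynomial ℕ ℂ) = x at *
  generalize (X (a.length + 1) : MvPolynomial ℕ ℂ) = y at *
  generalize (C ζ : MvPolynomial ℕ ℂ) = c at *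
  generalize upMon a 0 = ma
  generalize upMon b (a.length + 1 + 1) = mb
  have k1 : (c * y - x) * su * ((c ^ 2 * y - x) * su') =
      (c ^ 2 * (x - y) * v + (c - 1) * x * u) *
          ((c ^ 2) ^ 2 * (x - y) * v' + (c ^ 2 - 1) * x * u') := by
    rw [h1, h3]
  have k2 : (c * y - x) * sv * ((c ^ 2 * y - x) * sv') =
      (c ^ 2 * (x - y) * u + (c - 1) * y * v) *
          ((c ^ 2) ^ 2 * (x - y) * u' + (c ^ 2 - 1) * y * v') := by
    rw [h2, h4]
  linear_combination ma * mb * y * k1 + ma * mb * x * k2 +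
      ma * mb * (u * u' * (x ^ 2 * y * (c - 2) +
    x * (x - y) ^ 2 * (c - 1) * (c ^ 3 + 1) - x * y ^ 2 * (c - 1) + x ^ 2 * y) +
    v * v' * (x * y ^ 2 * (c - 2) + y * (x - y) ^ 2 * (c - 1) * (c ^ 3 + 1) -
      y * y ^ 2 * (c - 1) + x * y ^ 2) +
    (u * v' + v * u') * (x * y * (x - y) * c ^ 2 * (c - 1))) * hc

lemma sw_term_aligned {ζ : ℂ} (hζ : ζ ^ 2 + ζ + 1 = 0) (n : ℕ) (x : Bool) (a b : List Bool) :
    sw a.length (term ζ n (a ++ x :: x :: b)) = term ζ n (a ++ x :: x :: b) := by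
  rw [term]
  split_ifs with h
  swap
  · simp
  refine mul_left_cancel₀ (quad_ne_zero hζ (a.length + 1) a.length) ?_
  have h1 := comp_swap_aligned hζ n x a b h.1 h.2
  have h3 := comp_swap_aligned (sq_spec hζ) n x a b h.1 h.2
  have h5 : sw a.length (upMon (a ++ x :: x :: b) 0) = upMon (a ++ x :: x :: b) 0 := by
    simp only [upMon_append, upMon, map_mul, zero_add,
      sw_upMon (l := a) (s := 0) (i := a.length) (by omega),
      sw_upMon (l := b) (s := a.length + 1 + 1) (i := a.length) (by omega)]
    cases x
    · simp
    · simp only [if_true, sw_X_left, sw_X_right]; ring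
  rw [map_mul, map_mul, h5]
  have hc := C_spec hζ
  rw [map_pow] at h3 ⊢
  generalize comp ζ n (a ++ x :: x :: b) = u at *
  generalize comp (ζ ^ 2) n (a ++ x :: x :: b) = u' at *
  generalize sw a.length u = su at *
  generalize sw a.length u' = su' at *
  generalize (X a.length : MvPolynomial ℕ ℂ) = x at *
  generalize (X (a.length + 1) : MvPolynomial ℕ ℂ) = y at *
  generalize (C ζ : MvPolynomial ℕ ℂ) = c at *
  generalize upMon _ 0 = m
  linear_combination m * (c ^ 2 * y - x) * su' * h1 + m * (c * x - y) * u * h3 +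
    m * u * u' * (c - 1) * (x ^ 2 - y ^ 2) * hc

lemma sw_sumPoly {ζ : ℂ} (hζ : ζ ^ 2 + ζ + 1 = 0) {n k M i : ℕ} (h1 : k ≤ i) (h2 : i + 1 < k + M) :
    sw i (sumPoly ζ n k M) = sumPoly ζ n k M := by
  obtain ⟨p, rfl⟩ := Nat.exists_eq_add_of_le h1
  obtain ⟨q, rfl⟩ : ∃ q, M = p + (2 + q) := ⟨M - p - 2, by omega⟩
  rw [sumPoly, wsum_add_length]
  have e : ∀ g : List Bool → MvPolynomial ℕ ℂ, sw (k + p) (wsum p g) =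
      wsum p fun a => sw (k + p) (g a) :=
    fun g => map_wsum (sw (k + p) : MvPolynomial ℕ ℂ →+ MvPolynomial ℕ ℂ) p g
  rw [e]
  refine wsum_congr fun a ha => ?_
  have hl : (List.replicate k true ++ a).length = k + p := by simp [ha]
  have key : ∀ b, (fun b : List Bool => term ζ n (List.replicate k true ++ (a ++ (true :: true :: b)))
      + term ζ n (List.replicate k true ++ (a ++ (false :: false :: b)))
      + (term ζ n (List.replicate k true ++ (a ++ (true :: false :: b))) +
        term ζ n (List.replicate k true ++ (a ++ (false :: true :: b))))) b =
      sw (k + p) ((fun b : List Bool => term ζ n (List.replicate k true ++ (a ++ (true :: true :: b)))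
      + term ζ n (List.replicate k true ++ (a ++ (false :: false :: b)))
      + (term ζ n (List.replicate k true ++ (a ++ (true :: false :: b))) +
        term ζ n (List.replicate k true ++ (a ++ (false :: true :: b))))) b) := by
    intro b
    simp only [← List.append_assoc]
    rw [map_add (sw (k + p)) (_ + _), map_add (sw (k + p)) (term _ _ _) (term _ _ _), ← hl,
      sw_term_aligned hζ, sw_term_aligned hζ, sw_term_pair hζ]
  have e2 : ∀ g : List Bool → MvPolynomial ℕ ℂ, wsum (2 + q) g =
      wsum q fun b => g (true :: true :: b) + g (false :: false :: b) +
        (g (true :: false :: b) + g (false :: true :: b)) := by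
    intro g
    rw [show 2 + q = q + 1 + 1 by omega]
    simp only [wsum, wsum_add]
    abel
  rw [e2]
  conv_rhs => rw [wsum_congr fun b _ => key b]
  exact map_wsum (sw (k + p) : MvPolynomial ℕ ℂ →+ MvPolynomial ℕ ℂ) q _

end XXZ

namespace XXZ
open MvPolynomial

lemma heckeOp_injective {ζ : ℂ} (hζ : ζ ^ 2 + ζ + 1 = 0) (i : ℕ) :
    Function.Injective (heckeOp ζ i) := by
  intro f g h
  have h1 := heckeOp_spec ζ i f
  have h2 := heckeOp_spec ζ i g
  have hc := C_cube hζ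
  rw [h] at h1
  have h3 : (C ζ * X (i + 1) - X i) * sw i (f - g) = (C ζ - 1) * X i * (f - g) := by
    rw [map_sub]
    linear_combination C ζ ^ 2 * (h2 - h1) - ((C ζ * X (i + 1) - X i) * (sw i f - sw i g) -
      (C ζ - 1) * X i * (f - g)) * hc
  have h4 := congrArg (sw i) h3
  simp only [map_mul, map_sub (sw i) (C ζ * X (i + 1)) _, map_sub (sw i) (C ζ) _, sw_sw,
    sw_X_left, sw_X_right, sw_C, map_one] at h4
  have h5 : -(C ζ * ((X i - X (i + 1)) * (X i - X (i + 1)))) * (f - g) = 0 := by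
    linear_combination (C ζ * X (i + 1) - X i) * h4 + (C ζ - 1) * X (i + 1) * h3
  have hz : (C ζ : MvPolynomial ℕ ℂ) ≠ 0 := by
    intro h0; rw [h0] at hc; norm_num at hc
  rcases mul_eq_zero.mp h5 with h6 | h6
  · exact absurd h6 (neg_ne_zero.mpr (mul_ne_zero hz (mul_ne_zero (X_sub_X_ne_zero (by omega))
      (X_sub_X_ne_zero (by omega)))))
  · exact sub_eq_zero.mp h6

lemma Exch.ext_rev {ζ : ℂ} (hζ : ζ ^ 2 + ζ + 1 = 0) {c L : ℕ} {Φ Φ' : List Bool → MvPolynomial ℕ ℂ}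
    (h : Exch ζ c L Φ) (h' : Exch ζ c L Φ') (l : List Bool) (hl : l.length = L)
    (hs : Φ (List.replicate (l.count false) false ++ List.replicate (l.count true) true) =
      Φ' (List.replicate (l.count false) false ++ List.replicate (l.count true) true)) :
    Φ l = Φ' l := by
  have key := sort_induction (Q := fun l => l.length = L → Φ (l.map not) = Φ' (l.map not))
    (fun l₁ l₂ hQ hL => by
      have hL' : l₁.length + l₂.length + 2 = L := by rw [← hL]; simp; omega
      have e := hQ (by rw [← hL]; simp)
      simp only [List.map_append, List.map_cons, Bool.not_true, Bool.not_false] at e ⊢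
      rw [h _ _ (by simpa using hL'), h' _ _ (by simpa using hL')] at e
      exact heckeOp_injective hζ _ e) (l.map not)
    (fun _ => by
      have e1 : (l.map not).count true = l.count false := by
        have := List.count_map_of_injective l not Bool.not_injective false
        simpa using this
      have e2 : (l.map not).count false = l.count true := by
        have := List.count_map_of_injective l not Bool.not_injective true
        simpa using this
      rw [e1, e2]
      simpa [sorted] using hs)
    (by simpa using hl)
  simpa [Function.comp_def] using key

/-- The specialization `X_N = ζ X_{N+1}`. -/
def pinch (ζ : ℂ) (N : ℕ) : MvPolynomial ℕ ℂ →ₐ[ℂ] MvPolynomial ℕ ℂ :=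
  aeval fun j => if j = N then C ζ * X (N + 1) else X j

lemma pinch_X_self (ζ : ℂ) (N : ℕ) : pinch ζ N (X N) = C ζ * X (N + 1) := by simp [pinch]

lemma pinch_X_of_ne (ζ : ℂ) {N j : ℕ} (h : j ≠ N) : pinch ζ N (X j) = X j := by simp [pinch, h]

lemma pinch_sw (ζ : ℂ) {N i : ℕ} (h : i + 1 < N) (f : MvPolynomial ℕ ℂ) :
    pinch ζ N (sw i f) = sw i (pinch ζ N f) := by
  have : (pinch ζ N).comp (sw i) = (sw i).comp (pinch ζ N) := by
    apply MvPolynomial.algHom_ext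
    intro j
    simp only [AlgHom.comp_apply, sw_X]
    by_cases hj : j = N
    · subst hj
      rw [Equiv.swap_apply_of_ne_of_ne (by omega) (by omega), pinch_X_self, map_mul, sw_C,
        sw_X_of_ne (by omega) (by omega)]
    · rw [pinch_X_of_ne ζ hj, pinch_X_of_ne, sw_X]
      rw [Equiv.swap_apply_def]
      split_ifs <;> omega
  exact DFunLike.congr_fun this f

lemma eval_pinch {ζ : ℂ} {N : ℕ} {v : ℕ → ℂ} (h : v N = ζ * v (N + 1)) (f : MvPolynomial ℕ ℂ) :
    eval v (pinch ζ N f) = eval v f := by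
  have : ((aeval v : MvPolynomial ℕ ℂ →ₐ[ℂ] ℂ).comp (pinch ζ N)) = aeval v := ?_
  · exact DFunLike.congr_fun this f
  apply MvPolynomial.algHom_ext
  intro j
  simp only [AlgHom.comp_apply, aeval_X, pinch]
  split_ifs with hj
  · simp [hj, h]
  · simp

lemma pinch_pairProd (ζ : ℂ) {N n s : ℕ} (h : s + n ≤ N) :
    pinch ζ N (pairProd ζ n s) = pairProd ζ n s := by
  induction n generalizing s with
  | zero => simp [pairProd]
  | succ n ih =>
    rw [pairProd, map_mul, ih (by omega), map_prod]
    congr 1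
    refine Finset.prod_congr rfl fun j hj => ?_
    rw [Finset.mem_Ico] at hj
    rw [map_sub, map_mul, pinch_X_of_ne ζ (by omega), pinch_X_of_ne ζ (by omega)]
    simp [pinch]

lemma sw_prod_range {N i : ℕ} (h : i + 1 < N) (ζ : ℂ) :
    sw i (∏ j ∈ Finset.range N, (X j - C (ζ ^ 2) * X (N + 1))) =
      ∏ j ∈ Finset.range N, (X j - C (ζ ^ 2) * X (N + 1)) := by
  rw [map_prod]
  have : ∀ j, sw i (X j - C (ζ ^ 2) * X (N + 1)) =
      X (Equiv.swap i (i + 1) j) - C (ζ ^ 2) * X (N + 1) := fun j => by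
    rw [map_sub, map_mul, sw_C, sw_X, sw_X_of_ne (by omega) (by omega)]
  simp only [this]
  have := prod_swap (i := i) (a := 0) (b := N) (by omega) h
    fun j => (X j - C (ζ ^ 2) * X (N + 1) : MvPolynomial ℕ ℂ)
  simpa only [Nat.Ico_zero_eq_range] using this

/-- Fusion of the last two sites. -/
lemma pinch_comp {ζ : ℂ} (hζ : ζ ^ 2 + ζ + 1 = 0) {n : ℕ} (l : List Bool)
    (h1 : l.count true = n) (h2 : l.count false = n) :
    pinch ζ (2 * n) (comp ζ (n + 1) (l ++ [true, false])) =
      C ((-ζ) ^ n) * (∏ j ∈ Finset.range (2 * n), (X j - C (ζ ^ 2) * X (2 * n + 1))) *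
        comp ζ n l := by
  have hl : l.length = 2 * n := by have := count_add_count l; omega
  refine Exch.ext_rev hζ (c := 0) (L := 2 * n)
    (Φ := fun l => pinch ζ (2 * n) (comp ζ (n + 1) (l ++ [true, false])))
    (Φ' := fun l => C ((-ζ) ^ n) * (∏ j ∈ Finset.range (2 * n), (X j - C (ζ ^ 2) * X (2 * n + 1))) *
        comp ζ n l) (fun l₁ l₂ hL => ?_) (fun l₁ l₂ hL => ?_) l hl ?_
  · simp only [List.append_assoc, List.cons_append]
    rw [comp_exchange, Nat.zero_add]
    refine (heckeOp_map _ ?_ ?_ ?_).symm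
    · exact pinch_X_of_ne _ (by omega)
    · exact pinch_X_of_ne _ (by omega)
    · exact pinch_sw _ (by omega) _
  · simp only
    rw [comp_exchange, heckeOp_mul, Nat.zero_add]
    rw [map_mul, sw_C, sw_prod_range (by omega)]
  · simp only [h1, h2]
    rcases Nat.eq_zero_or_pos n with rfl | hn
    · have e1 := comp_sorted ζ 1
      have e2 := comp_sorted ζ 0
      simp only [sorted, List.replicate_zero, List.replicate_one, List.nil_append,
        List.singleton_append, Nat.zero_add] at e1 e2 ⊢
      rw [e1, e2]
      simp [baseComp, pairProd]
    have e1 := comp_rot_iterate hζ (n := n + 1) (by omega) n (by omega)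
    have e2 := comp_rot_iterate hζ (n := n) hn n le_rfl
    have e3 : List.replicate n false ++ List.replicate n true ++ [true, false] =
        List.replicate n false ++ (List.replicate (n + 1) true ++
          List.replicate (n + 1 - n) false) := by
      simp [List.replicate_succ']
    have e4 : List.replicate n false ++ List.replicate n true =
        List.replicate n false ++ (List.replicate n true ++ List.replicate (n - n) false) := by
      simp
    rw [e3, e1, e4, e2, rename_rot_iterate_base, baseComp, baseComp, map_mul (rename _),
      rename_pairProd (s' := n), pairProd_succ_last ζ n n, pairProd_succ ζ n (n + 1),
          map_mul (rename _),
      rename_pairProd (s' := 0)]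
    rotate_left
    · intro j hj
      rw [rot_iterate (by omega), show n + 1 + 1 + j + n = 0 + j + 2 * (n + 1) by omega,
        Nat.add_mod_right, Nat.mod_eq_of_lt (by omega)]
    · intro j hj
      rw [rot_iterate (by omega), Nat.mod_eq_of_lt (by omega)]; omega
    have f1 : rename ((rot (2 * (n + 1)))^[n])
        (∏ j ∈ Finset.Ico (n + 1 + 1) (n + 1 + 1 + n), (C ζ * X j - X (n + 1)) : MvPolynomial ℕ ℂ) =
        ∏ j ∈ Finset.range n, (C ζ * X j - X (2 * n + 1)) := by
      rw [map_prod, Finset.prod_Ico_eq_prod_range, Nat.add_sub_cancel_left]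
      refine Finset.prod_congr rfl fun j hj => ?_
      rw [Finset.mem_range] at hj
      simp only [map_sub, map_mul, rename_X, rename_C]
      rw [rot_iterate (by omega), rot_iterate (by omega),
        show n + 1 + 1 + j + n = j + 2 * (n + 1) by omega,
        Nat.add_mod_right, Nat.mod_eq_of_lt (by omega), Nat.mod_eq_of_lt (by omega),
        show n + 1 + n = 2 * n + 1 by omega]
    rw [f1]
    have g1 : ∀ j < 2 * n, pinch ζ (2 * n) (X j) = X j := fun j hj => pinch_X_of_ne _ (by omega)
    have g2 : pinch ζ (2 * n) (X (2 * n + 1)) = X (2 * n + 1) := pinch_X_of_ne _ (by omega)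
    have g3 : ∀ c, pinch ζ (2 * n) (C c) = C c := fun c => (pinch ζ (2 * n)).commutes c
    simp only [map_mul (pinch ζ (2 * n)), map_pow (pinch ζ (2 * n)), g3,
      pinch_pairProd ζ (show n + n ≤ 2 * n by omega),
          pinch_pairProd ζ (show 0 + n ≤ 2 * n by omega),
      map_prod (pinch ζ (2 * n))]
    have hc := C_cube hζ
    have p1 : ∏ j ∈ Finset.Ico n (n + n), pinch ζ (2 * n) (C ζ * X (n + n) - X j) =
        (-1) ^ n * ∏ j ∈ Finset.Ico n (2 * n), (X j - C (ζ ^ 2) * X (2 * n + 1)) := by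
      rw [show (-1 : MvPolynomial ℕ ℂ) ^ n = ∏ j ∈ Finset.Ico n (2 * n), (-1) by
        simp [show 2 * n - n = n by omega], ← Finset.prod_mul_distrib, show n + n = 2 * n by omega]
      refine Finset.prod_congr rfl fun j hj => ?_
      rw [Finset.mem_Ico] at hj
      rw [map_sub, map_mul, g3, g1 j hj.2, pinch_X_self, map_pow]
      ring
    have p2 : ∏ j ∈ Finset.range n, pinch ζ (2 * n) (C ζ * X j - X (2 * n + 1)) =
        C ζ ^ n * ∏ j ∈ Finset.Ico 0 n, (X j - C (ζ ^ 2) * X (2 * n + 1)) := by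
      rw [show (C ζ : MvPolynomial ℕ ℂ) ^ n = ∏ j ∈ Finset.Ico 0 n, C ζ by simp,
        ← Finset.prod_mul_distrib, Nat.Ico_zero_eq_range]
      refine Finset.prod_congr rfl fun j hj => ?_
      rw [Finset.mem_range] at hj
      rw [map_sub, map_mul, g3, g1 j (by omega), g2, map_pow]
      linear_combination X (2 * n + 1) * hc
    rw [p1, p2, ← Nat.Ico_zero_eq_range, ← Finset.prod_Ico_consecutive _ (Nat.zero_le n)
      (show n ≤ 2 * n by omega), neg_pow ζ n]
    simp only [map_mul, map_pow, map_neg, map_one]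
    ring

lemma eval_sw (v : ℕ → ℂ) (i : ℕ) (f : MvPolynomial ℕ ℂ) :
    eval v (sw i f) = eval (fun j => v (Equiv.swap i (i + 1) j)) f := by
  rw [sw, eval_rename]; rfl

lemma eval_comp_pinch {ζ : ℂ} (hζ : ζ ^ 2 + ζ + 1 = 0) {n : ℕ} (l : List Bool)
    (h1 : l.count true = n) (h2 : l.count false = n) {v : ℕ → ℂ}
    (hv : v (2 * n) = ζ * v (2 * n + 1)) :
    eval v (comp ζ (n + 1) (l ++ [true, false])) =
      (-ζ) ^ n * (∏ j ∈ Finset.range (2 * n), (v j - ζ ^ 2 * v (2 * n + 1))) *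
        eval v (comp ζ n l) := by
  rw [← eval_pinch hv, pinch_comp hζ l h1 h2]
  simp [map_prod]

/-- Setting the variables `X j`, `N ≤ j`, to zero. -/
def trunc (N : ℕ) : MvPolynomial ℕ ℂ →ₐ[ℂ] MvPolynomial ℕ ℂ :=
  aeval fun j => if j < N then X j else 0

lemma trunc_X {N j : ℕ} (h : j < N) : trunc N (X j) = X j := by simp [trunc, h]

lemma trunc_sw {N i : ℕ} (h : i + 1 < N) (f : MvPolynomial ℕ ℂ) :
    trunc N (sw i f) = sw i (trunc N f) := by
  have : (trunc N).comp (sw i) = (sw i).comp (trunc N) := by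
    apply MvPolynomial.algHom_ext
    intro j
    simp only [AlgHom.comp_apply, sw_X, trunc, aeval_X]
    by_cases hj : j < N
    · rw [if_pos hj, sw_X, if_pos]
      rw [Equiv.swap_apply_def]
      split_ifs <;> omega
    · rw [if_neg hj, map_zero, if_neg]
      rw [Equiv.swap_apply_def]
      split_ifs <;> omega
  exact DFunLike.congr_fun this f

lemma trunc_pairProd (ζ : ℂ) {N n s : ℕ} (h : s + n ≤ N) :
    trunc N (pairProd ζ n s) = pairProd ζ n s := by
  induction n generalizing s with
  | zero => simp [pairProd]
  | succ n ih =>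
    rw [pairProd, map_mul, ih (by omega), map_prod]
    congr 1
    refine Finset.prod_congr rfl fun j hj => ?_
    rw [Finset.mem_Ico] at hj
    rw [map_sub, map_mul, trunc_X (by omega), trunc_X (by omega)]
    simp [trunc]

lemma trunc_comp (ζ : ℂ) {n : ℕ} (l : List Bool) (h1 : l.count true = n) (h2 : l.count false = n) :
    trunc (2 * n) (comp ζ n l) = comp ζ n l := by
  have hl : l.length = 2 * n := by have := count_add_count l; omega
  refine Exch.ext (ζ := ζ) (c := 0) (L := 2 * n) (Φ := fun l => trunc (2 * n) (comp ζ n l))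
    (fun l₁ l₂ hL => ?_) (comp_exch ζ n _) l hl ?_
  · simp only
    rw [comp_exchange, Nat.zero_add]
    exact (heckeOp_map _ (trunc_X (by omega)) (trunc_X (by omega)) (trunc_sw (by omega) _)).symm
  · rw [h1, h2, comp_sorted, baseComp, map_mul, trunc_pairProd _ (by omega),
      trunc_pairProd _ (by omega)]

lemma eval_comp_congr (ζ : ℂ) {n : ℕ} (l : List Bool) (h1 : l.count true = n)
    (h2 : l.count false = n) {v w : ℕ → ℂ} (h : ∀ j < 2 * n, v j = w j) :
    eval v (comp ζ n l) = eval w (comp ζ n l) := by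
  have : ∀ v : ℕ → ℂ, eval v (comp ζ n l) =
      eval (fun j => if j < 2 * n then v j else 0) (comp ζ n l) := by
    intro v
    have e : ((aeval v : MvPolynomial ℕ ℂ →ₐ[ℂ] ℂ).comp (trunc (2 * n))) =
        aeval fun j => if j < 2 * n then v j else 0 := by
      apply MvPolynomial.algHom_ext
      intro j
      simp only [AlgHom.comp_apply, aeval_X, trunc]
      split_ifs <;> simp
    conv_lhs => rw [← trunc_comp ζ l h1 h2]
    exact DFunLike.congr_fun e (comp ζ n l)
  rw [this v, this w]
  congr 2
  funext j
  split_ifs with hj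
  · exact h j hj
  · rfl

lemma eval_upMon (v : ℕ → ℂ) (x : Bool) (l : List Bool) (s : ℕ) :
    eval v (upMon (x :: l) s) = (if x then v s else 1) * eval v (upMon l (s + 1)) := by
  cases x <;> simp [upMon]

lemma eval_upMon_congr (l : List Bool) (s : ℕ) {v w : ℕ → ℂ} (h : ∀ j < s + l.length, v j = w j) :
    eval v (upMon l s) = eval w (upMon l s) := by
  induction l generalizing s with
  | nil => simp [upMon]
  | cons x l ih =>
    simp only [List.length_cons] at h
    rw [eval_upMon, eval_upMon, ih (s + 1) fun j hj => h j (by omega), h s (by omega)]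

lemma eval_term_congr (ζ : ℂ) {n : ℕ} (l : List Bool) {v w : ℕ → ℂ} (h : ∀ j < 2 * n, v j = w j) :
    eval v (term ζ n l) = eval w (term ζ n l) := by
  rw [term]
  split_ifs with hl
  · have hl' : l.length = 2 * n := by have := count_add_count l; omega
    simp only [map_mul]
    rw [eval_comp_congr ζ l hl.1 hl.2 h, eval_comp_congr (ζ ^ 2) l hl.1 hl.2 h,
      eval_upMon_congr l 0 (by simpa [hl'] using h)]
  · simp

lemma eval_sumPoly (ζ : ℂ) (n k M : ℕ) (v : ℕ → ℂ) : eval v (sumPoly ζ n k M) =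
    wsum M fun w => eval v (term ζ n (List.replicate k true ++ w)) :=
  map_wsum (eval v : MvPolynomial ℕ ℂ →+ ℂ) M _

lemma eval_sumPoly_congr (ζ : ℂ) {n k M : ℕ} {v w : ℕ → ℂ} (h : ∀ j < 2 * n, v j = w j) :
    eval v (sumPoly ζ n k M) = eval w (sumPoly ζ n k M) := by
  rw [eval_sumPoly, eval_sumPoly]
  exact wsum_congr fun l _ => eval_term_congr ζ _ h

lemma root_ne {ζ : ℂ} (hζ : ζ ^ 2 + ζ + 1 = 0) : ζ ≠ 0 ∧ ζ - 1 ≠ 0 := by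
  constructor
  · rintro rfl; norm_num at hζ
  · intro h
    rw [sub_eq_zero.mp h] at hζ
    norm_num at hζ

lemma eval_aligned {ζ : ℂ} (hζ : ζ ^ 2 + ζ + 1 = 0) {n : ℕ} (x : Bool) (l : List Bool)
    (hl : l.length = 2 * n) {v : ℕ → ℂ}
    (hv : v (2 * n) = ζ * v (2 * n + 1)) (hv' : v (2 * n + 1) ≠ 0) :
    eval v (term ζ (n + 1) (l ++ [x, x])) = 0 := by
  rw [term]
  split_ifs with h
  · have := congrArg (eval v) (comp_swap_aligned hζ (n + 1) x l [] h.1 h.2)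
    simp only [map_mul, map_sub, eval_C, eval_X, hl, hv] at this
    have h0 : (ζ - 1) * (-ζ ^ 2 * v (2 * n + 1)) * eval v (comp ζ (n + 1) (l ++ [x, x])) = 0 := by
      linear_combination -this - (ζ - 1) * v (2 * n + 1) *
        eval v (comp ζ (n + 1) (l ++ [x, x])) * hζ
    obtain ⟨hz, hz1⟩ := root_ne hζ
    rw [mul_eq_zero] at h0
    rw [map_mul, map_mul, h0.resolve_left (by simp [hz, hz1, hv'])]
    ring
  · simp

lemma eval_term_pinch {ζ : ℂ} (hζ : ζ ^ 2 + ζ + 1 = 0) {n : ℕ} (l : List Bool)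
    (hl : l.length = 2 * n) {v : ℕ → ℂ}
    (hv : v (2 * n) = ζ * v (2 * n + 1)) (hv' : v (2 * n + 1) ≠ 0) :
    eval v (term ζ (n + 1) (l ++ [true, false])) + eval v (term ζ (n + 1) (l ++ [false, true])) =
      -ζ ^ 2 * v (2 * n + 1) * (∏ j ∈ Finset.range (2 * n), (v j - ζ ^ 2 * v (2 * n + 1))) ^ 2 *
        eval v (term ζ n l) := by
  have c1 : (l ++ [true, false]).count true = l.count true + 1 := by simp
  have c2 : (l ++ [true, false]).count false = l.count false + 1 := by simp
  have c3 : (l ++ [false, true]).count true = l.count true + 1 := by simp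
  have c4 : (l ++ [false, true]).count false = l.count false + 1 := by simp
  simp only [term, c1, c2, c3, c4, Nat.add_right_cancel_iff]
  split_ifs with h
  swap
  · simp
  have h1 := congrArg (eval v) (comp_swap_up_down hζ (n + 1) l [])
  have h2 := congrArg (eval v) (comp_swap_up_down (sq_spec hζ) (n + 1) l [])
  have k1 := eval_comp_pinch hζ l h.1 h.2 hv
  set v' : ℕ → ℂ := fun j => v (Equiv.swap (2 * n) (2 * n + 1) j) with hv'd
  have w1 : v' (2 * n) = v (2 * n + 1) := by simp [v']
  have w2 : v' (2 * n + 1) = v (2 * n) := by simp [v']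
  have w3 : ∀ j < 2 * n, v' j = v j := fun j hj => by
    simp only [v']
    rw [Equiv.swap_apply_of_ne_of_ne (by omega) (by omega)]
  have hc := cube_eq_one hζ
  have k2 := eval_comp_pinch (sq_spec hζ) l h.1 h.2 (v := v') (by
    rw [w1, w2, hv]; linear_combination -v (2 * n + 1) * hc)
  rw [eval_comp_congr (ζ ^ 2) l h.1 h.2 w3, w2, Finset.prod_congr rfl fun j hj => by
    rw [w3 j (Finset.mem_range.mp hj), hv, show (ζ ^ 2) ^ 2 * (ζ * v (2 * n + 1)) =
      ζ ^ 2 * v (2 * n + 1) by linear_combination ζ ^ 2 * v (2 * n + 1) * hc]] at k2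
  simp only [hl, map_mul, map_sub, map_add, eval_C, eval_X, map_pow, map_one, eval_sw, hv] at h1 h2
  rw [← hv'd, k2] at h2
  simp only [map_mul, upMon_append, hl, zero_add, upMon, if_true, if_false, Bool.false_eq_true,
    one_mul, mul_one, eval_X, hv]
  rw [k1] at h1 ⊢
  generalize ∏ j ∈ Finset.range (2 * n), (v j - ζ ^ 2 * v (2 * n + 1)) = P at *
  generalize eval v (comp ζ n l) = f at *
  generalize eval v (comp (ζ ^ 2) n l) = f' at *
  generalize eval v (comp ζ (n + 1) (l ++ [false, true])) = w at *
  generalize eval v (comp (ζ ^ 2) (n + 1) (l ++ [true, false])) = u' at *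
  generalize eval v (comp (ζ ^ 2) (n + 1) (l ++ [false, true])) = w' at *
  generalize eval v (upMon l 0) = m at *
  generalize v (2 * n + 1) = t at *
  have hn : (-ζ) ^ n * (-ζ ^ 2) ^ n = 1 := by
    rw [← mul_pow, show -ζ * -ζ ^ 2 = 1 by linear_combination hc, one_pow]
  obtain ⟨hz, hz1⟩ := root_ne hζ
  have hw : w = -ζ ^ 2 * ((-ζ) ^ n * P * f) := by
    refine mul_left_cancel₀ (mul_ne_zero (mul_ne_zero hz1 hv') (pow_ne_zero 2 hz)) ?_
    linear_combination -h1 + (ζ - 1) * t * ζ * ((-ζ) ^ n * P * f) * hc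
  have hw' : (-ζ ^ 2) ^ n * P * f' = w' - ζ ^ 2 * u' := by
    refine mul_left_cancel₀ (mul_ne_zero (mul_ne_zero hz1 hv') hz) ?_
    linear_combination h2 + (ζ - 1) * t * ζ * w' * hc + (ζ - 1) * t * ζ * u' * hζ
  rw [hw]
  linear_combination (-ζ ^ 2 * t * ((-ζ) ^ n * P * f) * m) * (-hw') +
    -ζ ^ 2 * t * P ^ 2 * f * f' * m * hn - ζ * t * (-ζ) ^ n * P * f * u' * m * hc

/-- Wheel recursion of the weighted sum of squares. -/
lemma eval_sumPoly_succ {ζ : ℂ} (hζ : ζ ^ 2 + ζ + 1 = 0) {n k M : ℕ} (hM : k + M = 2 * n)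
    {v : ℕ → ℂ} (hv : v (2 * n) = ζ * v (2 * n + 1)) (hv' : v (2 * n + 1) ≠ 0) :
    eval v (sumPoly ζ (n + 1) k (M + 2)) =
      -ζ ^ 2 * v (2 * n + 1) * (∏ j ∈ Finset.range (2 * n), (v j - ζ ^ 2 * v (2 * n + 1))) ^ 2 *
        eval v (sumPoly ζ n k M) := by
  rw [eval_sumPoly, eval_sumPoly, wsum_add_length, mul_wsum]
  refine wsum_congr fun a ha => ?_
  have hl : (List.replicate k true ++ a).length = 2 * n := by simp [ha, hM]
  simp only [wsum, ← List.append_assoc]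
  rw [← eval_term_pinch hζ _ hl hv hv', eval_aligned hζ true _ hl hv hv',
    eval_aligned hζ false _ hl hv hv']
  ring

end XXZ

namespace XXZ
open MvPolynomial

lemma degreeOf_X_sub_X {i j k : ℕ} (h : i ≠ j) :
    degreeOf k (X i - X j : MvPolynomial ℕ ℂ) = if k = i ∨ k = j then 1 else 0 := by
  split_ifs with hk
  · rcases hk with rfl | rfl
    · rw [sub_eq_add_neg, degreeOf_add_eq_of_degreeOf_lt, degreeOf_X_self]
      rw [degreeOf_neg, degreeOf_X_of_ne h, degreeOf_X_self]
      exact one_pos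
    · rw [sub_eq_add_neg, add_comm, degreeOf_add_eq_of_degreeOf_lt, degreeOf_neg, degreeOf_X_self]
      rw [degreeOf_neg, degreeOf_X_of_ne h.symm, degreeOf_X_self]
      exact one_pos
  · rw [not_or] at hk
    have := degreeOf_sub_le k (X i) (X j : MvPolynomial ℕ ℂ)
    rw [degreeOf_X_of_ne hk.1, degreeOf_X_of_ne hk.2] at this
    simpa using this

lemma degreeOf_sw (i j : ℕ) (f : MvPolynomial ℕ ℂ) :
    degreeOf (Equiv.swap i (i + 1) j) (sw i f) = degreeOf j f :=
  degreeOf_rename_of_injective (Equiv.injective _) j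

lemma degreeOf_heckeOp {ζ : ℂ} {i d : ℕ} {f : MvPolynomial ℕ ℂ}
    (h : ∀ j, degreeOf j f ≤ d) (j : ℕ) :
    degreeOf j (heckeOp ζ i f) ≤ d := by
  by_cases h0 : heckeOp ζ i f = 0
  · rw [h0, degreeOf_zero]; exact Nat.zero_le _
  have hs : degreeOf j (sw i f) ≤ d := by
    have := degreeOf_sw i (Equiv.swap i (i + 1) j) f
    rw [Equiv.swap_apply_self] at this
    rw [this]; exact h _
  have h1 := congrArg (degreeOf j) (heckeOp_spec ζ i f)
  rw [degreeOf_mul_eq (X_sub_X_ne_zero (by omega)) h0, degreeOf_X_sub_X (by omega)] at h1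
  have hlin : degreeOf j (C ζ * X (i + 1) - X i : MvPolynomial ℕ ℂ) ≤
      if j = i ∨ j = i + 1 then 1 else 0 := by
    refine (degreeOf_sub_le _ _ _).trans (max_le ((degreeOf_C_mul_le _ _ _).trans ?_) ?_)
    · rw [degreeOf_X]; split_ifs <;> simp_all
    · rw [degreeOf_X]; split_ifs <;> simp_all
  have hX : degreeOf j (X i : MvPolynomial ℕ ℂ) ≤ if j = i ∨ j = i + 1 then 1 else 0 := by
    rw [degreeOf_X]; split_ifs <;> simp_all
  have h2 : degreeOf j (C ζ * ((C ζ * X (i + 1) - X i) * sw i f - (C ζ - 1) * X i * f)) ≤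
      (if j = i ∨ j = i + 1 then 1 else 0) + d := by
    refine (degreeOf_C_mul_le _ _ _).trans ((degreeOf_sub_le _ _ _).trans (max_le ?_ ?_))
    · exact (degreeOf_mul_le _ _ _).trans (add_le_add hlin hs)
    · refine (degreeOf_mul_le _ _ _).trans (add_le_add ?_ (h j))
      rw [← map_one C, ← map_sub]
      exact (degreeOf_C_mul_le _ _ _).trans hX
  omega

lemma degreeOf_pairProd (ζ : ℂ) (n s j : ℕ) :
    degreeOf j (pairProd ζ n s) ≤ if s ≤ j ∧ j < s + n then n - 1 else 0 := by
  induction n generalizing s with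
  | zero => simp [pairProd]
  | succ n ih =>
    rw [pairProd]
    refine (degreeOf_mul_le _ _ _).trans ?_
    have h1 := ih (s + 1)
    have h2 : degreeOf j (∏ m ∈ Finset.Ico (s + 1) (s + 1 + n),
        (C ζ * X m - X s : MvPolynomial ℕ ℂ)) ≤
        ∑ m ∈ Finset.Ico (s + 1) (s + 1 + n), if j = s then 1 else if j = m then 1 else 0 := by
      refine (degreeOf_prod_le _ _ _).trans (Finset.sum_le_sum fun m hm => ?_)
      rw [Finset.mem_Ico] at hm
      refine (degreeOf_sub_le _ _ _).trans (max_le ((degreeOf_C_mul_le _ _ _).trans ?_) ?_)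
      · rw [degreeOf_X]; split_ifs <;> omega
      · rw [degreeOf_X]; split_ifs <;> omega
    by_cases hj : j = s
    · subst hj
      simp only [if_true, Finset.sum_const, Nat.card_Ico, smul_eq_mul, mul_one] at h2
      rw [if_neg (by omega)] at h1
      rw [if_pos (by omega)]
      omega
    · simp only [if_neg hj, Finset.sum_ite_eq, Finset.mem_Ico] at h2
      by_cases hj2 : s + 1 ≤ j ∧ j < s + 1 + n
      · rw [if_pos hj2] at h1 h2
        rw [if_pos (by omega)]
        omega
      · rw [if_neg hj2] at h1 h2
        omega

lemma degreeOf_comp (ζ : ℂ) {n : ℕ} (l : List Bool) (h1 : l.count true = n)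
    (h2 : l.count false = n) (j : ℕ) : degreeOf j (comp ζ n l) ≤ n - 1 := by
  revert j
  refine sort_induction (Q := fun l => ∀ j, degreeOf j (comp ζ n l) ≤ n - 1) (fun l₁ l₂ h j => ?_) l
    fun j => ?_
  · rw [comp_exchange]
    exact degreeOf_heckeOp h j
  · rw [h1, h2, comp_sorted, baseComp]
    have a := degreeOf_pairProd ζ n 0 j
    have b := degreeOf_pairProd ζ n n j
    refine (degreeOf_mul_le _ _ _).trans ?_
    split_ifs at a b <;> omega

lemma degreeOf_upMon (l : List Bool) (s j : ℕ) :
    degreeOf j (upMon l s) ≤ if s ≤ j then 1 else 0 := by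
  induction l generalizing s with
  | nil => simp [upMon]
  | cons x l ih =>
    rw [upMon]
    refine (degreeOf_mul_le _ _ _).trans ?_
    have := ih (s + 1)
    have h2 : degreeOf j (if x then X s else 1 : MvPolynomial ℕ ℂ) ≤ if j = s then 1 else 0 := by
      cases x
      · simp
      · simp [degreeOf_X]
    split_ifs at this h2 ⊢ <;> omega

lemma degreeOf_term (ζ : ℂ) {n : ℕ} (hn : 1 ≤ n) (l : List Bool) (j : ℕ) :
    degreeOf j (term ζ n l) ≤ 2 * n - 1 := by
  rw [term]
  split_ifs with h
  · refine (degreeOf_mul_le _ _ _).trans ?_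
    have h1 := degreeOf_mul_le j (comp ζ n l) (comp (ζ ^ 2) n l)
    have h2 := degreeOf_comp ζ l h.1 h.2 j
    have h3 := degreeOf_comp (ζ ^ 2) l h.1 h.2 j
    have h4 := degreeOf_upMon l 0 j
    split_ifs at h4 <;> omega
  · rw [degreeOf_zero]; exact Nat.zero_le _

lemma degreeOf_wsum {j d : ℕ} (M : ℕ) (g : List Bool → MvPolynomial ℕ ℂ)
    (h : ∀ l, degreeOf j (g l) ≤ d) : degreeOf j (wsum M g) ≤ d := by
  induction M generalizing g with
  | zero => exact h _
  | succ M ih =>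
    exact (degreeOf_add_le _ _ _).trans (max_le (ih _ fun l => h _) (ih _ fun l => h _))

lemma degreeOf_sumPoly (ζ : ℂ) {n : ℕ} (hn : 1 ≤ n) (k M j : ℕ) :
    degreeOf j (sumPoly ζ n k M) ≤ 2 * n - 1 :=
  degreeOf_wsum M _ fun _ => degreeOf_term ζ hn _ j

lemma natDegree_aeval_le {f : MvPolynomial ℕ ℂ} {j d : ℕ} (h : degreeOf j f ≤ d)
    {w : ℕ → Polynomial ℂ} (hw : (w j).natDegree ≤ 1) (hw' : ∀ i, i ≠ j → (w i).natDegree = 0) :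
    (aeval w f).natDegree ≤ d := by
  rw [aeval_def, eval₂_eq]
  refine Polynomial.natDegree_sum_le_of_forall_le _ _ fun m hm => ?_
  refine (Polynomial.natDegree_mul_le).trans ?_
  have h1 : (algebraMap ℂ (Polynomial ℂ) (coeff m f)).natDegree = 0 := Polynomial.natDegree_C _
  rw [h1, zero_add]
  refine (Polynomial.natDegree_prod_le _ _).trans ?_
  have h2 : ∀ i ∈ m.support, (w i ^ m i).natDegree ≤ if i = j then m j else 0 := by
    intro i _
    refine (Polynomial.natDegree_pow_le).trans ?_
    split_ifs with hi
    · subst hi; nlinarith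
    · rw [hw' i hi, mul_zero]
  refine (Finset.sum_le_sum h2).trans ?_
  rw [Finset.sum_ite_eq']
  have h3 := monomial_le_degreeOf j hm
  split_ifs <;> omega

end XXZ

namespace XXZ
open MvPolynomial

/-- The sequence `1, …, 1, y₀, …, y_{M-1}, 0, 0, …` starting with `k` ones. -/
def pt {A : Type*} [Zero A] [One A] (k : ℕ) {M : ℕ} (y : Fin M → A) (i : ℕ) : A :=
  if i < k then 1 else if h : i - k < M then y ⟨i - k, h⟩ else 0

lemma pt_of_lt {A : Type*} [Zero A] [One A] {k M i : ℕ} (y : Fin M → A) (h : i < k) :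
    pt k y i = 1 := if_pos h

lemma pt_add {A : Type*} [Zero A] [One A] (k : ℕ) {M : ℕ} (y : Fin M → A) (m : Fin M) :
    pt k y (k + m) = y m := by
  rw [pt, if_neg (by omega), dif_pos (by omega)]
  congr 1
  ext
  simp

lemma pt_of_le {A : Type*} [Zero A] [One A] {k M i : ℕ} (y : Fin M → A) (h : k + M ≤ i) :
    pt k y i = 0 := by
  rw [pt, if_neg (by omega), dif_neg (by omega)]

lemma map_pt {A B : Type*} [Semiring A] [Semiring B] (φ : A →+* B) (k : ℕ) {M : ℕ} (y : Fin M → A)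
    (i : ℕ) : φ (pt k y i) = pt k (fun m => φ (y m)) i := by
  unfold pt
  split_ifs <;> simp

lemma prod_pt {A B : Type*} [Zero A] [One A] [CommMonoid B] (k : ℕ) {M : ℕ} (y : Fin M → A)
    (f : A → B) : ∏ j ∈ Finset.range (k + M), f (pt k y j) = f 1 ^ k * ∏ m, f (y m) := by
  rw [Finset.prod_range_add, Finset.prod_congr rfl fun j hj => by
    rw [pt_of_lt y (Finset.mem_range.mp hj)], Finset.prod_const, Finset.card_range,
    Finset.prod_range]
  simp_rw [pt_add]

/-- The weighted sum of squares with `k` variables specialized to one. -/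
def sumFun (ζ : ℂ) (n k : ℕ) {M : ℕ} (y : Fin M → ℂ) : ℂ := eval (pt k y) (sumPoly ζ n k M)

lemma continuous_sumFun (ζ : ℂ) (n k M : ℕ) :
    Continuous (sumFun ζ n k : (Fin M → ℂ) → ℂ) := by
  refine (MvPolynomial.continuous_eval _).comp (continuous_pi fun i => ?_)
  unfold pt
  split_ifs <;> fun_prop

lemma sumFun_comp_swap {ζ : ℂ} (hζ : ζ ^ 2 + ζ + 1 = 0) {n k M : ℕ} (y : Fin (M + 1) → ℂ)
    (i : Fin M) : sumFun ζ n k (y ∘ Equiv.swap i.castSucc i.succ) = sumFun ζ n k y := by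
  rw [sumFun, sumFun, ← sw_sumPoly hζ (show k ≤ k + i by omega)
      (show k + i + 1 < k + (M + 1) by omega),
    eval_sw, sw_sumPoly hζ (show k ≤ k + i by omega) (show k + i + 1 < k + (M + 1) by omega)]
  congr 2
  funext j
  rcases lt_or_ge j k with hj | hj
  · rw [pt_of_lt _ hj, Equiv.swap_apply_of_ne_of_ne (by omega) (by omega), pt_of_lt _ hj]
  rcases lt_or_ge j (k + (M + 1)) with hj2 | hj2
  · obtain ⟨m, rfl⟩ : ∃ m : Fin (M + 1), j = k + m := ⟨⟨j - k, by omega⟩, by simp; omega⟩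
    rw [pt_add]
    have : Equiv.swap (k + (i : ℕ)) (k + i + 1) (k + m) =
        k + (Equiv.swap i.castSucc i.succ m : Fin (M + 1)) := by
      simp only [Equiv.swap_apply_def, Fin.ext_iff, Fin.val_castSucc, Fin.val_succ]
      split_ifs <;> (try simp only [Fin.val_castSucc, Fin.val_succ]) <;> omega
    rw [this, pt_add, Function.comp_apply, Equiv.swap_apply_self]
  · rw [pt_of_le _ hj2, Equiv.swap_apply_of_ne_of_ne (by omega) (by omega), pt_of_le _ hj2]

lemma sumFun_comp_perm {ζ : ℂ} (hζ : ζ ^ 2 + ζ + 1 = 0) {n k M : ℕ} (y : Fin M → ℂ)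
    (σ : Equiv.Perm (Fin M)) : sumFun ζ n k (y ∘ σ) = sumFun ζ n k y := by
  obtain _ | M := M
  · rw [Subsingleton.elim σ 1]; rfl
  have h : σ ∈ Submonoid.closure (Set.range fun i : Fin M ↦ Equiv.swap i.castSucc i.succ) := by
    rw [Equiv.Perm.mclosure_swap_castSucc_succ]; trivial
  induction h using Submonoid.closure_induction generalizing y with
  | mem x hx =>
    obtain ⟨i, rfl⟩ := hx
    exact sumFun_comp_swap hζ y i
  | one => rfl
  | mul a b _ _ ha hb =>
    rw [Equiv.Perm.coe_mul, ← Function.comp_assoc, hb, ha]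

lemma sumFun_snoc {ζ : ℂ} (hζ : ζ ^ 2 + ζ + 1 = 0) {n k M : ℕ} (hM : k + M = 2 * n)
    (y : Fin M → ℂ) {t : ℂ} (ht : t ≠ 0) :
    sumFun ζ (n + 1) k (Fin.snoc (Fin.snoc y (ζ * t) : Fin (M + 1) → ℂ) t : Fin (M + 2) → ℂ) =
      -ζ ^ 2 * t * ((1 - ζ ^ 2 * t) ^ k * ∏ m, (y m - ζ ^ 2 * t)) ^ 2 * sumFun ζ n k y := by
  set Y : Fin (M + 2) → ℂ := Fin.snoc (Fin.snoc y (ζ * t) : Fin (M + 1) → ℂ) t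
  have h1 : pt k Y (2 * n + 1) = t := by
    have := pt_add k Y (Fin.last (M + 1))
    rw [Fin.val_last, show k + (M + 1) = 2 * n + 1 by omega] at this
    rw [this]; simp [Y]
  have h2 : pt k Y (2 * n) = ζ * t := by
    have := pt_add k Y (Fin.last M).castSucc
    rw [Fin.val_castSucc, Fin.val_last, hM] at this
    rw [this]; simp [Y]
  have h3 : ∀ j < 2 * n, pt k Y j = pt k y j := by
    intro j hj
    rcases lt_or_ge j k with hk | hk
    · rw [pt_of_lt _ hk, pt_of_lt _ hk]
    · obtain ⟨m, rfl⟩ : ∃ m : Fin M, j = k + m := ⟨⟨j - k, by omega⟩, by simp; omega⟩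
      have := pt_add k Y m.castSucc.castSucc
      simp only [Fin.val_castSucc] at this
      rw [this, pt_add]; simp [Y]
  have h := eval_sumPoly_succ hζ hM (v := pt k Y) (by rw [h1, h2]) (by rwa [h1])
  rw [sumFun, h, h1, eval_sumPoly_congr ζ h3, Finset.prod_congr rfl fun j hj => by
    rw [h3 j (Finset.mem_range.mp hj)], ← hM, prod_pt k y fun z => z - ζ ^ 2 * t]
  rfl

lemma eval_pairProd (ζ : ℂ) (n s : ℕ) (v : ℕ → ℂ) : eval v (pairProd ζ n s) =
    ∏ i : Fin n, ∏ j ∈ Finset.Ioi i, (ζ * v (s + j) - v (s + i)) := by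
  induction n generalizing s with
  | zero => simp [pairProd]
  | succ n ih =>
    rw [pairProd, map_mul, ih, Fin.prod_univ_succ, Fin.prod_Ioi_zero, map_prod,
      Finset.prod_Ico_eq_prod_range, Nat.add_sub_cancel_left, Finset.prod_range]
    congr 1
    · refine Finset.prod_congr rfl fun j _ => ?_
      simp [Nat.add_assoc, Nat.add_comm 1]
    · refine Finset.prod_congr rfl fun i _ => ?_
      rw [Fin.prod_Ioi_succ]
      refine Finset.prod_congr rfl fun j _ => ?_
      simp [Nat.add_assoc, Nat.add_comm 1]

lemma prod_Ioi_const {A : Type*} [CommMonoid A] (c : A) (n : ℕ) :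
    ∏ i : Fin n, ∏ _j ∈ Finset.Ioi i, c = c ^ n.choose 2 := by
  induction n with
  | zero => simp
  | succ n ih =>
    rw [Fin.prod_univ_succ, Fin.prod_Ioi_zero]
    simp_rw [Fin.prod_Ioi_succ]
    rw [ih, Finset.prod_const, Finset.card_univ, Fintype.card_fin, ← pow_add,
      Nat.choose_succ_succ' n 1, Nat.choose_one_right]

lemma wsum_eq_single {A : Type*} [AddCommMonoid A] (L : ℕ) (g : List Bool → A)
    (h : ∀ l, l.length = L → l ≠ List.replicate L false → g l = 0) :
    wsum L g = g (List.replicate L false) := by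
  induction L generalizing g with
  | zero => rfl
  | succ L ih =>
    rw [wsum, ih (fun l => g (false :: l)), wsum_congr (g' := fun _ => 0), wsum_zero, zero_add]
    · rfl
    · intro l hl
      exact h _ (by simp [hl]) (by simp [List.replicate_succ])
    · intro l hl hl2
      exact h _ (by simp [hl]) (by simpa [List.replicate_succ] using hl2)

lemma eval_upMon_replicate_false (v : ℕ → ℂ) (m s : ℕ) :
    eval v (upMon (List.replicate m false) s) = 1 := by
  induction m generalizing s with
  | zero => simp [upMon]
  | succ m ih => rw [List.replicate_succ, eval_upMon, ih]; simp

lemma eval_upMon_eq_one {v : ℕ → ℂ} (l : List Bool) (s : ℕ) (h : ∀ j < s + l.length, v j = 1) :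
    eval v (upMon l s) = 1 := by
  induction l generalizing s with
  | nil => simp [upMon]
  | cons x l ih =>
    simp only [List.length_cons] at h
    rw [eval_upMon, ih (s + 1) fun j hj => h j (by omega), h s (by omega)]
    simp

lemma eval_upMon_sorted (n k : ℕ) (y : Fin k → ℂ) : eval (pt n y) (upMon (sorted n k) 0) = 1 := by
  rw [sorted, upMon_append, map_mul, eval_upMon_replicate_false, mul_one]
  exact eval_upMon_eq_one _ _ fun j hj => pt_of_lt y (by simpa using hj)

lemma sumFun_base {ζ : ℂ} (hζ : ζ ^ 2 + ζ + 1 = 0) (n : ℕ) (y : Fin n → ℂ) :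
    sumFun ζ n n y * (Matrix.vandermonde y).det =
      3 ^ n.choose 2 * (Matrix.vandermonde fun i => y i ^ 3).det := by
  rw [sumFun, eval_sumPoly, wsum_eq_single]
  swap
  · intro l hl hl2
    rw [term, if_neg, map_zero]
    rintro ⟨h, -⟩
    have h0 : l.count true = 0 := by simpa using h
    refine hl2 (List.eq_replicate_iff.mpr ⟨hl, fun b hb => ?_⟩)
    cases b
    · rfl
    · exact absurd hb (List.count_eq_zero.mp h0)
  rw [show List.replicate n true ++ List.replicate n false = sorted n n from rfl, term,
    if_pos ⟨count_true_sorted n n, count_false_sorted n n⟩, map_mul, map_mul, eval_upMon_sorted,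
    comp_sorted, comp_sorted, baseComp, baseComp, map_mul, map_mul, Matrix.det_vandermonde,
    Matrix.det_vandermonde]
  simp only [eval_pairProd, pt_add]
  have e1 : ∀ ζ : ℂ, ∏ i : Fin n, ∏ j ∈ Finset.Ioi i, (ζ * pt n y (0 + j) - pt n y (0 + i)) =
      (ζ - 1) ^ n.choose 2 := fun ζ => by
    rw [← prod_Ioi_const]
    refine Finset.prod_congr rfl fun i _ => Finset.prod_congr rfl fun j _ => ?_
    rw [pt_of_lt y (by omega), pt_of_lt y (by omega), mul_one]
  rw [e1, e1, ← show (ζ - 1) * (ζ ^ 2 - 1) = 3 by linear_combination (ζ - 2) * hζ, mul_pow]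
  have e2 : (∏ i : Fin n, ∏ j ∈ Finset.Ioi i, (ζ * y j - y i)) *
      (∏ i : Fin n, ∏ j ∈ Finset.Ioi i, (ζ ^ 2 * y j - y i)) *
      (∏ i : Fin n, ∏ j ∈ Finset.Ioi i, (y j - y i)) =
      ∏ i : Fin n, ∏ j ∈ Finset.Ioi i, (y j ^ 3 - y i ^ 3) := by
    simp only [← Finset.prod_mul_distrib]
    refine Finset.prod_congr rfl fun i _ => Finset.prod_congr rfl fun j _ => ?_
    linear_combination ((ζ - 1) * y j ^ 3 - (ζ - 1) * 0 - y j ^ 2 * y i * (ζ - 1) -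
        y j * y i * (y j - y i)) * hζ
  linear_combination (ζ - 1) ^ n.choose 2 * (ζ ^ 2 - 1) ^ n.choose 2 * e2

/-- `sumFun` as a polynomial in its first variable. -/
lemma exists_sumFun_cons (ζ : ℂ) {n : ℕ} (hn : 1 ≤ n) (k : ℕ) {M : ℕ} (y : Fin M → ℂ) :
    ∃ Q : Polynomial ℂ, Q.natDegree ≤ 2 * n - 1 ∧
      ∀ z, Q.eval z = sumFun ζ n k (Fin.cons z y : Fin (M + 1) → ℂ) := by
  refine ⟨aeval (pt k (Fin.cons Polynomial.X fun i => Polynomial.C (y i) :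
    Fin (M + 1) → Polynomial ℂ)) (sumPoly ζ n k (M + 1)), ?_, fun z => ?_⟩
  · refine natDegree_aeval_le (degreeOf_sumPoly ζ hn k (M + 1) k) ?_ fun i hi => ?_
    · have := pt_add k (Fin.cons Polynomial.X fun i => Polynomial.C (y i) :
        Fin (M + 1) → Polynomial ℂ) 0
      rw [Fin.val_zero, add_zero] at this
      rw [this, Fin.cons_zero]
      exact Polynomial.natDegree_X_le
    · rw [pt]
      split_ifs with h1 h2
      · exact Polynomial.natDegree_one
      · obtain ⟨m, hm⟩ : ∃ m : Fin M, (⟨i - k, h2⟩ : Fin (M + 1)) = m.succ :=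
          ⟨⟨i - k - 1, by omega⟩, by ext; simp; omega⟩
        rw [hm, Fin.cons_succ]
        exact Polynomial.natDegree_C _
      · exact Polynomial.natDegree_zero
  · have h : ((Polynomial.aeval z : Polynomial ℂ →ₐ[ℂ] ℂ).comp
        (aeval (pt k (Fin.cons Polynomial.X fun i => Polynomial.C (y i) :
          Fin (M + 1) → Polynomial ℂ)))) = aeval (pt k (Fin.cons z y : Fin (M + 1) → ℂ)) := by
      refine MvPolynomial.algHom_ext fun i => ?_
      rw [AlgHom.comp_apply, aeval_X, aeval_X, ← AlgHom.coe_toRingHom, map_pt]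
      congr 1
      funext m
      refine Fin.cases ?_ (fun m => ?_) m <;> simp
    have h2 := DFunLike.congr_fun h (sumPoly ζ n k (M + 1))
    rw [AlgHom.comp_apply, Polynomial.coe_aeval_eq_eval] at h2
    rw [sumFun, ← MvPolynomial.coe_aeval_eq_eval]
    exact h2

end XXZ

namespace XXZ
open Polynomial

lemma colPoly_inr_eval {A : Type*} [CommRing A] (ζ : A) {n r M : ℕ} (k : ℕ) (y : Fin M → A)
    (b : Fin r) (z : A) : (colPoly ζ k (rootPoly y) (.inr b : Fin n ⊕ Fin r)).eval z =
      z ^ (b : ℕ) * ((ζ * z - 1) ^ (2 * k) * ∏ m, (ζ * z - y m)) := by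
  simp [colPoly, rootPoly, eval_comp, eval_prod]

lemma colMat_map {A B : Type*} [CommRing A] [CommRing B] (φ : A →+* B) (ζ : A) {n r M : ℕ} (k : ℕ)
    (e : Fin M ≃ Fin n ⊕ Fin r) (y : Fin M → A) :
    (colMat ζ k e y).map φ = colMat (φ ζ) k e fun i => φ (y i) := by
  ext m j
  simp only [colMat, Matrix.map_apply, Matrix.of_apply]
  rw [← eval₂_at_apply, ← eval_map, colPoly_map, rootPoly_map]

lemma colMat_comp_perm {A : Type*} [CommRing A] (ζ : A) {n r M : ℕ} (k : ℕ)
    (e : Fin M ≃ Fin n ⊕ Fin r) (y : Fin M → A) (σ : Equiv.Perm (Fin M)) :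
    (colMat ζ k e (y ∘ σ)).det = Equiv.Perm.sign σ * (colMat ζ k e y).det := by
  rw [← Matrix.det_permute]
  congr 1
  ext i j
  have : rootPoly (y ∘ σ) = rootPoly y := Equiv.prod_comp σ fun i => X - C (y i)
  simp [colMat, this]

lemma vandermonde_comp_perm {A : Type*} [CommRing A] {M : ℕ} (y : Fin M → A)
    (σ : Equiv.Perm (Fin M)) : (Matrix.vandermonde (y ∘ σ)).det =
      Equiv.Perm.sign σ * (Matrix.vandermonde y).det := by
  rw [← Matrix.det_permute]
  rfl

lemma vandermonde_snoc {A : Type*} [CommRing A] {M : ℕ} (y : Fin M → A) (a : A) :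
    (Matrix.vandermonde (Fin.snoc y a : Fin (M + 1) → A)).det =
      (Matrix.vandermonde y).det * ∏ m, (a - y m) := by
  have h : ∀ (N : ℕ) (v : Fin N → A), (Matrix.vandermonde v).det =
      ∏ j, ∏ i ∈ Finset.Iio j, (v j - v i) := fun N v => by
    rw [Matrix.det_vandermonde]
    exact Finset.prod_comm' fun x y => by simp
  rw [h, h, Fin.prod_univ_castSucc]
  congr 1
  · refine Finset.prod_congr rfl fun j _ => ?_
    rw [Fin.prod_Iio_castSucc]
    simp
  · rw [Fin.Iio_last_eq_map, Finset.prod_map]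
    simp

/-- Columns of the enlarged determinant: the old ones shifted by one, plus the two first ones. -/
def growCol {n r : ℕ} : (Fin n ⊕ Fin r) ⊕ Fin 2 → Fin (n + 1) ⊕ Fin (r + 1)
  | .inl (.inl j) => .inl j.succ
  | .inl (.inr b) => .inr b.succ
  | .inr i => if i = 0 then .inr 0 else .inl 0

lemma growCol_bijective (n r : ℕ) : Function.Bijective (growCol (n := n) (r := r)) := by
  rw [Fintype.bijective_iff_injective_and_card]
  constructor
  · rintro ((j | b) | i) ((j' | b') | i') h <;> simp only [growCol] at h
    · simpa using h
    · simp at h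
    · split_ifs at h; simp [Fin.ext_iff] at h
    · simp at h
    · simpa using h
    · split_ifs at h; simp [Fin.ext_iff] at h
    · split_ifs at h; simp [Fin.ext_iff] at h
    · split_ifs at h; simp [Fin.ext_iff] at h
    · congr 1
      fin_cases i <;> fin_cases i' <;> simp_all
  · simp; omega

/-- The column labelling of the enlarged determinant. -/
def growEquiv {n r M : ℕ} (e : Fin M ≃ Fin n ⊕ Fin r) : Fin M ⊕ Fin 2 ≃ Fin (n + 1) ⊕ Fin (r + 1) :=
  (Equiv.sumCongr e (Equiv.refl _)).trans (Equiv.ofBijective _ (growCol_bijective n r))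

/-- Unipotent bidiagonal matrix. -/
def bidiag (c : ℂ) (n : ℕ) : Matrix (Fin (n + 1)) (Fin (n + 1)) ℂ :=
  Matrix.of fun i j => (if i = j then 1 else 0) - if (i : ℕ) + 1 = j then c else 0

lemma bidiag_det (c : ℂ) (n : ℕ) : (bidiag c n).det = 1 := by
  rw [Matrix.det_of_isUpperTriangular]
  · refine Finset.prod_eq_one fun i _ => ?_
    simp [bidiag]
  · intro i j hij
    have hij : j < i := hij
    have h2 : (j : ℕ) < i := hij
    simp only [bidiag, Matrix.of_apply]
    rw [if_neg hij.ne', if_neg (by omega), sub_zero]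

lemma sum_mul_bidiag_zero (c : ℂ) (n : ℕ) (g : Fin (n + 1) → ℂ) :
    ∑ i, g i * bidiag c n i 0 = g 0 := by
  simp [bidiag]

lemma sum_mul_bidiag_succ (c : ℂ) (n : ℕ) (g : Fin (n + 1) → ℂ) (j : Fin n) :
    ∑ i, g i * bidiag c n i j.succ = g j.succ - c * g j.castSucc := by
  have : ∀ i : Fin (n + 1), g i * bidiag c n i j.succ = (if i = j.succ then g i else 0) -
      if i = j.castSucc then c * g i else 0 := fun i => by
    have h : (i : ℕ) + 1 = (j.succ : Fin (n + 1)) ↔ i = j.castSucc := by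
      simp [Fin.ext_iff]
    simp only [bidiag, Matrix.of_apply, h]
    split_ifs <;> ring
  simp only [this, Finset.sum_sub_distrib, Finset.sum_ite_eq', Finset.mem_univ, if_true]

/-- The factor relating consecutive determinants. -/
def growFactor (ζ : ℂ) (k r : ℕ) {M : ℕ} (y : Fin M → ℂ) (t : ℂ) : ℂ :=
  ((ζ ^ 2 * t - 1) ^ (2 * k) * ((∏ m, (ζ ^ 2 * t - y m)) * (3 * ζ * t ^ 2))) *
    ((∏ m, (y m ^ 3 - t ^ 3)) * (ζ ^ 2) ^ r)

lemma colMat_snoc {ζ : ℂ} (hζ : ζ ^ 2 + ζ + 1 = 0) {n r M : ℕ} (k : ℕ) (e : Fin M ≃ Fin n ⊕ Fin r)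
    (y : Fin M → ℂ) (t : ℂ) :
    (colMat ζ k (finSumFinEquiv.symm.trans (growEquiv e))
      (Fin.snoc (Fin.snoc y (ζ * t) : Fin (M + 1) → ℂ) t : Fin (M + 2) → ℂ)).det =
      growFactor ζ k r y t * (colMat ζ k e y).det := by
  set Y : Fin (M + 2) → ℂ := Fin.snoc (Fin.snoc y (ζ * t) : Fin (M + 1) → ℂ) t
  have h3 := cube_eq_one hζ
  have hY1 : ∀ m : Fin M, Y (finSumFinEquiv (.inl m : Fin M ⊕ Fin 2)) = y m := fun m => by
    have : (finSumFinEquiv (.inl m : Fin M ⊕ Fin 2)) = m.castSucc.castSucc := by ext; simp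
    rw [this]; simp [Y]
  have hY2 : Y (finSumFinEquiv (.inr 0 : Fin M ⊕ Fin 2)) = ζ * t := by
    have : (finSumFinEquiv (.inr 0 : Fin M ⊕ Fin 2)) = (Fin.last M).castSucc := by ext; simp
    rw [this]; simp [Y]
  have hY3 : Y (finSumFinEquiv (.inr 1 : Fin M ⊕ Fin 2)) = t := by
    have : (finSumFinEquiv (.inr 1 : Fin M ⊕ Fin 2)) = Fin.last (M + 1) := by ext; simp
    rw [this]; simp [Y]
  have hP : ∀ z : ℂ, ∏ m, (z - Y m) = (∏ m, (z - y m)) * (z - ζ * t) * (z - t) := fun z => by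
    rw [Fin.prod_univ_castSucc, Fin.prod_univ_castSucc]
    simp [Y]
  set L : Matrix (Fin (n + 1) ⊕ Fin (r + 1)) (Fin (n + 1) ⊕ Fin (r + 1)) ℂ :=
    Matrix.fromBlocks (bidiag (t ^ 3) n) 0 0 (bidiag (ζ * t) r)
  have hL : L.det = 1 := by
    rw [Matrix.det_fromBlocks_zero₂₁, bidiag_det, bidiag_det, one_mul]
  set A := (colMat ζ k (finSumFinEquiv.symm.trans (growEquiv e)) Y).submatrix
    (finSumFinEquiv (m := M) (n := 2)) finSumFinEquiv
  have hA : A.det = (colMat ζ k (finSumFinEquiv.symm.trans (growEquiv e)) Y).det :=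
    Matrix.det_submatrix_equiv_self _ _
  have hAL : ∀ i j, (A * L.submatrix (growEquiv e) (growEquiv e)) i j =
      ∑ s, (colPoly ζ k (rootPoly Y) s).eval (Y (finSumFinEquiv i)) * L s (growEquiv e j) := by
    intro i j
    rw [Matrix.mul_apply, ← Equiv.sum_comp (growEquiv e)]
    refine Finset.sum_congr rfl fun s _ => ?_
    simp [A, colMat]
  have hcol_inl : ∀ (z : ℂ) (j : Fin n), ∑ s, (colPoly ζ k (rootPoly Y) s).eval z *
      L s (.inl j.succ) = (z ^ 3 - t ^ 3) * z ^ (3 * (j : ℕ)) := by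
    intro z j
    rw [Fintype.sum_sum_type]
    simp only [L, Matrix.fromBlocks_apply₁₁, Matrix.fromBlocks_apply₂₁, Matrix.zero_apply,
      mul_zero, Finset.sum_const_zero, add_zero]
    rw [sum_mul_bidiag_succ]
    simp [colPoly]
    ring
  have hcol_inr : ∀ (z : ℂ) (b : Fin r), ∑ s, (colPoly ζ k (rootPoly Y) s).eval z *
      L s (.inr b.succ) = (z ^ 3 - t ^ 3) * (ζ ^ 2 *
        (z ^ (b : ℕ) * ((ζ * z - 1) ^ (2 * k) * ∏ m, (ζ * z - y m)))) := by
    intro z b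
    rw [Fintype.sum_sum_type]
    simp only [L, Matrix.fromBlocks_apply₁₂, Matrix.fromBlocks_apply₂₂, Matrix.zero_apply,
      mul_zero, Finset.sum_const_zero, zero_add]
    rw [sum_mul_bidiag_succ, colPoly_inr_eval, colPoly_inr_eval, hP, Fin.val_succ, Fin.val_castSucc]
    have : (z - ζ * t) * ((ζ * z - ζ * t) * (ζ * z - t)) = ζ ^ 2 * (z ^ 3 - t ^ 3) := by
      linear_combination (-(z - t) * z * t * ζ) * hζ
    linear_combination (z ^ (b : ℕ) * ((ζ * z - 1) ^ (2 * k) * ∏ m, (ζ * z - y m))) * this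
  have hcol_inr0 : ∀ (z : ℂ), ∑ s, (colPoly ζ k (rootPoly Y) s).eval z *
      L s (.inr 0) = (ζ * z - 1) ^ (2 * k) *
          ((∏ m, (ζ * z - y m)) * (ζ * z - ζ * t) * (ζ * z - t)) := by
    intro z
    rw [Fintype.sum_sum_type]
    simp only [L, Matrix.fromBlocks_apply₁₂, Matrix.fromBlocks_apply₂₂, Matrix.zero_apply,
      mul_zero, Finset.sum_const_zero, zero_add]
    rw [sum_mul_bidiag_zero, colPoly_inr_eval, hP]
    simp
  have hcol_inl0 : ∀ (z : ℂ), ∑ s, (colPoly ζ k (rootPoly Y) s).eval z * L s (.inl 0) = 1 := by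
    intro z
    rw [Fintype.sum_sum_type]
    simp only [L, Matrix.fromBlocks_apply₁₁, Matrix.fromBlocks_apply₂₁, Matrix.zero_apply,
      mul_zero, Finset.sum_const_zero, add_zero]
    rw [sum_mul_bidiag_zero]
    simp [colPoly]
  have hcol : ∀ (z : ℂ) (j : Fin M), ∑ s, (colPoly ζ k (rootPoly Y) s).eval z *
      L s (growEquiv e (.inl j)) = (z ^ 3 - t ^ 3) * (Sum.elim (fun _ => 1) (fun _ => ζ ^ 2) (e j) *
        (colPoly ζ k (rootPoly y) (e j)).eval z) := by
    intro z j
    rcases h : e j with a | b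
    · have : growEquiv e (.inl j) = .inl a.succ := by simp [growEquiv, h, growCol]
      rw [this, hcol_inl]; simp [colPoly]
    · have : growEquiv e (.inl j) = .inr b.succ := by simp [growEquiv, h, growCol]
      rw [this, hcol_inr, colPoly_inr_eval]; simp
  have g0 : growEquiv e (.inr 0) = .inr 0 := by simp [growEquiv, growCol]
  have g1 : growEquiv e (.inr 1) = .inl 0 := by simp [growEquiv, growCol]
  have hblock : A * L.submatrix (growEquiv e) (growEquiv e) = Matrix.fromBlocks
      (Matrix.of fun i j => (y i ^ 3 - t ^ 3) *
        (Matrix.of fun i j => Sum.elim (fun _ => 1) (fun _ => ζ ^ 2) (e j) *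
            colMat ζ k e y i j) i j)
      (Matrix.of fun i j => (A * L.submatrix (growEquiv e) (growEquiv e)) (.inl i) (.inr j)) 0
      !![(ζ ^ 2 * t - 1) ^ (2 * k) * ((∏ m, (ζ ^ 2 * t - y m)) * (3 * ζ * t ^ 2)), 1; 0, 1] := by
    ext i j
    rcases i with i | i <;> rcases j with j | j
    · rw [hAL, hY1, hcol]; simp [colMat]
    · simp
    · rw [hAL, hcol]
      have : Y (finSumFinEquiv (.inr i : Fin M ⊕ Fin 2)) ^ 3 = t ^ 3 := by
        fin_cases i
        · simp only [Fin.zero_eta, hY2]; rw [mul_pow, h3, one_mul]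
        · simp only [Fin.mk_one, hY3]
      rw [this]; simp
    · rw [hAL, Matrix.fromBlocks_apply₂₂]
      fin_cases i <;> fin_cases j <;>
        simp only [Fin.zero_eta, Fin.mk_one, hY2, hY3, g0, g1, hcol_inr0, hcol_inl0]
      · have : (ζ * (ζ * t) - ζ * t) * (ζ * (ζ * t) - t) = 3 * ζ * t ^ 2 := by
          linear_combination (t ^ 2 * ζ * (ζ - 2)) * hζ
        rw [mul_assoc (∏ _, _), this, ← mul_assoc ζ ζ, ← sq]
        simp
      · simp
      · simp
      · simp
  have hdet := congrArg Matrix.det hblock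
  rw [Matrix.det_mul, Matrix.det_submatrix_equiv_self (growEquiv e) L, hL, mul_one, hA,
    Matrix.det_fromBlocks_zero₂₁, Matrix.det_mul_column, Matrix.det_mul_row,
    Matrix.det_fin_two_of, Equiv.prod_comp e, Fintype.prod_sum_type] at hdet
  simp only [Sum.elim_inl, Sum.elim_inr, Finset.prod_const, Finset.card_univ, Fintype.card_fin,
    one_pow, one_mul] at hdet
  rw [hdet, growFactor]
  ring

end XXZ

namespace XXZ
open Polynomial

/-- Constant relating consecutive determinants. -/
def growConst (ζ : ℂ) (r M : ℕ) : ℂ := -ζ ^ 2 * (1 - ζ) / (3 * ζ * (ζ ^ 2) ^ r * (-1) ^ M)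

lemma norm_growConst {ζ : ℂ} (hζ : ζ ^ 2 + ζ + 1 = 0) (r M : ℕ) :
    ‖growConst ζ r M‖ ^ 2 = 1 / 3 := by
  have h1 : ‖1 - ζ‖ ^ 2 = 3 := by
    have : (1 - ζ) ^ 2 = -3 * ζ := by linear_combination hζ
    rw [← norm_pow, this, norm_mul, norm_eq_one_of_cube hζ]; simp
  rw [growConst]
  simp only [norm_div, norm_mul, norm_neg, norm_pow, norm_one, norm_eq_one_of_cube hζ, one_pow,
    mul_one, one_mul, div_pow, h1]
  norm_num

/-- The determinant formula at a point. -/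
def DetFormula (ζ : ℂ) {n r M : ℕ} (k : ℕ) (e : Fin M ≃ Fin n ⊕ Fin r) (C₀ : ℂ) (y : Fin M → ℂ) :
    Prop :=
  sumFun ζ n k y * (Matrix.vandermonde y).det = C₀ * (colMat ζ k e y).det

lemma detFormula_comp_perm {ζ : ℂ} (hζ : ζ ^ 2 + ζ + 1 = 0) {n r M k : ℕ}
    (e : Fin M ≃ Fin n ⊕ Fin r) (C₀ : ℂ) (y : Fin M → ℂ) (σ : Equiv.Perm (Fin M)) :
    DetFormula ζ k e C₀ (y ∘ σ) ↔ DetFormula ζ k e C₀ y := by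
  rw [DetFormula, DetFormula, sumFun_comp_perm hζ, vandermonde_comp_perm, colMat_comp_perm]
  rcases Int.units_eq_one_or (Equiv.Perm.sign σ) with h | h <;> simp [h]

lemma detFormula_snoc {ζ : ℂ} (hζ : ζ ^ 2 + ζ + 1 = 0) {n r M k : ℕ} (hM : k + M = 2 * n)
    (e : Fin M ≃ Fin n ⊕ Fin r) {C₀ : ℂ} {y : Fin M → ℂ} (h : DetFormula ζ k e C₀ y) {t : ℂ}
    (ht : t ≠ 0) :
    DetFormula ζ k (finSumFinEquiv.symm.trans (growEquiv e)) (C₀ * growConst ζ r M)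
      (Fin.snoc (Fin.snoc y (ζ * t) : Fin (M + 1) → ℂ) t : Fin (M + 2) → ℂ) := by
  rw [DetFormula] at h ⊢
  rw [sumFun_snoc hζ hM y ht, colMat_snoc hζ, vandermonde_snoc, vandermonde_snoc,
    Fin.prod_univ_castSucc]
  simp only [Fin.snoc_castSucc, Fin.snoc_last]
  have h0 : ζ ≠ 0 := (root_ne hζ).1
  have p1 : (∏ m, (ζ ^ 2 * t - y m)) = (-1) ^ M * ∏ m, (y m - ζ ^ 2 * t) := by
    rw [← Fin.prod_const M (-1 : ℂ), ← Finset.prod_mul_distrib]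
    exact Finset.prod_congr rfl fun m _ => by ring
  have p2 : (∏ m, (y m - ζ ^ 2 * t)) * (∏ m, (ζ * t - y m)) * (∏ m, (t - y m)) =
      ∏ m, (y m ^ 3 - t ^ 3) := by
    rw [← Finset.prod_mul_distrib, ← Finset.prod_mul_distrib]
    refine Finset.prod_congr rfl fun m _ => ?_
    linear_combination ((y m - t) * (-y m * t + (ζ - 1) * t ^ 2)) * hζ
  have p3 : growConst ζ r M * (3 * ζ * (ζ ^ 2) ^ r * (-1) ^ M) = -ζ ^ 2 * (1 - ζ) := by
    rw [growConst]
    field_simp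
  have p4 : (1 - ζ ^ 2 * t) ^ (2 * k) = (ζ ^ 2 * t - 1) ^ (2 * k) := by
    rw [pow_mul, pow_mul]; congr 1; ring
  rw [growFactor, p1, ← p2, ← p4]
  set P := ∏ m, (y m - ζ ^ 2 * t)
  set Q := ∏ m, (ζ * t - y m)
  set S := ∏ m, (t - y m)
  have e1 : ((1 - ζ ^ 2 * t) ^ k * P) ^ 2 = (1 - ζ ^ 2 * t) ^ (2 * k) * P ^ 2 := by
    rw [mul_pow]; ring
  rw [e1]
  linear_combination (-ζ ^ 2 * t * (1 - ζ ^ 2 * t) ^ (2 * k) * P ^ 2 * Q * S * (t - ζ * t)) * h -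
    C₀ * (colMat ζ k e y).det * (1 - ζ ^ 2 * t) ^ (2 * k) * P ^ 2 * Q * S * t ^ 2 * p3

lemma exists_perm_apply {α : Type*} [DecidableEq α] {p q a b : α} (hpq : p ≠ q) (hab : a ≠ b) :
    ∃ σ : Equiv.Perm α, σ p = a ∧ σ q = b := by
  refine ⟨Equiv.swap p a * Equiv.swap q ((Equiv.swap p a).symm b), ?_, ?_⟩
  · rw [Equiv.Perm.mul_apply, Equiv.swap_apply_of_ne_of_ne hpq, Equiv.swap_apply_left]
    rw [Ne, Equiv.eq_symm_apply, Equiv.swap_apply_left]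
    exact hab
  · rw [Equiv.Perm.mul_apply, Equiv.swap_apply_left, Equiv.apply_symm_apply]

lemma detFormula_of_eq_mul {ζ : ℂ} (hζ : ζ ^ 2 + ζ + 1 = 0) {n r M k : ℕ} (hM : k + M = 2 * n)
    (e : Fin M ≃ Fin n ⊕ Fin r) {C₀ : ℂ} (h : ∀ y, Generic y → DetFormula ζ k e C₀ y)
    {z : ℂ} {w : Fin (M + 1) → ℂ} (hw : Generic w) {a b : Fin (M + 2)} (hab : a ≠ b)
    (h0 : a = 0 ∨ b = 0) (hb : (Fin.cons z w : Fin (M + 2) → ℂ) b ≠ 0)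
    (hmul : (Fin.cons z w : Fin (M + 2) → ℂ) a = ζ * (Fin.cons z w : Fin (M + 2) → ℂ) b) :
    DetFormula ζ k (finSumFinEquiv.symm.trans (growEquiv e)) (C₀ * growConst ζ r M)
      (Fin.cons z w : Fin (M + 2) → ℂ) := by
  set Y : Fin (M + 2) → ℂ := Fin.cons z w
  obtain ⟨σ, hp, hq⟩ := exists_perm_apply (p := (Fin.last M).castSucc) (q := Fin.last (M + 1))
    (Fin.castSucc_lt_last _).ne hab
  rw [← detFormula_comp_perm hζ _ _ Y σ]
  have hσ : Y ∘ σ = (Fin.snoc (Fin.snoc (fun m : Fin M => Y (σ m.castSucc.castSucc)) (ζ * Y b) :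
      Fin (M + 1) → ℂ) (Y b) : Fin (M + 2) → ℂ) := by
    funext i
    refine Fin.lastCases ?_ (fun i => ?_) i
    · rw [Fin.snoc_last, Function.comp_apply, hq]
    · rw [Fin.snoc_castSucc]
      refine Fin.lastCases ?_ (fun i => ?_) i
      · rw [Fin.snoc_last, Function.comp_apply, hp, hmul]
      · rw [Fin.snoc_castSucc]; rfl
  rw [hσ]
  refine detFormula_snoc hζ hM e (h _ ?_) hb
  have hne : ∀ m : Fin M, σ m.castSucc.castSucc ≠ 0 := by
    intro m hm
    rcases h0 with h0 | h0
    · rw [← h0, ← hp] at hm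
      have := Fin.castSucc_injective _ (σ.injective hm)
      exact (Fin.castSucc_lt_last m).ne this
    · rw [← h0, ← hq] at hm
      exact (Fin.castSucc_lt_last _).ne (σ.injective hm)
  have hY : ∀ m : Fin M, Y (σ m.castSucc.castSucc) = w ((σ m.castSucc.castSucc).pred (hne m)) := by
    intro m
    conv_lhs => rw [← Fin.succ_pred _ (hne m)]
    simp only [Y, Fin.cons_succ]
  simp only [hY]
  refine ⟨fun m => hw.1 _, fun m m' hm => ?_⟩
  have := Fin.pred_inj.mp (hw.2 hm)
  exact Fin.castSucc_injective _ (Fin.castSucc_injective _ (σ.injective this))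

lemma natDegree_colMat_det (ζ : ℂ) {n r M k : ℕ} (hk : n = k + r + 1) (hM : M + 1 = n + r + 1)
    (e : Fin (M + 1) ≃ Fin n ⊕ Fin (r + 1)) (w : Fin M → ℂ) :
    (colMat (C ζ) k e (Fin.cons X fun i => C (w i) : Fin (M + 1) → ℂ[X])).det.natDegree ≤
      3 * n - 2 + (r + 1) := by
  set Y : Fin (M + 1) → ℂ[X] := Fin.cons X fun i => C (w i)
  have hlin : ∀ i, (C ζ * Y i - 1).natDegree ≤ if i = 0 then 1 else 0 := by
    intro i
    refine Fin.cases ?_ (fun i => ?_) i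
    · simp only [Y, Fin.cons_zero, if_true]; compute_degree
    · simp only [Y, Fin.cons_succ, Fin.succ_ne_zero, if_false]; compute_degree
  have hY : ∀ i, (Y i).natDegree ≤ if i = 0 then 1 else 0 := by
    intro i
    refine Fin.cases ?_ (fun i => ?_) i
    · simp [Y]
    · simp [Y]
  have hdiff : ∀ i m, (C ζ * Y i - Y m).natDegree ≤
      (if i = 0 then 1 else 0) ⊔ (if m = 0 then 1 else 0) := by
    intro i m
    exact (natDegree_sub_le _ _).trans (max_le_max ((natDegree_C_mul_le _ _).trans (hY i)) (hY m))
  have hprod : ∀ i, (∏ m, (C ζ * Y i - Y m)).natDegree ≤ 1 + if i = 0 then M else 0 := by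
    intro i
    refine (natDegree_prod_le _ _).trans ?_
    rw [Fin.sum_univ_succ]
    refine add_le_add ((hdiff i 0).trans (by split_ifs <;> simp)) ?_
    refine (Finset.sum_le_sum fun m _ => hdiff i m.succ).trans ?_
    simp only [Fin.succ_ne_zero, if_false]
    split_ifs <;> simp
  have hentry : ∀ i j, (colMat (C ζ) k e Y i j).natDegree ≤
      Sum.elim (fun _ => 0) (fun _ => 1) (e j) + if i = 0 then 3 * n - 2 else 0 := by
    intro i j
    rw [colMat, Matrix.of_apply]
    rcases h : e j with a | b
    · have : (colPoly (C ζ) k (rootPoly Y) (.inl a : Fin n ⊕ Fin (r + 1))).eval (Y i) =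
        Y i ^ (3 * (a : ℕ)) := by simp [colPoly]
      rw [this]
      refine natDegree_pow_le.trans ((Nat.mul_le_mul_left _ (hY i)).trans ?_)
      have := a.2
      simp only [Sum.elim_inl]
      split_ifs <;> omega
    · rw [colPoly_inr_eval]
      have h1 := natDegree_mul_le (p := Y i ^ (b : ℕ))
        (q := (C ζ * Y i - 1) ^ (2 * k) * ∏ m, (C ζ * Y i - Y m))
      have h2 := natDegree_mul_le (p := (C ζ * Y i - 1) ^ (2 * k))
        (q := ∏ m, (C ζ * Y i - Y m))
      have h3 := hprod i
      have h4 := (natDegree_pow_le (p := Y i) (n := b)).trans (Nat.mul_le_mul_left _ (hY i))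
      have h5 := (natDegree_pow_le (p := C ζ * Y i - 1) (n := 2 * k)).trans
        (Nat.mul_le_mul_left _ (hlin i))
      have := b.2
      simp only [Sum.elim_inr]
      split_ifs at h3 h4 h5 ⊢ <;> omega
  rw [Matrix.det_apply]
  refine natDegree_sum_le_of_forall_le _ _ fun σ _ => ?_
  refine (natDegree_smul_le _ _).trans ((natDegree_prod_le _ _).trans ?_)
  refine (Finset.sum_le_sum fun i _ => hentry (σ i) i).trans ?_
  rw [Finset.sum_add_distrib, Equiv.sum_comp e, Fintype.sum_sum_type,
    Equiv.sum_comp σ fun i => if i = 0 then 3 * n - 2 else 0]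
  simp
  omega

lemma natDegree_vandermonde_det {M : ℕ} (w : Fin M → ℂ) :
    (Matrix.vandermonde (Fin.cons X fun i => C (w i) : Fin (M + 1) → ℂ[X])).det.natDegree ≤ M := by
  rw [Matrix.det_vandermonde, Fin.prod_univ_succ, Fin.prod_Ioi_zero]
  have h2 : (∏ i : Fin M, ∏ j ∈ Finset.Ioi i.succ,
      ((Fin.cons X fun i => C (w i) : Fin (M + 1) → ℂ[X]) j -
        (Fin.cons X fun i => C (w i) : Fin (M + 1) → ℂ[X]) i.succ)) =
      C (∏ i : Fin M, ∏ j ∈ Finset.Ioi i, (w j - w i)) := by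
    simp only [Fin.prod_Ioi_succ, Fin.cons_succ, map_prod, map_sub]
  rw [h2]
  refine (natDegree_mul_C_le _ _).trans ((natDegree_prod_le _ _).trans ?_)
  refine (Finset.sum_le_card_nsmul _ _ 1 fun i _ => ?_).trans (by simp)
  simp only [Fin.cons_zero, Fin.cons_succ]
  compute_degree

lemma detFormula_succ {ζ : ℂ} (hζ : ζ ^ 2 + ζ + 1 = 0) {n r M k : ℕ} (hM : k + M = 2 * n)
    (hn : n = k + r) (e : Fin M ≃ Fin n ⊕ Fin r) {C₀ : ℂ}
    (h : ∀ y, Generic y → DetFormula ζ k e C₀ y) (y : Fin (M + 2) → ℂ) (hy : Generic y) :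
    DetFormula ζ k (finSumFinEquiv.symm.trans (growEquiv e)) (C₀ * growConst ζ r M) y := by
  set e' := finSumFinEquiv.symm.trans (growEquiv e)
  set C₁ := C₀ * growConst ζ r M
  set w : Fin (M + 1) → ℂ := fun i => y i.succ
  have hyw : y = Fin.cons (y 0) w := (Fin.cons_self_tail y).symm
  have hw : Generic w := ⟨fun i => hy.1 _, fun i j hij => Fin.succ_injective _ (hy.2 hij)⟩
  obtain ⟨Q, hQ, hQe⟩ := exists_sumFun_cons ζ (n := n + 1) (by omega) k w
  set Y : Fin (M + 2) → ℂ[X] := Fin.cons X fun i => C (w i)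
  have hYe : ∀ z, (fun i => (Y i).eval z) = (Fin.cons z w : Fin (M + 2) → ℂ) := by
    intro z
    funext i
    refine Fin.cases ?_ (fun i => ?_) i <;> simp [Y]
  set p : ℂ[X] := Q * (Matrix.vandermonde Y).det - C C₁ * (colMat (C ζ) k e' Y).det
  have hpe : ∀ z, p.eval z = 0 ↔ DetFormula ζ k e' C₁ (Fin.cons z w : Fin (M + 2) → ℂ) := by
    intro z
    have h1 : (colMat (C ζ) k e' Y).det.eval z =
        (colMat ζ k e' (Fin.cons z w : Fin (M + 2) → ℂ)).det := by
      rw [← coe_evalRingHom, RingHom.map_det, RingHom.mapMatrix_apply, colMat_map]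
      simp only [coe_evalRingHom, eval_C, hYe]
    have h2 : (Matrix.vandermonde Y).det.eval z =
        (Matrix.vandermonde (Fin.cons z w : Fin (M + 2) → ℂ)).det := by
      rw [← coe_evalRingHom, RingHom.map_det, RingHom.mapMatrix_apply, ← hYe]
      congr 1
      ext i j
      simp
    rw [DetFormula, ← h1, ← h2, ← hQe]
    simp only [p, eval_sub, eval_mul, eval_C]
    exact sub_eq_zero
  have hdeg : p.natDegree < Fintype.card (Fin 3 × Fin (M + 1)) := by
    have h1 := natDegree_colMat_det ζ (n := n + 1) (r := r) (M := M + 1) (k := k) (by omega)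
      (by omega) e' w
    have h2 := natDegree_vandermonde_det w
    have h3 := natDegree_sub_le (Q * (Matrix.vandermonde Y).det) (C C₁ * (colMat (C ζ) k e' Y).det)
    have h4 := natDegree_mul_le (p := Q) (q := (Matrix.vandermonde Y).det)
    have h5 := natDegree_C_mul_le C₁ (colMat (C ζ) k e' Y).det
    rw [Fintype.card_prod, Fintype.card_fin, Fintype.card_fin]
    have h6 := max_le (h4.trans (add_le_add hQ h2)) (h5.trans (h1.trans (by omega)))
    exact lt_of_le_of_lt (h3.trans h6) (by omega)
  have h0 : ζ ≠ 0 := (root_ne hζ).1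
  have h1 : ζ ≠ 1 := sub_ne_zero.mp (root_ne hζ).2
  have h3 := cube_eq_one hζ
  have hinj : Function.Injective fun q : Fin 3 × Fin (M + 1) => ζ ^ (q.1 : ℕ) * w q.2 := by
    rintro ⟨a, i⟩ ⟨b, j⟩ hab
    simp only at hab
    have hij : i = j := by
      refine hw.2 ?_
      have := congrArg (· ^ 3) hab
      simp only [mul_pow, ← pow_mul, mul_comm _ 3] at this
      simpa [pow_mul, h3] using this
    subst hij
    have := mul_right_cancel₀ (hw.1 i) hab
    have h2 : ζ ^ 2 ≠ 1 := fun h2 => h1 (by linear_combination h3 - ζ * h2)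
    have h4 : ζ ≠ ζ ^ 2 := fun h4 => h1 (by linear_combination h3 + (ζ + 1) * h4)
    clear hab hn hM
    fin_cases a <;> fin_cases b <;> simp only [pow_zero, pow_one] at this <;>
      first | rfl | exact absurd this h1 | exact absurd this.symm h1 | exact absurd this h2 |
        exact absurd this.symm h2 | exact absurd this h4 | exact absurd this.symm h4
  have hp0 : p = 0 := by
    refine eq_zero_of_natDegree_lt_card_of_eval_eq_zero p hinj ?_ hdeg
    rintro ⟨a, i⟩
    rw [hpe]
    fin_cases a
    · have hne : (0 : Fin (M + 2)) ≠ i.succ := (Fin.succ_ne_zero i).symm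
      have hr : (Fin.cons (w i) w : Fin (M + 2) → ℂ) 0 =
          (Fin.cons (w i) w : Fin (M + 2) → ℂ) i.succ := by
        simp
      simp only [pow_zero, one_mul]
      rw [DetFormula, Matrix.det_zero_of_row_eq hne, Matrix.det_zero_of_row_eq hne, mul_zero,
          mul_zero]
      · funext j; simp only [colMat, Matrix.of_apply, hr]
      · funext j; simp only [Matrix.vandermonde_apply, hr]
    · simp only [pow_one]
      exact detFormula_of_eq_mul hζ hM e h hw (a := 0) (b := i.succ) (Fin.succ_ne_zero i).symm
        (Or.inl rfl) (by simpa using hw.1 i) (by simp)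
    · refine detFormula_of_eq_mul hζ hM e h hw (a := i.succ) (b := 0) (Fin.succ_ne_zero i)
        (Or.inr rfl) (by simpa [h0] using hw.1 i) ?_
      simp only [Fin.cons_zero, Fin.cons_succ]
      linear_combination (-w i) * h3
  rw [hyw, ← hpe, hp0, eval_zero]

lemma detFormula_zero {ζ : ℂ} (hζ : ζ ^ 2 + ζ + 1 = 0) (n : ℕ) (y : Fin n → ℂ) :
    DetFormula ζ n (Equiv.sumEmpty (Fin n) (Fin 0)).symm (3 ^ n.choose 2) y := by
  rw [DetFormula, sumFun_base hζ]
  congr 2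
  ext i j
  simp [colMat, colPoly, pow_mul]

lemma exists_detFormula {ζ : ℂ} (hζ : ζ ^ 2 + ζ + 1 = 0) (k r : ℕ) :
    ∃ (e : Fin (k + r + r) ≃ Fin (k + r) ⊕ Fin r) (C₀ : ℂ),
      ‖C₀‖ ^ 2 * 3 ^ r = (3 ^ k.choose 2) ^ 2 ∧ ∀ y, Generic y → DetFormula ζ k e C₀ y := by
  induction r with
  | zero =>
    refine ⟨(Equiv.sumEmpty (Fin k) (Fin 0)).symm, 3 ^ k.choose 2, by simp, fun y _ =>
      detFormula_zero hζ k y⟩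
  | succ r ih =>
    obtain ⟨e, C₀, hC, h⟩ := ih
    have key : ∀ N, N = k + r + r + 2 → ∃ e' : Fin N ≃ Fin (k + r + 1) ⊕ Fin (r + 1),
        ∀ y, Generic y → DetFormula ζ k e' (C₀ * growConst ζ r (k + r + r)) y := by
      rintro N rfl
      exact ⟨_, fun y hy => detFormula_succ hζ (by omega) rfl e h y hy⟩
    obtain ⟨e', he'⟩ := key (k + (r + 1) + (r + 1)) (by omega)
    refine ⟨e', C₀ * growConst ζ r (k + r + r), ?_, he'⟩
    rw [norm_mul, mul_pow, norm_growConst hζ, pow_succ, ← hC]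
    ring

/-- The value of `sumFun` at the homogeneous point. -/
lemma norm_sumFun_one {ζ : ℂ} (hζ : ζ ^ 2 + ζ + 1 = 0) {n k r : ℕ} (hn : n = k + r) :
    ‖sumFun ζ n k (fun _ : Fin (n + r) => (1 : ℂ))‖ ^ 2 * 3 ^ r =
      (3 ^ k.choose 2) ^ 2 * homNorm ζ n k r ^ 2 := by
  subst hn
  obtain ⟨e, C₀, hC, h⟩ := exists_detFormula hζ k r
  rw [eval_one_of_det ζ C₀ e _ (continuous_sumFun ζ _ k _) h, norm_mul, homNorm_eq, ← hC]
  ring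

end XXZ

namespace XXZ
open MvPolynomial

lemma map_heckeOp (σ : ℂ →+* ℂ) (ζ : ℂ) (i : ℕ) (f : MvPolynomial ℕ ℂ) :
    map σ (heckeOp ζ i f) = heckeOp (σ ζ) i (map σ f) := by
  refine (heckeOp_unique ?_).symm
  have h := congrArg (map σ) (heckeOp_spec ζ i f)
  have hs : map σ (sw i f) = sw i (map σ f) := map_rename σ _ f
  simpa only [map_mul, map_sub, map_one, map_X, map_C, hs] using h

lemma map_ins (σ : ℂ →+* ℂ) (ζ : ℂ) (p s : ℕ) (g : MvPolynomial ℕ ℂ) :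
    map σ (ins ζ p s g) = ins (σ ζ) p s (map σ g) := by
  induction p generalizing s with
  | zero => rfl
  | succ p ih => rw [ins, ins, map_heckeOp, ih]

lemma map_compOp (σ : ℂ →+* ℂ) (ζ : ℂ) (l : List Bool) (s : ℕ) (g : MvPolynomial ℕ ℂ) :
    map σ (compOp ζ l s g) = compOp (σ ζ) l s (map σ g) := by
  induction l generalizing s g with
  | nil => rfl
  | cons x l ih => cases x <;> simp [compOp, ih, map_ins]

lemma map_pairProd (σ : ℂ →+* ℂ) (ζ : ℂ) (n s : ℕ) :
    map σ (pairProd ζ n s) = pairProd (σ ζ) n s := by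
  induction n generalizing s with
  | zero => simp [pairProd]
  | succ n ih => simp [pairProd, ih, map_prod]

lemma map_comp (σ : ℂ →+* ℂ) (ζ : ℂ) (n : ℕ) (l : List Bool) :
    map σ (comp ζ n l) = comp (σ ζ) n l := by
  simp only [comp, map_compOp, baseComp, map_mul, map_pairProd]

lemma conj_eq_sq {ζ : ℂ} (hζ : ζ ^ 2 + ζ + 1 = 0) : starRingEnd ℂ ζ = ζ ^ 2 := by
  have h1 : ζ * starRingEnd ℂ ζ = 1 := by
    rw [Complex.mul_conj, Complex.normSq_eq_norm_sq, norm_eq_one_of_cube hζ]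
    norm_num
  have h0 := (root_ne hζ).1
  refine mul_left_cancel₀ h0 ?_
  rw [h1]
  linear_combination -cube_eq_one hζ

lemma groundVec_sq {ζ : ℂ} (hζ : ζ ^ 2 + ζ + 1 = 0) (n : ℕ) (l : List Bool) :
    eval (fun _ => 1) (comp (ζ ^ 2) n l) = starRingEnd ℂ (eval (fun _ => 1) (comp ζ n l)) := by
  rw [← conj_eq_sq hζ, ← map_comp, eval_map, eval₂_comp]
  congr 1
  funext _
  simp

/-- Squared norm of the part of the ground vector whose first `k` spins are up. -/
def upNorm (ζ : ℂ) (n k : ℕ) : ℝ :=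
  wsum (2 * n - k) fun w => ‖groundVec ζ n (List.replicate k true ++ w)‖ ^ 2

lemma wsum_nonneg {L : ℕ} {g : List Bool → ℝ} (hg : ∀ l, 0 ≤ g l) : 0 ≤ wsum L g := by
  induction L generalizing g with
  | zero => exact hg _
  | succ L ih => exact add_nonneg (ih fun _ => hg _) (ih fun _ => hg _)

lemma le_wsum {L : ℕ} {g : List Bool → ℝ} (hg : ∀ l, 0 ≤ g l) {l : List Bool} (hl : l.length = L) :
    g l ≤ wsum L g := by
  induction L generalizing g l with
  | zero => rw [List.eq_nil_of_length_eq_zero hl]; rfl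
  | succ L ih =>
    obtain _ | ⟨x, l⟩ := l
    · simp at hl
    · have h := ih (g := fun l => g (x :: l)) (fun _ => hg _) (by simpa using hl)
      cases x
      · exact h.trans (le_add_of_nonneg_left (wsum_nonneg fun _ => hg _))
      · exact h.trans (le_add_of_nonneg_right (wsum_nonneg fun _ => hg _))

lemma upNorm_pos {ζ : ℂ} (hζ : ζ ^ 2 + ζ + 1 = 0) {n k : ℕ} (hk : k ≤ n) : 0 < upNorm ζ n k := by
  have h0 := groundVec_sorted_ne_zero hζ n
  have e : sorted n n =
      List.replicate k true ++ (List.replicate (n - k) true ++ List.replicate n false) := by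
    rw [← List.append_assoc, ← List.replicate_add, show k + (n - k) = n by omega, sorted]
  rw [e] at h0
  refine (by positivity : 0 < ‖_‖ ^ 2).trans_le
    (le_wsum (g := fun w => ‖groundVec ζ n (List.replicate k true ++ w)‖ ^ 2)
      (fun _ => by positivity) (l := List.replicate (n - k) true ++ List.replicate n false) ?_)
  simp
  omega

lemma eval_term_one {ζ : ℂ} (hζ : ζ ^ 2 + ζ + 1 = 0) (n : ℕ) (l : List Bool) :
    eval (fun _ => 1) (term ζ n l) = ((‖groundVec ζ n l‖ ^ 2 : ℝ) : ℂ) := by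
  rw [term, groundVec]
  split_ifs
  · rw [map_mul, map_mul, groundVec_sq hζ, eval_upMon_eq_one _ _ (fun _ _ => rfl), mul_one,
      Complex.mul_conj, Complex.normSq_eq_norm_sq]
  · simp

lemma norm_sumFun_eq {ζ : ℂ} (hζ : ζ ^ 2 + ζ + 1 = 0) {n k r : ℕ} (hn : n = k + r) :
    ‖sumFun ζ n k (fun _ : Fin (n + r) => (1 : ℂ))‖ = upNorm ζ n k := by
  have h : sumFun ζ n k (fun _ : Fin (n + r) => (1 : ℂ)) = (upNorm ζ n k : ℂ) := by
    rw [sumFun, eval_sumPoly_congr ζ (w := fun _ => 1) fun j hj => ?_, eval_sumPoly, upNorm,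
      show 2 * n - k = n + r by omega]
    · simp only [eval_term_one hζ]
      exact (map_wsum (Complex.ofRealHom : ℝ →+ ℂ) _ _).symm
    · unfold pt
      split_ifs
      · rfl
      · rfl
      · omega
  rw [h, Complex.norm_real, Real.norm_of_nonneg (upNorm_pos hζ (by omega)).le]

lemma wsum_succ_last {L : ℕ} (g : List Bool → ℝ) :
    wsum (L + 1) g = wsum L fun l => g (l ++ [true]) + g (l ++ [false]) := by
  rw [wsum_add_length]
  rfl

lemma wsum_succ_first {L : ℕ} (g : List Bool → ℝ) :
    wsum (L + 1) g = wsum L fun l => g (true :: l) + g (false :: l) := by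
  rw [wsum_add]
  rfl

lemma wsum_getD_eq {L : ℕ} {g : List Bool → ℝ} (hg : ∀ x l, g (x :: l) = g (l ++ [x])) {j : ℕ}
    (hj : j ≤ L) : (wsum (L + 1) fun l => if l.getD j false then g l else 0) =
      wsum L fun l => g (true :: l) := by
  induction j with
  | zero =>
    rw [wsum_succ_first]
    simp
  | succ j ih =>
    rw [← ih (by omega), wsum_succ_first, wsum_succ_last]
    refine wsum_congr fun l hl => ?_
    simp only [List.getD_cons_succ, hg]
    rw [List.getD_append _ _ _ _ (by omega), List.getD_append _ _ _ _ (by omega)]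

lemma sum_getD_eq_count (l : List Bool) :
    (∑ j ∈ Finset.range l.length, if l.getD j false then (1 : ℝ) else 0) = l.count true := by
  induction l with
  | nil => simp
  | cons x l ih =>
    rw [List.length_cons, Finset.sum_range_succ']
    simp only [List.getD_cons_succ, ih, List.getD_cons_zero]
    cases x <;> simp

lemma wsum_finset_sum {ι : Type*} (s : Finset ι) (L : ℕ) (g : ι → List Bool → ℝ) :
    (wsum L fun l => ∑ j ∈ s, g j l) = ∑ j ∈ s, wsum L (g j) := by
  induction L generalizing g with
  | zero => rfl
  | succ L ih => simp only [wsum, ih, Finset.sum_add_distrib]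

lemma wsum_count_mul {L : ℕ} {g : List Bool → ℝ} (hg : ∀ x l, g (x :: l) = g (l ++ [x])) :
    (wsum (L + 1) fun l => (l.count true : ℝ) * g l) =
      (L + 1) * wsum L fun l => g (true :: l) := by
  have h : (wsum (L + 1) fun l => (l.count true : ℝ) * g l) =
      ∑ j ∈ Finset.range (L + 1), wsum (L + 1) fun l => if l.getD j false then g l else 0 := by
    rw [← wsum_finset_sum]
    refine wsum_congr fun l hl => ?_
    rw [← sum_getD_eq_count, hl, Finset.sum_mul]
    simp
  rw [h, Finset.sum_congr rfl fun j hj => wsum_getD_eq hg (by simpa [Nat.lt_succ_iff] using hj)]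
  simp

lemma upNorm_zero {ζ : ℂ} (hζ : ζ ^ 2 + ζ + 1 = 0) {n : ℕ} (hn : 1 ≤ n) :
    upNorm ζ n 0 = 2 * upNorm ζ n 1 := by
  have hg : ∀ x l, ‖groundVec ζ n (x :: l)‖ ^ 2 = ‖groundVec ζ n (l ++ [x])‖ ^ 2 := by
    intro x l
    conv_lhs => rw [← rho_groundVec hζ hn, rho_cons, norm_mul, norm_kap hζ, one_mul]
  have h := wsum_count_mul (L := 2 * n - 1) (g := fun l => ‖groundVec ζ n l‖ ^ 2) hg
  have e : (wsum (2 * n - 1 + 1) fun l => (l.count true : ℝ) * ‖groundVec ζ n l‖ ^ 2) =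
      n * upNorm ζ n 0 := by
    rw [upNorm, mul_wsum, show 2 * n - 1 + 1 = 2 * n - 0 by omega]
    refine wsum_congr fun l _ => ?_
    simp only [List.replicate_zero, List.nil_append]
    by_cases hl : l.count true = n
    · rw [hl]
    · rw [groundVec, if_neg fun h => hl h.1]
      simp
  have e' : (wsum (2 * n - 1) fun l => ‖groundVec ζ n (true :: l)‖ ^ 2) = upNorm ζ n 1 := rfl
  rw [e, e', Nat.cast_sub (by omega)] at h
  have hn' : (n : ℝ) ≠ 0 := by exact_mod_cast (by omega : n ≠ 0)
  push_cast at h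
  refine mul_left_cancel₀ hn' ?_
  linear_combination h

lemma sum_cfg_eq_wsum {N k : ℕ} (hk : k ≤ N) (g : List Bool → ℂ) :
    (∑ a : Cfg N, if ∀ i : Fin N, i.val < k → a i = true then g (List.ofFn a) else 0) =
      wsum (N - k) fun w => g (List.replicate k true ++ w) := by
  induction N generalizing k g with
  | zero =>
    obtain rfl : k = 0 := by omega
    simp [wsum]
  | succ N ih =>
    have e : ∀ f : Cfg (N + 1) → ℂ,
        ∑ a, f a = (∑ a : Cfg N, f (Fin.cons true a)) + ∑ a : Cfg N, f (Fin.cons false a) := by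
      intro f
      rw [← (Fin.consEquiv fun _ => Bool).sum_comp, Fintype.sum_prod_type, Fintype.sum_bool]
      rfl
    rw [e]
    simp only [Fin.forall_fin_succ, Fin.cons_zero, Fin.cons_succ, List.ofFn_cons, Fin.val_zero,
      Fin.val_succ]
    obtain _ | k := k
    · have h1 := ih (Nat.zero_le N) (fun l => g (true :: l))
      have h2 := ih (Nat.zero_le N) (fun l => g (false :: l))
      simp only [Nat.not_lt_zero, false_imp_iff, implies_true, if_true, and_true, Nat.sub_zero,
        List.replicate_zero, List.nil_append] at h1 h2 ⊢
      rw [h1, h2]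
      rfl
    · have h1 := ih (Nat.le_of_succ_le_succ hk) (fun l => g (true :: l))
      simp only [Nat.succ_lt_succ_iff, Nat.zero_lt_succ, true_imp_iff, true_and, false_and,
        Bool.false_eq_true, if_false, Finset.sum_const_zero, add_zero]
      rw [h1, show N + 1 - (k + 1) = N - k by omega]
      rfl

lemma pUp_mulVec {N : ℕ} (i : Fin N) (Ψ : Cfg N → ℂ) (a : Cfg N) :
    (pUp N i).mulVec Ψ a = if a i = true then Ψ a else 0 := by
  rw [pUp, Matrix.smul_mulVec, Matrix.add_mulVec, Matrix.one_mulVec, Pi.smul_apply, Pi.add_apply,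
    localOp_mulVec, Fintype.sum_bool]
  cases h : a i
  · rw [show Function.update a i false = a by rw [← h, Function.update_eq_self]]
    simp [sigmaZ]
  · rw [show Function.update a i true = a by rw [← h, Function.update_eq_self]]
    simp [sigmaZ]
    ring

lemma projProd_mulVec {N : ℕ} (k : ℕ) (Ψ : Cfg N → ℂ) (a : Cfg N) :
    (projProd N k).mulVec Ψ a = if ∀ i : Fin N, i.val < k → a i = true then Ψ a else 0 := by
  have h : ∀ l : List (Fin N), ((l.map (pUp N)).prod).mulVec Ψ a =
      if ∀ i ∈ l, a i = true then Ψ a else 0 := by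
    intro l
    induction l with
    | nil => simp
    | cons i l ih =>
      rw [List.map_cons, List.prod_cons, ← Matrix.mulVec_mulVec, pUp_mulVec, ih]
      simp only [List.forall_mem_cons, ite_and]
  rw [projProd, h]
  simp

lemma hermInner_projProd {ζ c : ℂ} {n k : ℕ} (hk : k ≤ n) {Ψ : Cfg (2 * n) → ℂ}
    (hΨ : ∀ a, Ψ a = c * groundVec ζ n (List.ofFn a)) :
    hermInner Ψ ((projProd (2 * n) k).mulVec Ψ) = ((‖c‖ ^ 2 * upNorm ζ n k : ℝ) : ℂ) := by
  have e : ((upNorm ζ n k : ℝ) : ℂ) = wsum (2 * n - k) fun w =>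
      ((‖groundVec ζ n (List.replicate k true ++ w)‖ ^ 2 : ℝ) : ℂ) :=
    map_wsum (Complex.ofRealHom : ℝ →+ ℂ) _ _
  rw [Complex.ofReal_mul, e, ← sum_cfg_eq_wsum (by omega)
    (fun l => ((‖groundVec ζ n l‖ ^ 2 : ℝ) : ℂ)), hermInner, Finset.mul_sum]
  refine Finset.sum_congr rfl fun a _ => ?_
  rw [projProd_mulVec, mul_ite, mul_ite, mul_zero, mul_zero]
  refine if_congr Iff.rfl ?_ rfl
  rw [mul_comm, Complex.mul_conj, Complex.normSq_eq_norm_sq, hΨ, norm_mul, mul_pow]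
  push_cast
  rfl

lemma hermInner_self {N : ℕ} (Ψ : Cfg N → ℂ) :
    hermInner Ψ Ψ = hermInner Ψ ((projProd N 0).mulVec Ψ) := by
  congr 1
  funext a
  rw [projProd_mulVec]
  simp

lemma EFP_eq {ζ c : ℂ} (hc : c ≠ 0) {n k : ℕ} (hk : k ≤ n) {Ψ : Cfg (2 * n) → ℂ}
    (hΨ : ∀ a, Ψ a = c * groundVec ζ n (List.ofFn a)) :
    EFP Ψ k = ((upNorm ζ n k / upNorm ζ n 0 : ℝ) : ℂ) := by
  have hc' : ‖c‖ ^ 2 ≠ 0 := by positivity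
  rw [EFP, hermInner_self, hermInner_projProd hk hΨ, hermInner_projProd (Nat.zero_le n) hΨ,
    ← Complex.ofReal_div, mul_div_mul_left _ _ hc']

lemma upNorm_succ {ζ : ℂ} (hζ : ζ ^ 2 + ζ + 1 = 0) {n k r : ℕ} (hn : n = k + 1 + r) :
    upNorm ζ n k * √3 * 3 ^ k * (n + r).factorial =
      upNorm ζ n (k + 1) * (2 * n + k).factorial *
        ‖hahnFun ζ n (Polynomial.X ^ r * hahn n r)‖ := by
  have h0 := norm_sumFun_one hζ (show n = k + (r + 1) by omega)
  have h1 := norm_sumFun_one hζ hn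
  have h2 := homNorm_succ hζ hn
  rw [norm_sumFun_eq hζ (by omega)] at h0 h1
  have p0 := upNorm_pos hζ (show k ≤ n by omega)
  have p1 := upNorm_pos hζ (show k + 1 ≤ n by omega)
  rw [← sq_eq_sq₀ (by positivity) (by positivity)]
  have h3 : (√3 : ℝ) ^ 2 = 3 := Real.sq_sqrt (by norm_num)
  have h4 : (3 : ℝ) ^ (k + 1).choose 2 = 3 ^ k.choose 2 * 3 ^ k := by
    rw [Nat.choose_succ_left _ _ (by norm_num), Nat.choose_one_right, pow_add, mul_comm]
  rw [h4] at h1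
  have h5 := congrArg (· ^ 2) h2
  simp only [mul_pow] at h5 ⊢
  rw [h3]
  refine mul_left_cancel₀ (show (3 : ℝ) ^ r ≠ 0 by positivity) ?_
  generalize homNorm ζ n k (r + 1) = A at *
  generalize homNorm ζ n (k + 1) r = B at *
  generalize ‖hahnFun ζ n (Polynomial.X ^ r * hahn n r)‖ = H at *
  rw [pow_succ] at h0
  linear_combination ((3 : ℝ) ^ k) ^ 2 * ((n + r).factorial : ℝ) ^ 2 * h0 -
    ((2 * n + k).factorial : ℝ) ^ 2 * H ^ 2 * h1 +
    (3 ^ k.choose 2) ^ 2 * ((3 : ℝ) ^ k) ^ 2 * h5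

lemma norm_hahnFun_mul {ζ : ℂ} (hζ : ζ ^ 2 + ζ + 1 = 0) {n k r : ℕ} (hn : n = k + 1 + r) :
    ‖hahnFun ζ n (Polynomial.X ^ r * hahn n r)‖ *
        (k.factorial * (3 * k + 1).factorial * (n + k).factorial) =
      √3 * 3 ^ k * ((2 * k).factorial * (2 * k + 1).factorial * r.factorial) := by
  induction k generalizing r with
  | zero =>
    obtain rfl : n = r + 1 := by omega
    have h0 := upNorm_succ hζ (k := 0) (r := r) (n := r + 1) (by omega)
    have p1 := upNorm_pos hζ (show 1 ≤ r + 1 by omega)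
    rw [upNorm_zero hζ (by omega)] at h0
    have e1 : ((2 * (r + 1) + 0).factorial : ℝ) = 2 * (r + 1) * ((r + 1 + r).factorial : ℝ) := by
      rw [show 2 * (r + 1) + 0 = r + 1 + r + 1 by omega, Nat.factorial_succ]
      push_cast
      ring
    have e2 : ((r + 1 + 0).factorial : ℝ) = (r + 1) * r.factorial := by
      rw [Nat.add_zero, Nat.factorial_succ]
      push_cast
      ring
    rw [e1] at h0
    rw [e2]
    have hf : ((r + 1 + r).factorial : ℝ) ≠ 0 := by positivity
    refine mul_left_cancel₀ (mul_ne_zero (mul_ne_zero two_ne_zero p1.ne') hf) ?_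
    simp only [pow_zero, mul_zero, zero_add, Nat.factorial_zero, Nat.factorial_one, Nat.cast_one,
      one_mul, mul_one] at h0 ⊢
    linear_combination -(r.factorial : ℝ) * h0
  | succ k ih =>
    have h := ih (r := r + 1) (by omega)
    have hc : ‖hahnCoeff n (r + 1)‖ * (4 * (2 * k + 1) * (2 * k + 3)) =
        (r + 1) * (n + k + 1) * ((3 * k + 2) * (3 * k + 4)) := by
      have e : hahnCoeff n (r + 1) = (((r + 1) * (n + k + 1) * ((3 * k + 2) * (3 * k + 4)) /
          (4 * (2 * k + 1) * (2 * k + 3)) : ℝ) : ℂ) := by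
        have e0 : ((n : ℂ) - ((r + 1 : ℕ) : ℂ)) = k + 1 := by
          rw [hn]
          push_cast
          ring
        have d1 : (2 * (k : ℂ) + 1) ≠ 0 := by exact_mod_cast (by omega : 2 * k + 1 ≠ 0)
        have d2 : (2 * (k : ℂ) + 3) ≠ 0 := by exact_mod_cast (by omega : 2 * k + 3 ≠ 0)
        have d3 : (4 * (4 * ((k : ℂ) + 1) ^ 2 - 1)) = 4 * (2 * k + 1) * (2 * k + 3) := by ring
        rw [hahnCoeff, e0, d3]
        push_cast
        congr 1
        rw [hn]
        push_cast
        ring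
      rw [e, Complex.norm_real, Real.norm_of_nonneg (by positivity)]
      field_simp
    have hs : ‖hahnFun ζ n (Polynomial.X ^ (r + 1) * hahn n (r + 1))‖ =
        ‖hahnFun ζ n (Polynomial.X ^ r * hahn n r)‖ * ‖hahnCoeff n (r + 1)‖ := by
      rw [← norm_mul, hahnFun_norm hζ n r (by omega), hahnFun_norm hζ n (r + 1) (by omega),
        Finset.prod_range_succ, mul_assoc]
    rw [hs] at h
    have f1 : ((3 * (k + 1) + 1).factorial : ℝ) =
        (3 * k + 4) * ((3 * k + 3) * ((3 * k + 2) * (3 * k + 1).factorial)) := by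
      rw [show 3 * (k + 1) + 1 = 3 * k + 1 + 1 + 1 + 1 by ring]
      simp only [Nat.factorial_succ]
      push_cast
      ring
    have f2 : ((2 * (k + 1)).factorial : ℝ) =
        (2 * k + 2) * ((2 * k + 1) * (2 * k).factorial) := by
      rw [show 2 * (k + 1) = 2 * k + 1 + 1 by ring]
      simp only [Nat.factorial_succ]
      push_cast
      ring
    have f3 : ((2 * (k + 1) + 1).factorial : ℝ) =
        (2 * k + 3) * ((2 * k + 2) * (2 * k + 1).factorial) := by
      rw [show 2 * (k + 1) + 1 = (2 * k + 1) + 1 + 1 by ring, Nat.factorial_succ,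
        Nat.factorial_succ (2 * k + 1)]
      push_cast
      ring
    have f4 : ((n + (k + 1)).factorial : ℝ) = (n + k + 1) * (n + k).factorial := by
      rw [← add_assoc, Nat.factorial_succ]
      push_cast
      ring
    have f5 : ((r + 1).factorial : ℝ) = (r + 1) * r.factorial := by
      rw [Nat.factorial_succ]
      push_cast
      ring
    have f6 : ((k + 1).factorial : ℝ) = (k + 1) * k.factorial := by
      rw [Nat.factorial_succ]
      push_cast
      ring
    rw [f1, f2, f3, f4, f6]
    rw [f5] at h
    refine mul_left_cancel₀ (show ((r : ℝ) + 1) ≠ 0 by positivity) ?_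
    rw [pow_succ]
    generalize ‖hahnFun ζ n (Polynomial.X ^ r * hahn n r)‖ = H at *
    generalize ‖hahnCoeff n (r + 1)‖ = c at *
    generalize ((3 * k + 1).factorial : ℝ) = F1 at *
    generalize ((2 * k + 1).factorial : ℝ) = F3 at *
    generalize ((2 * k).factorial : ℝ) = F2 at *
    generalize ((n + k).factorial : ℝ) = F4 at *
    generalize (r.factorial : ℝ) = F5 at *
    generalize (k.factorial : ℝ) = F6 at *
    linear_combination 12 * ((k : ℝ) + 1) ^ 2 * (2 * k + 1) * (2 * k + 3) * h -
      3 * ((k : ℝ) + 1) ^ 2 * H * F1 * F4 * F6 * hc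

lemma upNorm_ratio {ζ : ℂ} (hζ : ζ ^ 2 + ζ + 1 = 0) {n k r : ℕ} (hn : n = k + 1 + r) :
    upNorm ζ n k * (k.factorial * (3 * k + 1).factorial * (n + r).factorial * (n + k).factorial) =
      upNorm ζ n (k + 1) *
        ((2 * k).factorial * (2 * k + 1).factorial * (2 * n + k).factorial * r.factorial) := by
  have h1 := upNorm_succ hζ hn
  have h2 := norm_hahnFun_mul hζ hn
  have h3 : √(3 : ℝ) * 3 ^ k ≠ 0 := by positivity
  refine mul_left_cancel₀ h3 ?_
  linear_combination (k.factorial * (3 * k + 1).factorial * (n + k).factorial : ℝ) * h1 +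
    upNorm ζ n (k + 1) * (2 * n + k).factorial * h2

end XXZ
theorem EFP_ratio_even (n k : ℕ) (hn : 1 ≤ n) (hk : 1 ≤ k) (hkn : k ≤ n)
    (Ψ : Cfg (2*n) → ℂ) (hΨ : Ψ ≠ 0) (E₀ : ℝ)
    (hground : (Htw (2*n) (by omega)).mulVec Ψ = (E₀ : ℂ) • Ψ)
    (hmin : ∀ (E : ℂ) (v : Cfg (2*n) → ℂ), v ≠ 0 →
      (Htw (2*n) (by omega)).mulVec v = E • v → E₀ ≤ E.re)
    (hSz : (Sz (2*n)).mulVec Ψ = 0) :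
    EFP Ψ (k-1) ≠ 0 ∧ EFP Ψ k ≠ 0 ∧
      EFP Ψ (k-1) / EFP Ψ k =
        (((2*k-2).factorial : ℂ) * ((2*k-1).factorial : ℂ) * ((2*n+k-1).factorial : ℂ) *
          ((n-k).factorial : ℂ)) /
        (((k-1).factorial : ℂ) * ((3*k-2).factorial : ℂ) * ((2*n-k).factorial : ℂ) *
          ((n+k-1).factorial : ℂ)) := by
  obtain ⟨c, hc, hΨc⟩ := XXZ.ground_eq_smul hn hΨ hground hmin hSz
  have hω := XXZ.omega3_spec
  obtain ⟨k, rfl⟩ : ∃ j, k = j + 1 := ⟨k - 1, by omega⟩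
  obtain ⟨r, rfl⟩ : ∃ r, n = k + 1 + r := ⟨n - (k + 1), by omega⟩
  have p0 := XXZ.upNorm_pos hω (Nat.zero_le (k + 1 + r))
  have p1 := XXZ.upNorm_pos hω (show k ≤ k + 1 + r by omega)
  have p2 := XXZ.upNorm_pos hω hkn
  have h := XXZ.upNorm_ratio hω (rfl : k + 1 + r = k + 1 + r)
  rw [Nat.add_sub_cancel, XXZ.EFP_eq hc (by omega) hΨc, XXZ.EFP_eq hc hkn hΨc]
  refine ⟨?_, ?_, ?_⟩
  · exact_mod_cast (div_pos p1 p0).ne'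
  · exact_mod_cast (div_pos p2 p0).ne'
  · rw [← Complex.ofReal_div, div_div_div_cancel_right₀ p0.ne']
    have e : XXZ.upNorm omega3 (k + 1 + r) k / XXZ.upNorm omega3 (k + 1 + r) (k + 1) =
        ((2 * k).factorial * (2 * k + 1).factorial * (2 * (k + 1 + r) + k).factorial *
          r.factorial) / (k.factorial * (3 * k + 1).factorial * (k + 1 + r + r).factorial *
            (k + 1 + r + k).factorial) := by
      rw [div_eq_div_iff p2.ne' (by positivity)]
      linear_combination h
    rw [e, show 2 * (k + 1) - 2 = 2 * k by omega, show 2 * (k + 1) - 1 = 2 * k + 1 by omega,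
      show 2 * (k + 1 + r) + (k + 1) - 1 = 2 * (k + 1 + r) + k by omega,
      show k + 1 + r - (k + 1) = r by omega, show 3 * (k + 1) - 2 = 3 * k + 1 by omega,
      show 2 * (k + 1 + r) - (k + 1) = k + 1 + r + r by omega,
      show k + 1 + r + (k + 1) - 1 = k + 1 + r + k by omega]
    push_cast
    rfl
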